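/- arXiv:2408.05015 — 2 statements merged into one kernel-verified Lean document; each statement's English description precedes it below -/
import Mathlib

section
/- Let q be a prime power, m ≥ 1, n = 2m−1, and fix a point P_0 of F_q^{2m}. Then the family of functions {χ_j^P : j ∈ {1,…,m}, P a point of F_q^{2m} with P ≠ P_0} is a basis of the eigenspace of the eigenvalue −q^{2m²−2m} of the adjacency operator of the opposition graph on maximal flags of F_q^{2m}; in particular this eigenspace has dimension m·(q^{2m}−q)/(q−1). -/
open Matrix

def MaxFlag2 (F : Type) [Field F] (m : ℕ) : Type :=
  {U : Fin (2 * m + 1) → Submodule F (Fin (2 * m) → F) //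
    Monotone U ∧ ∀ k : Fin (2 * m + 1), Module.finrank F (U k) = (k : ℕ)}

instance (F : Type) [Field F] [Fintype F] (m : ℕ) : Finite (MaxFlag2 F m) :=
  Subtype.finite

noncomputable instance (F : Type) [Field F] [Fintype F] (m : ℕ) : Fintype (MaxFlag2 F m) :=
  Fintype.ofFinite _

/-- The points of `F^(2m)`: one-dimensional subspaces. -/
def Point2 (F : Type) [Field F] (m : ℕ) : Type :=
  {X : Submodule F (Fin (2 * m) → F) // Module.finrank F X = 1}

noncomputable def flagMem2 {F : Type} [Field F] {m : ℕ} (c : MaxFlag2 F m) (k : ℕ) :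
    Submodule F (Fin (2 * m) → F) :=
  if h : k < 2 * m + 1 then c.1 ⟨k, h⟩ else ⊤

def Opp2 {F : Type} [Field F] {m : ℕ} (c d : MaxFlag2 F m) : Prop :=
  ∀ i : Fin (2 * m + 1), c.1 i ⊓ d.1 i.rev = ⊥

open Classical in
noncomputable def adj2 (F : Type) [Field F] [Fintype F] (m : ℕ) :
    Matrix (MaxFlag2 F m) (MaxFlag2 F m) ℂ :=
  fun c d => if Opp2 c d then 1 else 0

open Classical in
noncomputable def chi2 (F : Type) [Field F] [Fintype F] (m : ℕ) (j : ℕ)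
    (P : Submodule F (Fin (2 * m) → F)) (c : MaxFlag2 F m) : ℂ :=
  if P ≤ flagMem2 c (m - j) then 0
  else if P ≤ flagMem2 c m then (Fintype.card F : ℂ) ^ j
  else if P ≤ flagMem2 c (m + j) then -1
  else 0

section Hecke

variable {E : Type*} [NormedAddCommGroup E] [InnerProductSpace ℝ E]

/-- A symmetric endomorphism has an eigenvector in every nonzero invariant subspace. -/
theorem LinearMap.IsSymmetric.exists_eigenvector_mem [FiniteDimensional ℝ E] {L : Module.End ℝ E}
    (hL : L.IsSymmetric) {M : Submodule ℝ E} (hM : M ≠ ⊥) (hinv : ∀ v ∈ M, L v ∈ M) :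
    ∃ v ∈ M, v ≠ 0 ∧ ∃ a : ℝ, L v = a • v := by
  have hs := hL.restrict_invariant hinv
  have : Nontrivial M := Submodule.nontrivial_iff_ne_bot.2 hM
  have h := hs.hasEigenvalue_iSup_of_finiteDimensional
  obtain ⟨v, hv⟩ := h.exists_hasEigenvector
  refine ⟨v, v.2, fun h0 => hv.2 (Subtype.ext h0), _, congrArg Subtype.val hv.apply_eq_smul⟩

/-- Symmetric operators `T 0, …, T (N - 1)` satisfying the relations of the Iwahori–Hecke algebra
of type `A_N` with parameter `q`. -/
structure IsHeckeFamily (q : ℝ) (N : ℕ) (T : ℕ → Module.End ℝ E) : Prop where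
  symm : ∀ i < N, (T i).IsSymmetric
  quad : ∀ i < N, T i * T i = (q - 1) • T i + q • (1 : Module.End ℝ E)
  comm : ∀ i j, i + 1 < j → j < N → T i * T j = T j * T i
  braid : ∀ i, i + 1 < N → T i * T (i + 1) * T i = T (i + 1) * T i * T (i + 1)

/-- The multiplicative Jucys–Murphy elements. -/
def jucysMurphy (T : ℕ → Module.End ℝ E) : ℕ → Module.End ℝ E
  | 0 => 1
  | k + 1 => T k * jucysMurphy T k * T k

/-- The product of the first `k` Jucys–Murphy elements. -/
def fullTwist (T : ℕ → Module.End ℝ E) : ℕ → Module.End ℝ E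
  | 0 => 1
  | k + 1 => fullTwist T k * jucysMurphy T (k + 1)

/-- The descending product `T (k - 1) * ⋯ * T 0`. -/
def descProd {R : Type*} [Monoid R] (T : ℕ → R) : ℕ → R
  | 0 => 1
  | k + 1 => T k * descProd T k

/-- The product over the standard reduced word of the longest element of `S_(k+1)`. -/
def longProd {R : Type*} [Monoid R] (T : ℕ → R) : ℕ → R
  | 0 => 1
  | k + 1 => longProd T k * descProd T (k + 1)

/-- The ascending product `T 0 * ⋯ * T (k - 1)`. -/
def ascProd {R : Type*} [Monoid R] (T : ℕ → R) : ℕ → R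
  | 0 => 1
  | k + 1 => ascProd T k * T k

/-- The factors of `longProd` in the opposite order. -/
def revLongProd {R : Type*} [Monoid R] (T : ℕ → R) : ℕ → R
  | 0 => 1
  | k + 1 => ascProd T (k + 1) * revLongProd T k

/-- The vectors on which `T 0, …, T (k - 1)` act as the scalar `q`. -/
def heckeFixed (q : ℝ) (T : ℕ → Module.End ℝ E) (k : ℕ) : Submodule ℝ E where
  carrier := {v | ∀ i < k, T i v = q • v}
  zero_mem' := by simp
  add_mem' := fun {a b} ha hb i hi => by rw [map_add, ha i hi, hb i hi, smul_add]
  smul_mem' := fun r a ha i hi => by rw [map_smul, ha i hi, smul_comm]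

namespace IsHeckeFamily

variable {q : ℝ} {N : ℕ} {T : ℕ → Module.End ℝ E}

theorem commute_jucysMurphy_of_lt (h : IsHeckeFamily q N T) {j k : ℕ} (hjk : k < j) (hj : j < N) :
    Commute (T j) (jucysMurphy T k) := by
  induction k with
  | zero => exact Commute.one_right _
  | succ k ih =>
    have h1 : Commute (T j) (T k) := (h.comm k j hjk hj).symm
    exact (h1.mul_right (ih (by omega))).mul_right h1

theorem commute_jucysMurphy (h : IsHeckeFamily q N T) {i k : ℕ} (hik : i + 1 < k) (hk : k ≤ N) :
    Commute (T i) (jucysMurphy T k) := by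
  induction k with
  | zero => omega
  | succ k ih =>
    rcases Nat.lt_or_ge (i + 1) k with h1 | h1
    · have h2 : Commute (T i) (T k) := h.comm i k h1 (by omega)
      exact (h2.mul_right (ih h1 (by omega))).mul_right h2
    · obtain rfl : k = i + 1 := by omega
      have hb := h.braid i (by omega)
      have hc : T (i + 1) * jucysMurphy T i = jucysMurphy T i * T (i + 1) :=
        (h.commute_jucysMurphy_of_lt (by omega) (by omega)).eq
      change T i * (T (i+1) * (T i * jucysMurphy T i * T i) * T (i+1)) =
        (T (i+1) * (T i * jucysMurphy T i * T i) * T (i+1)) * T i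
      calc _ = (T i * T (i+1) * T i) * jucysMurphy T i * T i * T (i+1) := by simp only [mul_assoc]
        _ = T (i+1) * T i * (T (i+1) * jucysMurphy T i) * T i * T (i+1) := by
            rw [hb]; simp only [mul_assoc]
        _ = T (i+1) * T i * jucysMurphy T i * (T (i+1) * T i * T (i+1)) := by
            rw [hc]; simp only [mul_assoc]
        _ = _ := by rw [← hb]; simp only [mul_assoc]

theorem commute_jucysMurphy_jucysMurphy (h : IsHeckeFamily q N T) {j k : ℕ} (hjk : j < k)
    (hk : k ≤ N) : Commute (jucysMurphy T j) (jucysMurphy T k) := by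
  induction j with
  | zero => exact Commute.one_left _
  | succ j ih =>
    have h1 := h.commute_jucysMurphy (i := j) (by omega) hk
    exact (h1.mul_left (ih (by omega))).mul_left h1

theorem commute_fullTwist_of_lt (h : IsHeckeFamily q N T) {j k : ℕ} (hjk : k < j) (hj : j < N) :
    Commute (T j) (fullTwist T k) := by
  induction k with
  | zero => exact Commute.one_right _
  | succ k ih =>
    exact (ih (by omega)).mul_right (h.commute_jucysMurphy_of_lt hjk hj)

theorem commute_fullTwist (h : IsHeckeFamily q N T) {i k : ℕ} (hik : i < k) (hk : k ≤ N) :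
    Commute (T i) (fullTwist T k) := by
  induction k with
  | zero => omega
  | succ k ih =>
    rcases Nat.lt_or_ge i k with h1 | h1
    · exact (ih h1 (by omega)).mul_right (h.commute_jucysMurphy (by omega) hk)
    · obtain rfl : k = i := by omega
      have hJ := (h.commute_jucysMurphy_jucysMurphy (Nat.lt_succ_self k) hk).eq
      have hLT : Commute (T k) (jucysMurphy T k * jucysMurphy T (k + 1)) := by
        change T k * (jucysMurphy T k * jucysMurphy T (k + 1)) =
          (jucysMurphy T k * jucysMurphy T (k + 1)) * T k
        have h2 := hJ
        simp only [jucysMurphy, mul_assoc] at h2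
        simp only [jucysMurphy]
        calc _ = (T k * (jucysMurphy T k * (T k * jucysMurphy T k))) * T k := by
              simp only [mul_assoc]
          _ = _ := by rw [← h2]; simp only [mul_assoc]
      cases k with
      | zero => simp [fullTwist, jucysMurphy]
      | succ j =>
        have := (h.commute_fullTwist_of_lt (Nat.lt_succ_self j) (by omega)).mul_right hLT
        simpa only [fullTwist, mul_assoc] using this

theorem jucysMurphy_symm (h : IsHeckeFamily q N T) {k : ℕ} (hk : k ≤ N) :
    (jucysMurphy T k).IsSymmetric := by
  induction k with
  | zero => intro u v; rfl
  | succ k ih =>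
    intro u v
    have hT := h.symm k (by omega)
    have hJ := ih (by omega)
    change inner ℝ (T k (jucysMurphy T k (T k u))) v = inner ℝ u (T k (jucysMurphy T k (T k v)))
    rw [hT, hJ, hT]

theorem fullTwist_symm (h : IsHeckeFamily q N T) {k : ℕ} (hk : k ≤ N) :
    (fullTwist T k).IsSymmetric := by
  induction k with
  | zero => intro u v; rfl
  | succ k ih =>
    have hc : Commute (fullTwist T k) (jucysMurphy T (k + 1)) := by
      clear ih
      have : ∀ j ≤ k, Commute (fullTwist T j) (jucysMurphy T (k + 1)) := by
        intro j hj
        induction j with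
        | zero => exact Commute.one_left _
        | succ j ih =>
          exact (ih (by omega)).mul_left (h.commute_jucysMurphy_jucysMurphy (by omega) hk)
      exact this k le_rfl
    exact (ih (by omega)).mul_of_commute (h.jucysMurphy_symm hk) hc

theorem jucysMurphy_mem {M : Submodule ℝ E} {k : ℕ} (hM : ∀ i < k, ∀ v ∈ M, T i v ∈ M) :
    ∀ v ∈ M, jucysMurphy T k v ∈ M := by
  induction k with
  | zero => intro v hv; exact hv
  | succ k ih =>
    intro v hv
    exact hM k (by omega) _ (ih (fun i hi => hM i (by omega)) _ (hM k (by omega) _ hv))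

theorem fullTwist_mem {M : Submodule ℝ E} {k : ℕ} (hM : ∀ i < k, ∀ v ∈ M, T i v ∈ M) :
    ∀ v ∈ M, fullTwist T k v ∈ M := by
  induction k with
  | zero => intro v hv; exact hv
  | succ k ih =>
    intro v hv
    exact ih (fun i hi => hM i (by omega)) _ (jucysMurphy_mem hM _ hv)

theorem jucysMurphy_apply_of_mem_heckeFixed {k : ℕ} {v : E} (hv : v ∈ heckeFixed q T k) :
    jucysMurphy T k v = q ^ (2 * k) • v := by
  induction k with
  | zero => simp [jucysMurphy]
  | succ k ih =>
    have h1 := ih (fun i hi => hv i (by omega))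
    change T k (jucysMurphy T k (T k v)) = _
    rw [hv k (by omega), map_smul, h1, map_smul, map_smul, hv k (by omega), smul_smul, smul_smul]
    congr 1
    ring

theorem fullTwist_apply_of_mem_heckeFixed {k : ℕ} {v : E} (hv : v ∈ heckeFixed q T k) :
    fullTwist T k v = q ^ (k * (k + 1)) • v := by
  induction k with
  | zero => simp [fullTwist]
  | succ k ih =>
    have h1 := ih (fun i hi => hv i (by omega))
    change fullTwist T k (jucysMurphy T (k + 1) v) = _
    rw [jucysMurphy_apply_of_mem_heckeFixed hv, map_smul, h1, smul_smul]
    congr 1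
    ring

theorem map_eq_zero (h : IsHeckeFamily q N T) (hq : 1 < q) {k : ℕ} (hk : k < N) {v : E}
    (hv : T k v = 0) : v = 0 := by
  have h1 := congrArg (fun f : Module.End ℝ E => f v) (h.quad k hk)
  simp only [Module.End.mul_apply, hv, map_zero, LinearMap.add_apply, LinearMap.smul_apply,
    smul_zero, zero_add, Module.End.one_apply] at h1
  exact (smul_eq_zero.1 h1.symm).resolve_left (by linarith)

theorem map_map (h : IsHeckeFamily q N T) {k : ℕ} (hk : k < N) (v : E) :
    T k (T k v) = (q - 1) • T k v + q • v :=
  congrArg (fun f : Module.End ℝ E => f v) (h.quad k hk)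

theorem inner_jucysMurphy_pos (h : IsHeckeFamily q N T) (hq : 1 < q) {k : ℕ} (hk : k ≤ N) {v : E}
    (hv : v ≠ 0) : 0 < inner ℝ (jucysMurphy T k v) v := by
  induction k generalizing v with
  | zero =>
    change 0 < inner ℝ v v
    exact real_inner_self_pos.2 hv
  | succ k ih =>
    change 0 < inner ℝ (T k (jucysMurphy T k (T k v))) v
    rw [h.symm k (by omega)]
    exact ih (by omega) fun h0 => hv (h.map_eq_zero hq (by omega) h0)

theorem jucysMurphy_eigenvalue_pos (h : IsHeckeFamily q N T) (hq : 1 < q) {k : ℕ} (hk : k ≤ N)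
    {v : E} (hv : v ≠ 0) {b : ℝ} (hb : jucysMurphy T k v = b • v) : 0 < b := by
  have h1 := h.inner_jucysMurphy_pos hq hk hv
  rw [hb, real_inner_smul_left] at h1
  exact pos_of_mul_pos_left h1 real_inner_self_nonneg

/-- A joint eigenvector of two consecutive Jucys–Murphy elements is either an eigenvector of the
generator between them, or spans with its image a plane in which the eigenvalues are exchanged. -/
theorem joint_eigenvector (h : IsHeckeFamily q N T) (hq : 1 < q) {k : ℕ} (hk : k < N) {v : E}
    (hv : v ≠ 0) {a b : ℝ} (ha : jucysMurphy T k v = a • v)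
    (hb : jucysMurphy T (k + 1) v = b • v) :
    b ≠ q * a ∧ ((T k v = q • v ∧ b = q ^ 2 * a) ∨ (T k v = -v ∧ b = a) ∨
      ∃ c₁ c₂ : ℝ, c₁ • T k v + c₂ • v ≠ 0 ∧
        jucysMurphy T k (c₁ • T k v + c₂ • v) = (b / q) • (c₁ • T k v + c₂ • v)) := by
  have hq0 : q ≠ 0 := by linarith
  have hbpos := h.jucysMurphy_eigenvalue_pos hq (by omega : k + 1 ≤ N) hv hb
  have hapos := h.jucysMurphy_eigenvalue_pos hq (by omega : k ≤ N) hv ha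
  have hsymm := h.jucysMurphy_symm (by omega : k ≤ N)
  have hTT := h.map_map hk v
  have hLT : q • jucysMurphy T k (T k v) = b • T k v - ((q - 1) * b) • v := by
    have h1 := congrArg (T k) hb
    have h2 := h.map_map hk (jucysMurphy T k (T k v))
    change T k (T k (jucysMurphy T k (T k v))) = _ at h1
    rw [h2] at h1
    change (q - 1) • (jucysMurphy T (k + 1) v) + _ = _ at h1
    rw [hb, map_smul, smul_smul] at h1
    rw [← h1]; abel
  have hLT' : jucysMurphy T k (T k v) = (b / q) • T k v - ((q - 1) * (b / q)) • v := by
    have := congrArg (fun x => q⁻¹ • x) hLT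
    simp only [smul_smul, inv_mul_cancel₀ hq0, one_smul, smul_sub] at this
    rw [this]
    congr 2 <;> field_simp
  have hne : b ≠ q * a := by
    intro hba
    have h3 : b / q = a := by rw [hba]; field_simp
    rw [h3] at hLT'
    have h4 := hsymm (T k v) v
    rw [hLT', ha, inner_sub_left, real_inner_smul_left, real_inner_smul_left,
      real_inner_smul_right] at h4
    have h5 : (q - 1) * a * inner ℝ v v = 0 := by linarith
    have h6 : 0 < inner ℝ v v := real_inner_self_pos.2 hv
    have : 0 < (q - 1) * a * inner ℝ v v := by
      have : 0 < q - 1 := by linarith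
      positivity
    linarith
  refine ⟨hne, ?_⟩
  by_cases hu : (b - q * a) • T k v + (-((q - 1) * b)) • v = 0
  · have hne' : b - q * a ≠ 0 := sub_ne_zero.2 hne
    obtain ⟨l, hl⟩ : ∃ l : ℝ, T k v = l • v := by
      refine ⟨(b - q * a)⁻¹ * ((q - 1) * b), ?_⟩
      rw [neg_smul, ← sub_eq_add_neg, sub_eq_zero] at hu
      rw [mul_smul, ← hu, smul_smul, inv_mul_cancel₀ hne', one_smul]
    have hll : b = l ^ 2 * a := by
      have h1 : jucysMurphy T (k + 1) v = (l ^ 2 * a) • v := by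
        change T k (jucysMurphy T k (T k v)) = _
        rw [hl, map_smul, ha, map_smul, map_smul, hl]
        simp only [smul_smul]; congr 1; ring
      rw [hb] at h1
      exact smul_left_injective ℝ hv h1
    have hroot : l * l = (q - 1) * l + q := by
      rw [hl, map_smul, hl, smul_smul, smul_smul, ← add_smul] at hTT
      exact smul_left_injective ℝ hv hTT
    have : (l - q) * (l + 1) = 0 := by linarith
    rcases mul_eq_zero.1 this with h1 | h1
    · left
      obtain rfl : l = q := by linarith
      exact ⟨hl, hll⟩
    · right; left
      obtain rfl : l = -1 := by linarith
      exact ⟨by rw [hl]; simp, by rw [hll]; ring⟩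
  · refine Or.inr (Or.inr ⟨_, _, hu, ?_⟩)
    rw [map_add, map_smul, map_smul, hLT', ha]
    have : a = b / q - (b - q * a) / q := by field_simp; ring
    match_scalars
    · ring
    · field_simp; ring

theorem mem_heckeFixed_succ {k : ℕ} {v : E} (hv : v ∈ heckeFixed q T k) (h1 : T k v = q • v) :
    v ∈ heckeFixed q T (k + 1) := by
  intro i hi
  rcases Nat.lt_succ_iff_lt_or_eq.1 hi with h2 | rfl
  exacts [hv i h2, h1]

theorem heckeFixed_mem (k : ℕ) :
    ∀ i < k, ∀ v ∈ heckeFixed q T k, T i v ∈ heckeFixed q T k := fun i hi v hv => by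
  rw [hv i hi]
  exact Submodule.smul_mem _ _ hv

theorem orthogonal_mem (h : IsHeckeFamily q N T) {k : ℕ} (hk : k ≤ N) {M : Submodule ℝ E}
    (hM : ∀ i < k, ∀ v ∈ M, T i v ∈ M) : ∀ i < k, ∀ v ∈ Mᗮ, T i v ∈ Mᗮ := by
  intro i hi v hv
  rw [Submodule.mem_orthogonal] at hv ⊢
  intro u hu
  rw [← h.symm i (by omega)]
  exact hv _ (hM i hi u hu)

/-- Intersecting an invariant subspace with an eigenspace of a central operator. -/
theorem inf_eigenspace_mem {k : ℕ} {M : Submodule ℝ E} (hM : ∀ i < k, ∀ v ∈ M, T i v ∈ M)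
    {Z : Module.End ℝ E} (hZ : ∀ i < k, Commute (T i) Z) (z : ℝ) :
    ∀ i < k, ∀ v ∈ M ⊓ Module.End.eigenspace Z z, T i v ∈ M ⊓ Module.End.eigenspace Z z := by
  intro i hi v hv
  refine ⟨hM i hi v hv.1, ?_⟩
  have h2 := Module.End.mem_eigenspace_iff.1 hv.2
  rw [SetLike.mem_coe, Module.End.mem_eigenspace_iff]
  have h3 := congrArg (fun f : Module.End ℝ E => f v) (hZ i hi).eq
  simp only [Module.End.mul_apply] at h3
  rw [← h3, h2, map_smul]

variable [FiniteDimensional ℝ E]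

theorem eigenvalue_le_or_fixed (h : IsHeckeFamily q N T) {k : ℕ} (hk : k ≤ N)
    (hB : ∀ M : Submodule ℝ E, (∀ i < k, ∀ v ∈ M, T i v ∈ M) → M ⊓ heckeFixed q T k = ⊥ →
      ∀ v ∈ M, v ≠ 0 → ∀ b : ℝ, jucysMurphy T k v = b • v → b * q ≤ q ^ (2 * k))
    {v : E} {b : ℝ} (hb : jucysMurphy T k v = b • v) :
    b * q ≤ q ^ (2 * k) ∨ v ∈ heckeFixed q T k := by
  set Φ := heckeFixed q T k
  obtain ⟨x, hx, y, hy, rfl⟩ := Φ.exists_add_mem_mem_orthogonal v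
  by_cases hy0 : y = 0
  · right; simpa [hy0] using hx
  left
  have hinv := h.orthogonal_mem hk (heckeFixed_mem (q := q) k)
  refine hB Φᗮ hinv ?_ y hy hy0 b ?_
  · rw [inf_comm]; exact Φ.inf_orthogonal_eq_bot
  · have h1 := jucysMurphy_mem (heckeFixed_mem k) x hx
    have h2 := jucysMurphy_mem hinv y hy
    rw [map_add, smul_add] at hb
    have h3 : jucysMurphy T k x - b • x = b • y - jucysMurphy T k y := by
      rw [sub_eq_sub_iff_add_eq_add, hb]; abel
    have h4 : jucysMurphy T k x - b • x ∈ Φ := Φ.sub_mem h1 (Φ.smul_mem _ hx)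
    have h5 : b • y - jucysMurphy T k y ∈ Φᗮ := Φᗮ.sub_mem (Φᗮ.smul_mem _ hy) h2
    rw [h3] at h4
    have h6 := (Submodule.mem_bot ℝ).1 (Φ.inf_orthogonal_eq_bot ▸ Submodule.mem_inf.2 ⟨h4, h5⟩)
    exact (sub_eq_zero.1 h6).symm

theorem jucysMurphy_le (h : IsHeckeFamily q N T) (hq : 1 < q) {k : ℕ} (hk : k ≤ N)
    {M : Submodule ℝ E} (hM : ∀ i < k, ∀ v ∈ M, T i v ∈ M) (hfix : M ⊓ heckeFixed q T k = ⊥)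
    {v : E} (hv : v ∈ M) (hv0 : v ≠ 0) {b : ℝ} (hb : jucysMurphy T k v = b • v) :
    b * q ≤ q ^ (2 * k) := by
  induction k generalizing M v b with
  | zero =>
    have : v ∈ M ⊓ heckeFixed q T 0 := ⟨hv, fun i hi => by omega⟩
    rw [hfix] at this
    exact absurd ((Submodule.mem_bot ℝ).1 this) hv0
  | succ k ih =>
    have hAB := fun {v : E} {b : ℝ} => h.eigenvalue_le_or_fixed (k := k) (by omega)
      (fun M h1 h2 v h3 h4 b h5 => ih (by omega) h1 h2 h3 h4 h5) (v := v) (b := b)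
    have hq0 : 0 < q := by linarith
    have hpw : q ^ (2 * (k + 1)) = q ^ (2 * k) * q * q := by ring
    have hpk : 0 < q ^ (2 * k) := by positivity
    have hA : ∀ {v : E} {b : ℝ}, v ≠ 0 → jucysMurphy T k v = b • v → b ≤ q ^ (2 * k) := by
      intro v b hv0 hb
      rcases hAB hb with h1 | h1
      · have := h.jucysMurphy_eigenvalue_pos hq (by omega : k ≤ N) hv0 hb
        nlinarith
      · rw [jucysMurphy_apply_of_mem_heckeFixed h1] at hb
        exact (smul_left_injective ℝ hv0 hb).ge
    set M' := M ⊓ Module.End.eigenspace (jucysMurphy T (k + 1)) b with hM'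
    have hM'inv : ∀ i < k, ∀ v ∈ M', T i v ∈ M' := inf_eigenspace_mem (fun i hi => hM i (by omega))
      (fun i hi => h.commute_jucysMurphy (by omega) hk) b
    have hvM' : v ∈ M' := ⟨hv, Module.End.mem_eigenspace_iff.2 hb⟩
    have key : ∀ w ∈ M', w ≠ 0 → ∀ a : ℝ, jucysMurphy T k w = a • w →
        (T k w = q • w → a * q ≤ q ^ (2 * k)) → b * q ≤ q ^ (2 * (k + 1)) := by
      intro w hw hw0 a ha hTw
      have hbw := Module.End.mem_eigenspace_iff.1 hw.2
      have hale := hA hw0 ha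
      rcases (h.joint_eigenvector hq (by omega) hw0 ha hbw).2 with ⟨h1, h2⟩ | ⟨h1, h2⟩ | h1
      · have := hTw h1
        rw [hpw, h2]
        nlinarith [mul_le_mul_of_nonneg_right this (by positivity : 0 ≤ q * q)]
      · rw [hpw, h2]
        have : a * q ≤ q ^ (2 * k) * q := mul_le_mul_of_nonneg_right hale hq0.le
        have h5 : q ^ (2 * k) * q * 1 ≤ q ^ (2 * k) * q * q :=
          mul_le_mul_of_nonneg_left hq.le (by positivity)
        linarith
      · obtain ⟨c₁, c₂, hu0, hu⟩ := h1
        have := hA hu0 hu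
        rw [div_le_iff₀ hq0] at this
        rw [hpw]
        exact mul_le_mul_of_nonneg_right this hq0.le
    by_cases hfix' : M' ⊓ heckeFixed q T k = ⊥
    · obtain ⟨w, hw, hw0, a, ha⟩ := (h.jucysMurphy_symm (by omega : k ≤ N)).exists_eigenvector_mem
        (M := M') (fun h0 => hv0 ((Submodule.mem_bot ℝ).1 (h0 ▸ hvM'))) (jucysMurphy_mem hM'inv)
      exact key w hw hw0 a ha fun _ => ih (by omega) hM'inv hfix' hw hw0 ha
    · obtain ⟨w, hw, hw0⟩ := Submodule.exists_mem_ne_zero_of_ne_bot hfix'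
      refine key w hw.1 hw0 _ (jucysMurphy_apply_of_mem_heckeFixed hw.2) fun hTw => ?_
      have : w ∈ M ⊓ heckeFixed q T (k + 1) := ⟨hw.1.1, mem_heckeFixed_succ hw.2 hTw⟩
      rw [hfix] at this
      exact absurd ((Submodule.mem_bot ℝ).1 this) hw0

theorem jucysMurphy_lt (h : IsHeckeFamily q N T) (hq : 1 < q) {k : ℕ} (hk : k + 1 ≤ N)
    {M : Submodule ℝ E} (hM : ∀ i < k + 1, ∀ v ∈ M, T i v ∈ M) (hfix : M ⊓ heckeFixed q T k = ⊥)
    {v : E} (hv : v ∈ M) (hv0 : v ≠ 0) {b : ℝ} (hb : jucysMurphy T (k + 1) v = b • v) :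
    b * q < q ^ (2 * (k + 1)) := by
  induction k generalizing M v b with
  | zero =>
    have : v ∈ M ⊓ heckeFixed q T 0 := ⟨hv, fun i hi => by omega⟩
    rw [hfix] at this
    exact absurd ((Submodule.mem_bot ℝ).1 this) hv0
  | succ k ih =>
    have hq0 : 0 < q := by linarith
    have hpw : q ^ (2 * (k + 1 + 1)) = q ^ (2 * (k + 1)) * q * q := by ring
    have hpk : 0 < q ^ (2 * (k + 1)) := by positivity
    set M' := M ⊓ Module.End.eigenspace (jucysMurphy T (k + 1 + 1)) b with hM'
    have hM'inv : ∀ i < k + 1, ∀ v ∈ M', T i v ∈ M' :=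
      inf_eigenspace_mem (fun i hi => hM i (by omega))
        (fun i hi => h.commute_jucysMurphy (by omega) hk) b
    have hvM' : v ∈ M' := ⟨hv, Module.End.mem_eigenspace_iff.2 hb⟩
    have hA : ∀ w ∈ M, w ≠ 0 → ∀ a : ℝ, jucysMurphy T (k + 1) w = a • w →
        a * q ≤ q ^ (2 * (k + 1)) := fun w hw hw0 a ha =>
      h.jucysMurphy_le hq (by omega) (fun i hi => hM i (by omega)) hfix hw hw0 ha
    have key : ∀ w ∈ M', w ≠ 0 → ∀ a : ℝ, jucysMurphy T (k + 1) w = a • w →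
        a * q ≠ q ^ (2 * (k + 1)) → b * q < q ^ (2 * (k + 1 + 1)) := by
      intro w hw hw0 a ha hane
      have hbw := Module.End.mem_eigenspace_iff.1 hw.2
      have hale := hA w hw.1 hw0 a ha
      have halt := lt_of_le_of_ne hale hane
      rcases (h.joint_eigenvector hq (by omega) hw0 ha hbw).2 with ⟨h1, h2⟩ | ⟨h1, h2⟩ | h1
      · rw [hpw, h2]
        nlinarith [mul_lt_mul_of_pos_right halt (by positivity : 0 < q * q)]
      · rw [hpw, h2]
        have h5 : q ^ (2 * (k + 1)) * 1 ≤ q ^ (2 * (k + 1)) * (q * q) :=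
          mul_le_mul_of_nonneg_left (by nlinarith) (by positivity)
        linarith
      · obtain ⟨c₁, c₂, hu0, hu⟩ := h1
        have := hA _ (M.add_mem (M.smul_mem _ (hM _ (by omega) _ hw.1)) (M.smul_mem _ hw.1)) hu0 _ hu
        rw [div_mul_cancel₀ _ hq0.ne'] at this
        rw [hpw]
        nlinarith [mul_le_mul_of_nonneg_right this hq0.le, mul_pos hpk hq0]
    by_cases hfix' : M' ⊓ heckeFixed q T k = ⊥
    · obtain ⟨w, hw, hw0, a, ha⟩ :=
        (h.jucysMurphy_symm (by omega : k + 1 ≤ N)).exists_eigenvector_mem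
        (M := M') (fun h0 => hv0 ((Submodule.mem_bot ℝ).1 (h0 ▸ hvM'))) (jucysMurphy_mem hM'inv)
      exact key w hw hw0 a ha (ih (by omega) hM'inv hfix' hw hw0 ha).ne
    · have hinv : ∀ w ∈ M' ⊓ heckeFixed q T k,
          jucysMurphy T (k + 1) w ∈ M' ⊓ heckeFixed q T k := by
        intro w hw
        refine ⟨jucysMurphy_mem hM'inv w hw.1, fun i hi => ?_⟩
        have h3 := congrArg (fun f : Module.End ℝ E => f w)
          (h.commute_jucysMurphy (by omega : i + 1 < k + 1) (by omega)).eq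
        simp only [Module.End.mul_apply] at h3
        rw [h3, hw.2 i hi, map_smul]
      obtain ⟨w, hw, hw0, a, ha⟩ :=
        (h.jucysMurphy_symm (by omega : k + 1 ≤ N)).exists_eigenvector_mem hfix' hinv
      refine key w hw.1 hw0 a ha fun h0 => ?_
      refine (h.joint_eigenvector hq (by omega) hw0
        (jucysMurphy_apply_of_mem_heckeFixed hw.2) ha).1 ?_
      have : a * q = q * q ^ (2 * k) * q := by rw [h0]; ring
      exact mul_right_cancel₀ hq0.ne' this

omit [FiniteDimensional ℝ E] in
theorem jucysMurphy_succ_of_mem_heckeFixed (h : IsHeckeFamily q N T) (hq : 1 < q) {k : ℕ}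
    (hk : k + 1 ≤ N) {v : E} (hv : v ∈ heckeFixed q T k) (hv0 : v ≠ 0) {b : ℝ}
    (hb : jucysMurphy T (k + 1) v = b • v) : v ∈ heckeFixed q T (k + 1) ∨ b = q ^ k := by
  have hq0 : 0 < q := by linarith
  induction k generalizing v b with
  | zero =>
    rcases h.joint_eigenvector hq (by omega) hv0 (a := 1) (by simp [jucysMurphy]) hb with
      ⟨h0, ⟨h1, h2⟩ | ⟨h1, h2⟩ | ⟨c₁, c₂, hu0, hu⟩⟩
    · exact Or.inl (mem_heckeFixed_succ hv h1)
    · right; simpa using h2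
    · exfalso
      have h3 : (1 : ℝ) • (c₁ • T 0 v + c₂ • v) = (b / q) • (c₁ • T 0 v + c₂ • v) := by
        simpa [jucysMurphy] using hu
      have h4 := smul_left_injective ℝ hu0 h3
      rw [eq_div_iff hq0.ne'] at h4
      exact h0 (by linarith)
  | succ k ih =>
    have ha := jucysMurphy_apply_of_mem_heckeFixed hv
    rcases h.joint_eigenvector hq (by omega) hv0 ha hb with
      ⟨h0, ⟨h1, h2⟩ | ⟨h1, h2⟩ | ⟨c₁, c₂, hu0, hu⟩⟩
    · exact Or.inl (mem_heckeFixed_succ hv h1)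
    · exfalso
      have hbr := congrArg (fun f : Module.End ℝ E => f v) (h.braid k (by omega))
      have h3 := hv k (by omega)
      simp only [Module.End.mul_apply, h3, h1, map_neg, map_smul, smul_neg, neg_neg] at hbr
      have h4 : (-(q * q) - q) • v = 0 := by
        rw [sub_smul, neg_smul, mul_smul, sub_eq_zero]; exact hbr
      rcases smul_eq_zero.1 h4 with h5 | h5
      · nlinarith
      · exact hv0 h5
    · right
      have hufix : c₁ • T (k + 1) v + c₂ • v ∈ heckeFixed q T k := by
        intro i hi
        have h3 := congrArg (fun f : Module.End ℝ E => f v) (h.comm i (k + 1) (by omega) (by omega))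
        simp only [Module.End.mul_apply] at h3
        rw [map_add, map_smul, map_smul, h3, hv i (by omega), map_smul]
        module
      rcases ih (by omega) hufix hu0 hu with h3 | h3
      · exfalso
        rw [jucysMurphy_apply_of_mem_heckeFixed h3] at hu
        have h4 := smul_left_injective ℝ hu0 hu
        rw [eq_div_iff hq0.ne'] at h4
        exact h0 (by rw [← h4]; ring)
      · rw [div_eq_iff hq0.ne'] at h3
        rw [h3]; ring

theorem fullTwist_lt (h : IsHeckeFamily q N T) (hq : 1 < q) {k : ℕ} (hk : k + 1 ≤ N)
    (ih : ∀ M : Submodule ℝ E, (∀ i < k, ∀ v ∈ M, T i v ∈ M) → M ⊓ heckeFixed q T k = ⊥ →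
      ∀ v ∈ M, v ≠ 0 → ∀ z : ℝ, fullTwist T k v = z • v → z * q ≤ q ^ (k ^ 2))
    {M : Submodule ℝ E} (hM : ∀ i < k + 1, ∀ v ∈ M, T i v ∈ M) (hfix : M ⊓ heckeFixed q T k = ⊥)
    {v : E} (hv : v ∈ M) (hv0 : v ≠ 0) {z : ℝ} (hz : fullTwist T (k + 1) v = z • v) :
    z * q < q ^ ((k + 1) ^ 2) := by
  have hq0 : 0 < q := by linarith
  set M' := M ⊓ Module.End.eigenspace (fullTwist T (k + 1)) z with hM'
  have hM'inv : ∀ i < k + 1, ∀ v ∈ M', T i v ∈ M' :=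
    inf_eigenspace_mem hM (fun i hi => h.commute_fullTwist hi hk) z
  have hvM' : v ∈ M' := ⟨hv, Module.End.mem_eigenspace_iff.2 hz⟩
  obtain ⟨w, hw, hw0, b, hb⟩ := (h.jucysMurphy_symm hk).exists_eigenvector_mem
    (M := M') (fun h0 => hv0 ((Submodule.mem_bot ℝ).1 (h0 ▸ hvM'))) (jucysMurphy_mem hM'inv)
  set M'' := M' ⊓ Module.End.eigenspace (jucysMurphy T (k + 1)) b with hM''
  have hM''inv : ∀ i < k, ∀ v ∈ M'', T i v ∈ M'' :=
    inf_eigenspace_mem (fun i hi => hM'inv i (by omega))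
      (fun i hi => h.commute_jucysMurphy (by omega) hk) b
  have hwM'' : w ∈ M'' := ⟨hw, Module.End.mem_eigenspace_iff.2 hb⟩
  obtain ⟨x, hx, hx0, y, hy⟩ := (h.fullTwist_symm (by omega : k ≤ N)).exists_eigenvector_mem
    (M := M'') (fun h0 => hw0 ((Submodule.mem_bot ℝ).1 (h0 ▸ hwM''))) (fullTwist_mem hM''inv)
  have hbx := Module.End.mem_eigenspace_iff.1 hx.2
  have hzx := Module.End.mem_eigenspace_iff.1 hx.1.2
  have hzyb : z = y * b := by
    change fullTwist T k (jucysMurphy T (k + 1) x) = _ at hzx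
    rw [hbx, map_smul, hy, smul_smul] at hzx
    rw [mul_comm]
    exact (smul_left_injective ℝ hx0 hzx).symm
  have h1 := h.jucysMurphy_lt hq hk hM hfix hx.1.1 hx0 hbx
  have hbpos := h.jucysMurphy_eigenvalue_pos hq hk hx0 hbx
  have h2 := ih M (fun i hi => hM i (by omega)) hfix x hx.1.1 hx0 y hy
  have h3 : (y * q) * (b * q) < q ^ (k ^ 2) * q ^ (2 * (k + 1)) :=
    (mul_le_mul_of_nonneg_right h2 (by positivity)).trans_lt
      (mul_lt_mul_of_pos_left h1 (by positivity))
  have h4 : q ^ (k ^ 2) * q ^ (2 * (k + 1)) = q ^ ((k + 1) ^ 2) * q := by ring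
  rw [h4, (by ring : (y * q) * (b * q) = y * b * q * q), ← hzyb] at h3
  exact lt_of_mul_lt_mul_right h3 hq0.le

theorem fullTwist_le (h : IsHeckeFamily q N T) (hq : 1 < q) {k : ℕ} (hk : k ≤ N)
    {M : Submodule ℝ E} (hM : ∀ i < k, ∀ v ∈ M, T i v ∈ M) (hfix : M ⊓ heckeFixed q T k = ⊥)
    {v : E} (hv : v ∈ M) (hv0 : v ≠ 0) {z : ℝ} (hz : fullTwist T k v = z • v) :
    z * q ≤ q ^ (k ^ 2) := by
  have hq0 : 0 < q := by linarith
  induction k generalizing M v z with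
  | zero =>
    have : v ∈ M ⊓ heckeFixed q T 0 := ⟨hv, fun i hi => by omega⟩
    rw [hfix] at this
    exact absurd ((Submodule.mem_bot ℝ).1 this) hv0
  | succ k ih =>
    set M' := M ⊓ Module.End.eigenspace (fullTwist T (k + 1)) z with hM'
    have hM'inv : ∀ i < k + 1, ∀ v ∈ M', T i v ∈ M' :=
      inf_eigenspace_mem hM (fun i hi => h.commute_fullTwist hi hk) z
    have hvM' : v ∈ M' := ⟨hv, Module.End.mem_eigenspace_iff.2 hz⟩
    by_cases hfix' : M' ⊓ heckeFixed q T k = ⊥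
    · exact (h.fullTwist_lt hq hk
        (fun M h1 h2 v h3 h4 z h5 => ih (by omega) h1 h2 h3 h4 h5) hM'inv hfix' hvM' hv0 hz).le
    · have hinv : ∀ w ∈ M' ⊓ heckeFixed q T k,
          jucysMurphy T (k + 1) w ∈ M' ⊓ heckeFixed q T k := by
        intro w hw
        refine ⟨jucysMurphy_mem hM'inv w hw.1, fun i hi => ?_⟩
        have h3 := congrArg (fun f : Module.End ℝ E => f w)
          (h.commute_jucysMurphy (by omega : i + 1 < k + 1) (by omega)).eq
        simp only [Module.End.mul_apply] at h3
        rw [h3, hw.2 i hi, map_smul]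
      obtain ⟨w, hw, hw0, b, hb⟩ := (h.jucysMurphy_symm hk).exists_eigenvector_mem hfix' hinv
      have hzw := Module.End.mem_eigenspace_iff.1 hw.1.2
      rcases h.jucysMurphy_succ_of_mem_heckeFixed hq hk hw.2 hw0 hb with h1 | h1
      · have : w ∈ M ⊓ heckeFixed q T (k + 1) := ⟨hw.1.1, h1⟩
        rw [hfix] at this
        exact absurd ((Submodule.mem_bot ℝ).1 this) hw0
      · change fullTwist T k (jucysMurphy T (k + 1) w) = _ at hzw
        rw [hb, map_smul, fullTwist_apply_of_mem_heckeFixed hw.2, smul_smul] at hzw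
        have h2 := smul_left_injective ℝ hw0 hzw
        rw [← h2, h1]
        apply le_of_eq
        ring

omit [FiniteDimensional ℝ E] in
theorem jucysMurphy_eq (k : ℕ) : jucysMurphy T k = descProd T k * ascProd T k := by
  induction k with
  | zero => simp [jucysMurphy, descProd, ascProd]
  | succ k ih => simp only [jucysMurphy, descProd, ascProd, ih, mul_assoc]

omit [FiniteDimensional ℝ E] in
theorem commute_revLongProd (h : IsHeckeFamily q N T) {j k : ℕ} (hjk : j < k) (hk : k ≤ N) :
    Commute (jucysMurphy T k) (revLongProd T j) := by
  have hasc : ∀ j < k, Commute (jucysMurphy T k) (ascProd T j) := by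
    intro j hj
    induction j with
    | zero => exact Commute.one_right _
    | succ j ih => exact (ih (by omega)).mul_right (h.commute_jucysMurphy hj hk).symm
  induction j with
  | zero => exact Commute.one_right _
  | succ j ih => exact (hasc _ hjk).mul_right (ih (by omega))

omit [FiniteDimensional ℝ E] in
theorem longProd_mul_revLongProd (h : IsHeckeFamily q N T) {k : ℕ} (hk : k ≤ N) :
    longProd T k * revLongProd T k = fullTwist T k := by
  induction k with
  | zero => simp [longProd, revLongProd, fullTwist]
  | succ k ih =>
    change longProd T k * descProd T (k + 1) * (ascProd T (k + 1) * revLongProd T k) =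
      fullTwist T k * jucysMurphy T (k + 1)
    rw [← ih (by omega), mul_assoc, ← mul_assoc (descProd T (k + 1)), ← jucysMurphy_eq,
      (h.commute_revLongProd (Nat.lt_succ_self k) hk).eq, mul_assoc]

omit [FiniteDimensional ℝ E] in
theorem inner_longProd (h : IsHeckeFamily q N T) {k : ℕ} (hk : k ≤ N) (u v : E) :
    inner ℝ (longProd T k u) v = inner ℝ u (revLongProd T k v) := by
  have hdesc : ∀ k ≤ N, ∀ u v : E, inner ℝ (descProd T k u) v = inner ℝ u (ascProd T k v) := by
    intro k hk
    induction k with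
    | zero => intro u v; rfl
    | succ k ih =>
      intro u v
      change inner ℝ (T k (descProd T k u)) v = inner ℝ u (ascProd T k (T k v))
      rw [h.symm k (by omega), ih (by omega)]
  induction k generalizing u v with
  | zero => rfl
  | succ k ih =>
    change inner ℝ (longProd T k (descProd T (k + 1) u)) v =
      inner ℝ u (ascProd T (k + 1) (revLongProd T k v))
    rw [ih (by omega), hdesc _ hk]

/-- An invariant subspace containing all vectors fixed by the maximal parabolic contains all
eigenvectors of the longest element whose eigenvalue `a` satisfies `a ^ 2 = q ^ (N ^ 2 - 1)`. -/
theorem mem_of_longProd_eigenvector (h : IsHeckeFamily q N T) (hq : 1 < q) {k : ℕ}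
    (hk : k + 1 = N) (hsymm : (longProd T N).IsSymmetric) {W : Submodule ℝ E}
    (hW : ∀ i < N, ∀ v ∈ W, T i v ∈ W) (hfix : heckeFixed q T k ≤ W) {a : ℝ}
    (ha : a ^ 2 * q = q ^ (N ^ 2)) {v : E} (hv : longProd T N v = a • v) : v ∈ W := by
  subst hk
  have hrev : ∀ v, revLongProd T (k + 1) v = longProd T (k + 1) v := by
    intro v
    refine ext_inner_left ℝ fun u => ?_
    rw [← h.inner_longProd le_rfl, hsymm]
  have hZ : fullTwist T (k + 1) v = a ^ 2 • v := by
    rw [← h.longProd_mul_revLongProd le_rfl, Module.End.mul_apply, hrev, hv, map_smul, hv,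
      smul_smul, sq]
  obtain ⟨x, hx, y, hy, rfl⟩ := W.exists_add_mem_mem_orthogonal v
  have hinv := h.orthogonal_mem le_rfl hW
  have hZy : fullTwist T (k + 1) y = a ^ 2 • y := by
    have h1 := fullTwist_mem hW x hx
    have h2 := fullTwist_mem hinv y hy
    rw [map_add, smul_add] at hZ
    have h3 : fullTwist T (k + 1) x - a ^ 2 • x = a ^ 2 • y - fullTwist T (k + 1) y := by
      rw [sub_eq_sub_iff_add_eq_add, hZ]; abel
    have h4 : fullTwist T (k + 1) x - a ^ 2 • x ∈ W := W.sub_mem h1 (W.smul_mem _ hx)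
    have h5 : a ^ 2 • y - fullTwist T (k + 1) y ∈ Wᗮ := Wᗮ.sub_mem (Wᗮ.smul_mem _ hy) h2
    rw [h3] at h4
    have h6 := (Submodule.mem_bot ℝ).1 (W.inf_orthogonal_eq_bot ▸ Submodule.mem_inf.2 ⟨h4, h5⟩)
    exact (sub_eq_zero.1 h6).symm
  have hbot : Wᗮ ⊓ heckeFixed q T k = ⊥ := by
    rw [eq_bot_iff, ← W.inf_orthogonal_eq_bot, inf_comm]
    exact inf_le_inf_right _ hfix
  by_cases hy0 : y = 0
  · simpa [hy0] using hx
  · exact absurd ha (h.fullTwist_lt hq le_rfl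
      (fun M h1 h2 v h3 h4 z h5 => h.fullTwist_le hq (by omega) h1 h2 h3 h4 h5)
      hinv hbot hy hy0 hZy).ne

end IsHeckeFamily
end Hecke

section FlagGeometry

variable {F : Type} [Field F] {m : ℕ}

theorem Submodule.sup_span_singleton_eq {K V : Type*} [Field K] [AddCommGroup V] [Module K V]
    [Module.Finite K V] {A S : Submodule K V} (hAS : A ≤ S)
    (hr : Module.finrank K S = Module.finrank K A + 1) {x : V} (hx : x ∈ S) (hxA : x ∉ A) :
    A ⊔ Submodule.span K {x} = S := by
  refine Submodule.eq_of_le_of_finrank_eq (sup_le hAS ?_) ?_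
  · simpa using hx
  · rw [Submodule.finrank_sup_span_singleton hxA, hr]

theorem Submodule.mem_of_finrank_succ {K V : Type*} [Field K] [AddCommGroup V] [Module K V]
    [Module.Finite K V] {A S : Submodule K V} (hAS : A ≤ S)
    (hr : Module.finrank K S = Module.finrank K A + 1) {x : V} (hx : x ∈ S) (hxA : x ∉ A)
    {y : V} (hy : y ∈ S) : ∃ r : K, y - r • x ∈ A := by
  rw [← Submodule.sup_span_singleton_eq hAS hr hx hxA, Submodule.mem_sup] at hy
  obtain ⟨a, ha, b, hb, rfl⟩ := hy
  obtain ⟨r, rfl⟩ := Submodule.mem_span_singleton.1 hb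
  exact ⟨r, by simpa using ha⟩

theorem flagMem2_of_lt (c : MaxFlag2 F m) {k : ℕ} (h : k < 2 * m + 1) :
    flagMem2 c k = c.1 ⟨k, h⟩ := dif_pos h

theorem finrank_flagMem2 (c : MaxFlag2 F m) {k : ℕ} (h : k ≤ 2 * m) :
    Module.finrank F (flagMem2 c k) = k := by
  rw [flagMem2_of_lt c (by omega)]
  exact c.2.2 _

theorem flagMem2_eq_top (c : MaxFlag2 F m) {k : ℕ} (h : 2 * m ≤ k) : flagMem2 c k = ⊤ := by
  rcases h.eq_or_lt with rfl | h
  · apply Submodule.eq_top_of_finrank_eq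
    rw [finrank_flagMem2 c le_rfl]; simp
  · exact dif_neg (by omega)

theorem flagMem2_zero (c : MaxFlag2 F m) : flagMem2 c 0 = ⊥ :=
  Submodule.finrank_eq_zero.1 (finrank_flagMem2 c (Nat.zero_le _))

theorem flagMem2_mono (c : MaxFlag2 F m) : Monotone (flagMem2 c) := by
  intro j k hjk
  by_cases hk : k < 2 * m + 1
  · rw [flagMem2_of_lt c hk, flagMem2_of_lt c (by omega)]
    exact c.2.1 hjk
  · rw [flagMem2_eq_top c (by omega : 2 * m ≤ k)]
    exact le_top

theorem flagMem2_ext {c d : MaxFlag2 F m} (h : ∀ k, flagMem2 c k = flagMem2 d k) : c = d := by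
  apply Subtype.ext
  funext k
  have := h k
  rwa [flagMem2_of_lt c k.2, flagMem2_of_lt d k.2] at this

/-- The component of dimension `i + 1` of a flag can be replaced arbitrarily between its
neighbours. -/
theorem exists_flag_replace (c : MaxFlag2 F m) {i : ℕ} (hi : i + 2 ≤ 2 * m)
    {S : Submodule F (Fin (2 * m) → F)} (h1 : flagMem2 c i ≤ S) (h2 : S ≤ flagMem2 c (i + 2))
    (hS : Module.finrank F S = i + 1) :
    ∃ d : MaxFlag2 F m, flagMem2 d (i + 1) = S ∧ ∀ k, k ≠ i + 1 → flagMem2 d k = flagMem2 c k := by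
  let U : Fin (2 * m + 1) → Submodule F (Fin (2 * m) → F) :=
    fun k => if (k : ℕ) = i + 1 then S else flagMem2 c k
  have hU : Monotone U := by
    intro a b hab
    have hab' : (a : ℕ) ≤ b := hab
    simp only [U]
    split_ifs with ha hb hb
    · exact le_rfl
    · exact h2.trans (flagMem2_mono c (by omega))
    · exact (flagMem2_mono c (by omega)).trans h1
    · exact flagMem2_mono c hab'
  have hUr : ∀ k : Fin (2 * m + 1), Module.finrank F (U k) = (k : ℕ) := by
    intro k
    by_cases hk : (k : ℕ) = i + 1
    · rw [show U k = S from if_pos hk, hS, hk]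
    · rw [show U k = flagMem2 c k from if_neg hk]
      exact finrank_flagMem2 c (by omega)
  obtain ⟨d, hd⟩ : ∃ d : MaxFlag2 F m, d.1 = U := ⟨⟨U, hU, hUr⟩, rfl⟩
  refine ⟨d, ?_, fun k hk => ?_⟩
  · rw [flagMem2_of_lt d (by omega), hd]
    exact if_pos rfl
  · rcases Nat.lt_or_ge k (2 * m + 1) with h | h
    · rw [flagMem2_of_lt d h, hd]
      exact if_neg hk
    · rw [flagMem2_eq_top d (by omega), flagMem2_eq_top c (by omega)]

/-- Two flags lie in the same panel of type `i` if they agree except possibly in dimension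
`i + 1`. -/
def SamePanel (i : ℕ) (c d : MaxFlag2 F m) : Prop :=
  ∀ k, k ≠ i + 1 → flagMem2 c k = flagMem2 d k

theorem SamePanel.refl (i : ℕ) (c : MaxFlag2 F m) : SamePanel i c c := fun _ _ => rfl

theorem SamePanel.symm {i : ℕ} {c d : MaxFlag2 F m} (h : SamePanel i c d) : SamePanel i d c :=
  fun k hk => (h k hk).symm

theorem SamePanel.trans {i : ℕ} {c d e : MaxFlag2 F m} (h : SamePanel i c d)
    (h' : SamePanel i d e) : SamePanel i c e := fun k hk => (h k hk).trans (h' k hk)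

theorem SamePanel.eq_of {i : ℕ} {c d : MaxFlag2 F m} (h : SamePanel i c d)
    (h' : flagMem2 c (i + 1) = flagMem2 d (i + 1)) : c = d :=
  flagMem2_ext fun k => by
    by_cases hk : k = i + 1
    · rw [hk, h']
    · exact h k hk

/-- In a panel, each vector of the upper space outside the lower space lies in the middle
component of exactly one flag. -/
theorem existsUnique_samePanel (c : MaxFlag2 F m) {i : ℕ} (hi : i + 2 ≤ 2 * m)
    {x : Fin (2 * m) → F} (hx : x ∈ flagMem2 c (i + 2)) (hx' : x ∉ flagMem2 c i) :
    ∃! d : MaxFlag2 F m, SamePanel i c d ∧ x ∈ flagMem2 d (i + 1) := by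
  obtain ⟨d, hd, hd'⟩ := exists_flag_replace c hi (S := flagMem2 c i ⊔ Submodule.span F {x})
    le_sup_left (sup_le (flagMem2_mono c (by omega)) (by simpa using hx))
    (by rw [Submodule.finrank_sup_span_singleton hx', finrank_flagMem2 c (by omega)])
  refine ⟨d, ⟨fun k hk => (hd' k hk).symm, ?_⟩, ?_⟩
  · rw [hd]
    exact Submodule.mem_sup_right (Submodule.mem_span_singleton_self x)
  · rintro e ⟨he, hxe⟩
    refine SamePanel.eq_of (i := i) (he.symm.trans fun k hk => (hd' k hk).symm) ?_
    rw [hd, he i (by omega)]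
    refine (Submodule.sup_span_singleton_eq (flagMem2_mono e (by omega)) ?_ hxe ?_).symm
    · rw [finrank_flagMem2 e (by omega), finrank_flagMem2 e (by omega)]
    · rwa [← he i (by omega)]

theorem SamePanel.inf_eq {i : ℕ} (hi : i + 2 ≤ 2 * m) {c d : MaxFlag2 F m} (h : SamePanel i c d)
    (hne : c ≠ d) {x : Fin (2 * m) → F} (hc : x ∈ flagMem2 c (i + 1))
    (hd : x ∈ flagMem2 d (i + 1)) : x ∈ flagMem2 c i := by
  by_contra hx
  obtain ⟨e, -, he⟩ := existsUnique_samePanel c hi (flagMem2_mono c (by omega) hc) hx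
  exact hne ((he c ⟨SamePanel.refl i c, hc⟩).trans (he d ⟨h, hd⟩).symm)

theorem flagMem2_decompose (c : MaxFlag2 F m) {k : ℕ} {x y : Fin (2 * m) → F}
    (hx : x ∈ flagMem2 c (k + 1)) (hx' : x ∉ flagMem2 c k) (hy : y ∈ flagMem2 c (k + 1)) :
    ∃ r : F, y - r • x ∈ flagMem2 c k := by
  have hk : k < 2 * m := by
    by_contra h
    rw [flagMem2_eq_top c (by omega)] at hx'
    exact hx' trivial
  exact Submodule.mem_of_finrank_succ (flagMem2_mono c (by omega))
    (by rw [finrank_flagMem2 c (by omega), finrank_flagMem2 c (by omega)]) hx hx' hy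

/-- The flag `d` is in relative position `w` to `c`: the filtration of `d_(i+1) / d_i` induced
by `c` jumps at `w i + 1`. -/
def HasJump (w : ℕ → ℕ) (c d : MaxFlag2 F m) : Prop :=
  ∀ i < 2 * m, flagMem2 c (w i) ⊓ flagMem2 d (i + 1) ≤ flagMem2 d i ∧
    ¬ flagMem2 c (w i + 1) ⊓ flagMem2 d (i + 1) ≤ flagMem2 d i

theorem HasJump.eq {w w' : ℕ → ℕ} {c d : MaxFlag2 F m} (h : HasJump w c d) (h' : HasJump w' c d)
    {i : ℕ} (hi : i < 2 * m) : w i = w' i := by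
  rcases lt_trichotomy (w i) (w' i) with hlt | heq | hlt
  · exact absurd ((inf_le_inf_right _ (flagMem2_mono c hlt)).trans (h' i hi).1) (h i hi).2
  · exact heq
  · exact absurd ((inf_le_inf_right _ (flagMem2_mono c hlt)).trans (h i hi).1) (h' i hi).2

theorem hasJump_id {c d : MaxFlag2 F m} : HasJump id c d ↔ c = d := by
  constructor
  · intro h
    have key : ∀ k ≤ 2 * m, flagMem2 c k = flagMem2 d k := by
      intro k
      induction k with
      | zero => intro _; rw [flagMem2_zero, flagMem2_zero]
      | succ k ih =>
        intro hk
        have ih := ih (by omega)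
        obtain ⟨x, hx, hx'⟩ := SetLike.not_le_iff_exists.1 (h k (by omega)).2
        have hc := finrank_flagMem2 c hk
        have hd := finrank_flagMem2 d hk
        have hdk := finrank_flagMem2 d (by omega : k ≤ 2 * m)
        rw [← Submodule.sup_span_singleton_eq (flagMem2_mono d (Nat.le_succ k))
          (by rw [hd, hdk]) hx.2 hx']
        rw [← ih] at hx' hdk ⊢
        exact (Submodule.sup_span_singleton_eq (flagMem2_mono c (Nat.le_succ k))
          (by rw [hc, hdk]) hx.1 hx').symm
    refine flagMem2_ext fun k => ?_
    rcases le_total k (2 * m) with hk | hk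
    · exact key k hk
    · rw [flagMem2_eq_top c hk, flagMem2_eq_top d hk]
  · rintro rfl i hi
    refine ⟨inf_le_left, fun h => ?_⟩
    have := Submodule.finrank_mono ((le_inf le_rfl le_rfl).trans h)
    simp only [id] at this
    rw [finrank_flagMem2 c (by omega), finrank_flagMem2 c (by omega)] at this
    omega

theorem HasJump.swap {w : ℕ → ℕ} {c d e : MaxFlag2 F m} {i : ℕ} (hi : i + 2 ≤ 2 * m)
    (hw : w i < w (i + 1)) (h : HasJump w c d) (hde : SamePanel i d e) (hne : d ≠ e) :
    HasJump (w ∘ Equiv.swap i (i + 1)) c e := by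
  have hX : flagMem2 d i = flagMem2 e i := hde i (by omega)
  have hY : flagMem2 d (i + 1 + 1) = flagMem2 e (i + 1 + 1) := hde _ (by omega)
  obtain ⟨ha, ha'⟩ := h i (by omega)
  obtain ⟨hb, hb'⟩ := h (i + 1) (by omega)
  obtain ⟨x, ⟨hxc, hxd⟩, hx⟩ := SetLike.not_le_iff_exists.1 ha'
  obtain ⟨y, ⟨hyc, hyd⟩, hy⟩ := SetLike.not_le_iff_exists.1 hb'
  have hxe : x ∉ flagMem2 e (i + 1) := fun h' => hx (hde.inf_eq hi hne hxd h')
  intro j hj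
  rcases eq_or_ne j i with rfl | hji
  · simp only [Function.comp, Equiv.swap_apply_left]
    constructor
    · rintro z ⟨hzc, hze⟩
      have hzd : z ∈ flagMem2 d (j + 1) :=
        hb ⟨hzc, hY ▸ flagMem2_mono e (by omega : j + 1 ≤ j + 1 + 1) hze⟩
      exact hX ▸ hde.inf_eq hi hne hzd hze
    · intro hle
      obtain ⟨r, hr⟩ := flagMem2_decompose e
        (hY ▸ flagMem2_mono d (by omega : j + 1 ≤ j + 1 + 1) hxd) hxe (hY ▸ hyd)
      have h1 : y - r • x ∈ flagMem2 c (w (j + 1) + 1) := Submodule.sub_mem _ hyc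
        (Submodule.smul_mem _ _ (flagMem2_mono c (by omega) hxc))
      have h2 : y - r • x ∈ flagMem2 d (j + 1) :=
        flagMem2_mono d (by omega : j ≤ j + 1) (hX ▸ hle ⟨h1, hr⟩)
      exact hy (by simpa using Submodule.add_mem _ h2 (Submodule.smul_mem _ r hxd))
  rcases eq_or_ne j (i + 1) with rfl | hji'
  · simp only [Function.comp, Equiv.swap_apply_right]
    constructor
    · rintro z ⟨hzc, hze⟩
      have hzd : z ∈ flagMem2 d (i + 1) := hb ⟨flagMem2_mono c hw.le hzc, hY ▸ hze⟩
      exact flagMem2_mono e (by omega : i ≤ i + 1) (hX ▸ ha ⟨hzc, hzd⟩)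
    · intro hle
      exact hxe (hle ⟨hxc, hY ▸ flagMem2_mono d (by omega : i + 1 ≤ i + 1 + 1) hxd⟩)
  · simp only [Function.comp, Equiv.swap_apply_of_ne_of_ne hji hji']
    rw [← hde j (by omega), ← hde (j + 1) (by omega)]
    exact h j hj

theorem HasJump.exists_of_swap {w : ℕ → ℕ} {c e : MaxFlag2 F m} {i : ℕ} (hi : i + 2 ≤ 2 * m)
    (hw : w i < w (i + 1)) (h : HasJump (w ∘ Equiv.swap i (i + 1)) c e) :
    ∃ d, HasJump w c d ∧ SamePanel i d e ∧ d ≠ e := by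
  obtain ⟨hb, hb'⟩ := h i (by omega)
  obtain ⟨ha, ha'⟩ := h (i + 1) (by omega)
  simp only [Function.comp, Equiv.swap_apply_left] at hb hb'
  simp only [Function.comp, Equiv.swap_apply_right] at ha ha'
  obtain ⟨x, ⟨hxc, hxY⟩, hxe⟩ := SetLike.not_le_iff_exists.1 ha'
  have hxX : x ∉ flagMem2 e i := fun h' => hxe (flagMem2_mono e (by omega) h')
  obtain ⟨d, ⟨hed, hxd⟩, -⟩ := existsUnique_samePanel e hi hxY hxX
  have hX : flagMem2 e i = flagMem2 d i := hed i (by omega)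
  have hY : flagMem2 e (i + 1 + 1) = flagMem2 d (i + 1 + 1) := hed _ (by omega)
  have hne : e ≠ d := by rintro rfl; exact hxe hxd
  obtain ⟨y, ⟨hyc, hye⟩, hy⟩ := SetLike.not_le_iff_exists.1 hb'
  refine ⟨d, fun j hj => ?_, hed.symm, hne.symm⟩
  rcases eq_or_ne j i with rfl | hji
  · constructor
    · rintro z ⟨hzc, hzd⟩
      have hze : z ∈ flagMem2 e (j + 1) :=
        ha ⟨hzc, hY ▸ flagMem2_mono d (by omega : j + 1 ≤ j + 1 + 1) hzd⟩
      exact hX ▸ hed.inf_eq hi hne hze hzd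
    · exact fun hle => hxX (hX ▸ hle ⟨hxc, hxd⟩)
  rcases eq_or_ne j (i + 1) with rfl | hji'
  · constructor
    · rintro z ⟨hzc, hzd⟩
      obtain ⟨r, hr⟩ := flagMem2_decompose e hxY hxe (hY ▸ hzd)
      have h1 : z - r • x ∈ flagMem2 c (w (i + 1)) := Submodule.sub_mem _ hzc
        (Submodule.smul_mem _ _ (flagMem2_mono c (by omega) hxc))
      have h2 : z - r • x ∈ flagMem2 d (i + 1) :=
        flagMem2_mono d (by omega : i ≤ i + 1) (hX ▸ hb ⟨h1, hr⟩)
      simpa using Submodule.add_mem _ h2 (Submodule.smul_mem _ r hxd)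
    · exact fun hle => hy (hed.inf_eq hi hne hye
        (hle ⟨hyc, hY ▸ flagMem2_mono e (by omega : i + 1 ≤ i + 1 + 1) hye⟩))
  · have := h j hj
    simp only [Function.comp, Equiv.swap_apply_of_ne_of_ne hji hji'] at this
    rwa [hed j (by omega), hed (j + 1) (by omega)] at this

theorem opp2_iff {c d : MaxFlag2 F m} :
    Opp2 c d ↔ ∀ k ≤ 2 * m, flagMem2 c k ⊓ flagMem2 d (2 * m - k) = ⊥ := by
  constructor
  · intro h k hk
    have := h ⟨k, by omega⟩
    rw [flagMem2_of_lt c (by omega), flagMem2_of_lt d (by omega)]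
    convert this using 3
    simp [Fin.rev]
  · intro h k
    have := h k (by omega)
    rw [flagMem2_of_lt c (by omega), flagMem2_of_lt d (by omega)] at this
    convert this using 3
    simp [Fin.rev]

theorem Opp2.symm {c d : MaxFlag2 F m} (h : Opp2 c d) : Opp2 d c := by
  rw [opp2_iff] at h ⊢
  intro k hk
  have := h (2 * m - k) (by omega)
  rwa [inf_comm, (by omega : 2 * m - (2 * m - k) = k)] at this

/-- Opposite flags are those in relative position the longest permutation. -/
theorem hasJump_rev_iff {w : ℕ → ℕ} (hw : ∀ i < 2 * m, w i = 2 * m - 1 - i)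
    {c d : MaxFlag2 F m} : HasJump w c d ↔ Opp2 c d := by
  rw [opp2_iff]
  constructor
  · intro h
    have key : ∀ k ≤ 2 * m, flagMem2 c (2 * m - k) ⊓ flagMem2 d k = ⊥ := by
      intro k
      induction k with
      | zero => intro _; rw [flagMem2_zero, inf_bot_eq]
      | succ k ih =>
        intro hk
        have h1 := (h k (by omega)).1
        rw [hw k (by omega), (by omega : 2 * m - 1 - k = 2 * m - (k + 1))] at h1
        rw [eq_bot_iff, ← ih (by omega)]
        exact le_inf (inf_le_left.trans (flagMem2_mono c (by omega))) h1
    intro k hk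
    have := key (2 * m - k) (by omega)
    rwa [(by omega : 2 * m - (2 * m - k) = k)] at this
  · intro h i hi
    rw [hw i hi]
    constructor
    · have := h (2 * m - 1 - i) (by omega)
      rw [(by omega : 2 * m - (2 * m - 1 - i) = i + 1)] at this
      rw [this]; exact bot_le
    · intro hle
      have h1 := h (2 * m - 1 - i + 1) (by omega)
      rw [(by omega : 2 * m - (2 * m - 1 - i + 1) = i)] at h1
      have h2 : flagMem2 c (2 * m - 1 - i + 1) ⊓ flagMem2 d (i + 1) = ⊥ := by
        rw [eq_bot_iff, ← h1]
        exact le_inf inf_le_left hle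
      have h3 := Submodule.finrank_add_finrank_le_of_disjoint (disjoint_iff.2 h2)
      rw [finrank_flagMem2 c (by omega), finrank_flagMem2 d (by omega)] at h3
      simp at h3
      omega

end FlagGeometry

section FlagHecke

open Classical

/-- The matrix of the relation of being in relative position `w`. -/
noncomputable def jumpMat (F : Type) [Field F] (m : ℕ) (w : ℕ → ℕ) :
    Matrix (MaxFlag2 F m) (MaxFlag2 F m) ℝ :=
  Matrix.of fun c d => if HasJump w c d then 1 else 0

/-- The adjacency matrix of the relation of being distinct in a common panel of type `i`. -/
noncomputable def panelMat (F : Type) [Field F] (m i : ℕ) :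
    Matrix (MaxFlag2 F m) (MaxFlag2 F m) ℝ :=
  Matrix.of fun c d => if SamePanel i c d ∧ c ≠ d then 1 else 0

variable {F : Type} [Field F] {m : ℕ}

theorem HasJump.congr {w w' : ℕ → ℕ} (h : ∀ i < 2 * m, w i = w' i) {c d : MaxFlag2 F m} :
    HasJump w c d ↔ HasJump w' c d := by
  unfold HasJump
  exact forall₂_congr fun i hi => by rw [h i hi]

theorem jumpMat_congr {w w' : ℕ → ℕ} (h : ∀ i < 2 * m, w i = w' i) :
    jumpMat F m w = jumpMat F m w' := by
  ext c d
  simp only [jumpMat, Matrix.of_apply]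
  exact if_congr (HasJump.congr h) rfl rfl

theorem jumpMat_id : jumpMat F m id = 1 := by
  ext c d
  simp only [jumpMat, Matrix.of_apply, hasJump_id, Matrix.one_apply]

theorem panelMat_transpose (i : ℕ) : (panelMat F m i)ᵀ = panelMat F m i := by
  ext c d
  simp only [panelMat, Matrix.of_apply, Matrix.transpose_apply]
  congr 1
  rw [eq_iff_iff, ne_comm]
  exact and_congr_left' ⟨SamePanel.symm, SamePanel.symm⟩

theorem panelMat_add_one_apply (i : ℕ) (c d : MaxFlag2 F m) :
    (panelMat F m i + 1) c d = if SamePanel i c d then 1 else 0 := by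
  simp only [panelMat, Matrix.add_apply, Matrix.of_apply, Matrix.one_apply]
  by_cases h : c = d
  · subst h; simp [SamePanel.refl]
  · simp [h]

/-- The real adjacency matrix of the opposition graph. -/
noncomputable def oppMat (F : Type) [Field F] (m : ℕ) :
    Matrix (MaxFlag2 F m) (MaxFlag2 F m) ℝ :=
  Matrix.of fun c d => if Opp2 c d then 1 else 0

theorem oppMat_transpose : (oppMat F m)ᵀ = oppMat F m := by
  ext c d
  simp only [oppMat, Matrix.of_apply, Matrix.transpose_apply]
  exact if_congr ⟨Opp2.symm, Opp2.symm⟩ rfl rfl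

variable [Fintype F]

theorem jumpMat_mul_panelMat {w : ℕ → ℕ} {i : ℕ} (hi : i + 2 ≤ 2 * m) (hw : w i < w (i + 1)) :
    jumpMat F m w * panelMat F m i = jumpMat F m (w ∘ Equiv.swap i (i + 1)) := by
  ext c e
  simp only [jumpMat, panelMat, Matrix.mul_apply, Matrix.of_apply]
  by_cases h : HasJump (w ∘ Equiv.swap i (i + 1)) c e
  · obtain ⟨d, hd, hde, hne⟩ := h.exists_of_swap hi hw
    rw [if_pos h, Finset.sum_eq_single d]
    · simp [hd, hde, hne]
    · intro d' _ hd'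
      by_contra h0
      have h1 : HasJump w c d' ∧ SamePanel i d' e ∧ d' ≠ e := by
        by_contra hcon
        apply h0
        split_ifs with h1 h2 <;> simp_all
      have h2 := (hd.swap hi hw (hde.trans h1.2.1.symm) (Ne.symm hd')).eq h1.1
        (by omega : i < 2 * m)
      simp only [Function.comp, Equiv.swap_apply_left] at h2
      omega
    · simp
  · rw [if_neg h]
    refine Finset.sum_eq_zero fun d _ => ?_
    by_contra h0
    apply h
    have h1 : HasJump w c d ∧ SamePanel i d e ∧ d ≠ e := by
      by_contra hcon
      apply h0
      split_ifs with h1 h2 <;> simp_all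
    exact h1.1.swap hi hw h1.2.1 h1.2.2

theorem panelMat_eq {i : ℕ} (hi : i + 2 ≤ 2 * m) :
    panelMat F m i = jumpMat F m (id ∘ Equiv.swap i (i + 1)) := by
  rw [← jumpMat_mul_panelMat hi (by simp), jumpMat_id, one_mul]

theorem panelMat_comm {i j : ℕ} (hij : i + 1 < j) (hj : j + 2 ≤ 2 * m) :
    panelMat F m i * panelMat F m j = panelMat F m j * panelMat F m i := by
  conv_lhs => rw [panelMat_eq (by omega : i + 2 ≤ 2 * m)]
  conv_rhs => rw [panelMat_eq hj]
  rw [jumpMat_mul_panelMat hj, jumpMat_mul_panelMat (by omega : i + 2 ≤ 2 * m)]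
  · congr 1
    funext k
    simp only [Function.comp, id, Equiv.swap_apply_def]
    split_ifs <;> omega
  · simp only [Function.comp, id, Equiv.swap_apply_def]
    split_ifs <;> omega
  · simp only [Function.comp, id, Equiv.swap_apply_def]
    split_ifs <;> omega

theorem panelMat_braid {i : ℕ} (hi : i + 3 ≤ 2 * m) :
    panelMat F m i * panelMat F m (i + 1) * panelMat F m i =
      panelMat F m (i + 1) * panelMat F m i * panelMat F m (i + 1) := by
  have key : ∀ a b : ℕ, a + 2 ≤ 2 * m → b + 2 ≤ 2 * m → (a + 1 = b ∨ b + 1 = a) →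
      panelMat F m a * panelMat F m b * panelMat F m a =
        jumpMat F m (((id ∘ Equiv.swap a (a + 1)) ∘ Equiv.swap b (b + 1)) ∘
          Equiv.swap a (a + 1)) := by
    intro a b ha hb hab
    rw [← jumpMat_mul_panelMat ha, ← jumpMat_mul_panelMat hb, ← panelMat_eq ha]
    all_goals
      simp only [Function.comp, id, Equiv.swap_apply_def]
      split_ifs <;> omega
  rw [key i (i + 1) (by omega) (by omega) (by simp), key (i + 1) i (by omega) (by omega) (by simp)]
  congr 1
  funext k
  simp only [Function.comp, id, Equiv.swap_apply_def]
  split_ifs <;> omega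

theorem card_filter_mem {K V : Type*} [Field K] [Fintype K] [AddCommGroup V] [Module K V]
    [Fintype V] (S : Submodule K V) [DecidablePred (· ∈ S)] :
    (Finset.univ.filter (· ∈ S)).card = Fintype.card K ^ Module.finrank K S := by
  rw [← Module.card_eq_pow_finrank, Fintype.card_subtype]

theorem card_filter_mem_sdiff {K V : Type*} [Field K] [Fintype K] [AddCommGroup V] [Module K V]
    [Fintype V] {A S : Submodule K V} (h : A ≤ S) :
    ((Finset.univ.filter fun x => x ∈ S ∧ x ∉ A).card : ℝ) =
      (Fintype.card K : ℝ) ^ Module.finrank K S - (Fintype.card K : ℝ) ^ Module.finrank K A := by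
  have h1 : (Finset.univ.filter fun x => x ∈ S ∧ x ∉ A) =
      Finset.univ.filter (· ∈ S) \ Finset.univ.filter (· ∈ A) := by
    ext x; simp
  rw [h1, Finset.cast_card_sdiff, card_filter_mem, card_filter_mem]
  · push_cast; rfl
  · intro x; simpa using @h x

theorem card_panel (c : MaxFlag2 F m) {i : ℕ} (hi : i + 2 ≤ 2 * m) :
    ((Finset.univ.filter fun d => SamePanel i c d).card : ℝ) = Fintype.card F + 1 := by
  have hq : (1 : ℝ) < Fintype.card F := by exact_mod_cast Fintype.one_lt_card
  have hpos : (0 : ℝ) < (Fintype.card F : ℝ) ^ i := by positivity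
  have h := Finset.sum_card_bipartiteAbove_eq_sum_card_bipartiteBelow
    (s := Finset.univ.filter fun d : MaxFlag2 F m => SamePanel i c d)
    (t := Finset.univ.filter fun x => x ∈ flagMem2 c (i + 2) ∧ x ∉ flagMem2 c i)
    (fun d x => x ∈ flagMem2 d (i + 1))
  have h1 : ∀ d ∈ Finset.univ.filter fun d : MaxFlag2 F m => SamePanel i c d,
      ((Finset.bipartiteAbove (fun (d : MaxFlag2 F m) x => x ∈ flagMem2 d (i + 1))
        (Finset.univ.filter fun x => x ∈ flagMem2 c (i + 2) ∧ x ∉ flagMem2 c i) d).card : ℝ) =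
        (Fintype.card F : ℝ) ^ i * (Fintype.card F - 1) := by
    intro d hd
    have hd : SamePanel i c d := by simpa using hd
    have h2 : Finset.bipartiteAbove (fun (d : MaxFlag2 F m) x => x ∈ flagMem2 d (i + 1))
        (Finset.univ.filter fun x => x ∈ flagMem2 c (i + 2) ∧ x ∉ flagMem2 c i) d =
        Finset.univ.filter fun x => x ∈ flagMem2 d (i + 1) ∧ x ∉ flagMem2 d i := by
      ext x
      simp only [Finset.mem_bipartiteAbove, Finset.mem_filter, Finset.mem_univ, true_and]
      rw [hd (i + 2) (by omega), hd i (by omega)]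
      have := @flagMem2_mono F _ m d (i + 1) (i + 2) (by omega) x
      tauto
    rw [h2, card_filter_mem_sdiff (flagMem2_mono d (by omega)), finrank_flagMem2 d (by omega),
      finrank_flagMem2 d (by omega)]
    ring
  have h2 : ∀ x ∈ Finset.univ.filter fun x => x ∈ flagMem2 c (i + 2) ∧ x ∉ flagMem2 c i,
      (Finset.bipartiteBelow (fun (d : MaxFlag2 F m) x => x ∈ flagMem2 d (i + 1))
        (Finset.univ.filter fun d : MaxFlag2 F m => SamePanel i c d) x).card = 1 := by
    intro x hx
    simp only [Finset.mem_filter, Finset.mem_univ, true_and] at hx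
    obtain ⟨d, hd, hd'⟩ := existsUnique_samePanel c hi hx.1 hx.2
    rw [Finset.card_eq_one]
    refine ⟨d, ?_⟩
    ext e
    simp only [Finset.mem_bipartiteBelow, Finset.mem_filter, Finset.mem_univ, true_and,
      Finset.mem_singleton]
    exact ⟨hd' e, fun h => h ▸ hd⟩
  rw [Finset.sum_congr rfl h2] at h
  have h := congrArg (Nat.cast : ℕ → ℝ) h
  push_cast at h
  rw [Finset.sum_congr rfl h1, Finset.sum_const, Finset.sum_const, nsmul_eq_mul, nsmul_eq_mul,
    card_filter_mem_sdiff (flagMem2_mono c (by omega)), finrank_flagMem2 c (by omega),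
    finrank_flagMem2 c (by omega)] at h
  have h0 : (Fintype.card F : ℝ) ^ i * (Fintype.card F - 1) ≠ 0 :=
    (mul_pos hpos (by linarith)).ne'
  apply mul_right_cancel₀ h0
  rw [h]
  ring

theorem panelMat_quad {i : ℕ} (hi : i + 2 ≤ 2 * m) :
    panelMat F m i * panelMat F m i = ((Fintype.card F : ℝ) - 1) • panelMat F m i +
      (Fintype.card F : ℝ) • (1 : Matrix (MaxFlag2 F m) (MaxFlag2 F m) ℝ) := by
  have h : (panelMat F m i + 1) * (panelMat F m i + 1) =
      ((Fintype.card F : ℝ) + 1) • (panelMat F m i + 1) := by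
    ext c e
    rw [Matrix.mul_apply, Matrix.smul_apply, panelMat_add_one_apply, ← card_panel c hi]
    simp only [panelMat_add_one_apply, mul_boole, ← ite_and, Finset.sum_boole, smul_eq_mul]
    split_ifs with h
    · congr 2
      ext d
      simp only [Finset.mem_filter, Finset.mem_univ, true_and]
      exact ⟨fun h' => h'.2, fun h' => ⟨h'.symm.trans h, h'⟩⟩
    · rw [Nat.cast_eq_zero, Finset.card_eq_zero, Finset.filter_eq_empty_iff]
      exact fun d _ h' => h (h'.2.trans h'.1)
  have h' : panelMat F m i * panelMat F m i =
      (panelMat F m i + 1) * (panelMat F m i + 1) - (2 : ℝ) • panelMat F m i - 1 := by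
    rw [two_smul]; noncomm_ring
  rw [h', h]
  module

/-- The permutation obtained from the identity by moving `p` to position `r`, and then reversing
the values beyond. -/
def moved (N p r i : ℕ) : ℕ :=
  if i < p then i else if i < r then N + p - i else if i = r then p else N + 1 + p - i

theorem jumpMat_mul_descProd {N p : ℕ} (hN : N + 1 = 2 * m) (k : ℕ) (hk : p + k ≤ N) :
    jumpMat F m (moved N p (N - k)) * descProd (fun i => panelMat F m (N - 1 - i)) k =
      jumpMat F m (moved N p N) := by
  induction k with
  | zero => simp [descProd]
  | succ k ih =>
    rw [← ih (by omega), descProd, ← mul_assoc, jumpMat_mul_panelMat (by omega)]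
    · congr 1
      apply jumpMat_congr
      intro i hi
      simp only [Function.comp, moved, Equiv.swap_apply_def]
      split_ifs <;> omega
    · simp only [moved]
      split_ifs <;> omega

theorem longProd_panelMat_aux {N : ℕ} (hN : N + 1 = 2 * m) (k : ℕ) (hk : k ≤ N) :
    longProd (fun i => panelMat F m (N - 1 - i)) k =
      jumpMat F m (fun i => if i < N - k then i else N + (N - k) - i) := by
  induction k with
  | zero =>
    rw [longProd, ← jumpMat_id]
    apply jumpMat_congr
    intro i hi
    simp only [id]
    split_ifs <;> omega
  | succ k ih =>
    rw [longProd, ih (by omega)]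
    have h := jumpMat_mul_descProd (F := F) (p := N - (k + 1)) hN (k + 1) (by omega)
    convert h using 1
    · congr 1
      apply jumpMat_congr
      intro i hi
      simp only [moved]
      split_ifs <;> omega
    · apply jumpMat_congr
      intro i hi
      simp only [moved]
      split_ifs <;> omega

theorem longProd_panelMat {N : ℕ} (hN : N + 1 = 2 * m) :
    longProd (fun i => panelMat F m (N - 1 - i)) N = oppMat F m := by
  rw [longProd_panelMat_aux hN N le_rfl]
  ext c d
  simp only [jumpMat, oppMat, Matrix.of_apply]
  refine if_congr (hasJump_rev_iff fun i hi => ?_) rfl rfl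
  simp only [Nat.sub_self]
  split_ifs <;> omega

end FlagHecke

section PointFunctions

open Classical

/-- The indicator function of the flags whose member of dimension `k` contains the vector `x`. -/
noncomputable def ptFun {F : Type} [Field F] {m : ℕ} (x : Fin (2 * m) → F) (k : ℕ)
    (c : MaxFlag2 F m) : ℝ :=
  if x ∈ flagMem2 c k then 1 else 0

variable {F : Type} [Field F] {m : ℕ}

theorem ptFun_zero {x : Fin (2 * m) → F} (hx : x ≠ 0) : ptFun x 0 = 0 := by
  funext c
  simp [ptFun, flagMem2_zero, hx]

theorem ptFun_top (x : Fin (2 * m) → F) {k : ℕ} (hk : 2 * m ≤ k) : ptFun x k = 1 := by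
  funext c
  simp [ptFun, flagMem2_eq_top c hk]

variable (F m) in
/-- The span of the functions `ptFun x k` for nonzero `x`. -/
noncomputable def ptSpan : Submodule ℝ (MaxFlag2 F m → ℝ) :=
  Submodule.span ℝ {f | ∃ x : Fin (2 * m) → F, x ≠ 0 ∧ ∃ k ≤ 2 * m, f = ptFun x k}

theorem ptFun_mem_ptSpan {x : Fin (2 * m) → F} (hx : x ≠ 0) {k : ℕ} (hk : k ≤ 2 * m) :
    ptFun x k ∈ ptSpan F m :=
  Submodule.subset_span ⟨x, hx, k, hk, rfl⟩

/-- A function which is constant on all panels of type at least `j₀` depends only on the members of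
dimension at most `j₀` of a flag. -/
theorem eq_of_forall_panel {f : MaxFlag2 F m → ℝ} {j₀ : ℕ}
    (hf : ∀ i, j₀ ≤ i → i + 2 ≤ 2 * m → ∀ c d, SamePanel i c d → f c = f d)
    {c d : MaxFlag2 F m} (hcd : ∀ k ≤ j₀, flagMem2 c k = flagMem2 d k) : f c = f d := by
  have key : ∀ t j : ℕ, j₀ ≤ j → 2 * m ≤ j + t → ∀ c d : MaxFlag2 F m,
      (∀ k ≤ j, flagMem2 c k = flagMem2 d k) → f c = f d := by
    intro t
    induction t with
    | zero =>
      intro j _ hj c d h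
      rw [show c = d from flagMem2_ext fun k => by
        rcases le_total k j with hk | hk
        · exact h k hk
        · rw [flagMem2_eq_top c (by omega), flagMem2_eq_top d (by omega)]]
    | succ t ih =>
      intro j hj1 hjt c d h
      by_cases hj : 2 * m ≤ j
      · exact ih j hj1 (by omega) c d h
      obtain ⟨x, hx, hx'⟩ : ∃ x, x ∈ flagMem2 d (j + 1) ∧ x ∉ flagMem2 d j := by
        by_contra! hcon
        have := Submodule.finrank_mono (show flagMem2 d (j + 1) ≤ flagMem2 d j from hcon)
        rw [finrank_flagMem2 d (by omega), finrank_flagMem2 d (by omega)] at this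
        omega
      have step : ∀ s : ℕ, ∀ c : MaxFlag2 F m, (∀ k ≤ j, flagMem2 c k = flagMem2 d k) →
          j + 1 + s ≤ 2 * m → x ∈ flagMem2 c (j + 1 + s) → f c = f d := by
        intro s
        induction s with
        | zero =>
          intro c hc hs hxc
          refine ih (j + 1) (by omega) (by omega) c d fun k hk => ?_
          rcases hk.lt_or_eq with hk | rfl
          · exact hc k (by omega)
          · rw [← Submodule.sup_span_singleton_eq (flagMem2_mono d (Nat.le_succ j)) (by
              rw [finrank_flagMem2 d (by omega), finrank_flagMem2 d (by omega)]) hx hx']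
            rw [← hc j le_rfl] at hx' ⊢
            exact (Submodule.sup_span_singleton_eq (flagMem2_mono c (Nat.le_succ j)) (by
              rw [finrank_flagMem2 c (by omega), finrank_flagMem2 c (by omega)]) hxc hx').symm
        | succ s ihs =>
          intro c hc hs hxc
          by_cases hxs : x ∈ flagMem2 c (j + s)
          · exact ihs c hc (by omega) (flagMem2_mono c (by omega) hxs)
          · obtain ⟨e, ⟨he, hxe⟩, -⟩ := existsUnique_samePanel c (i := j + s) (by omega)
              (by rwa [show j + s + 2 = j + 1 + (s + 1) by omega]) hxs
            rw [hf (j + s) (by omega) (by omega) c e he]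
            refine ihs e (fun k hk => ?_) (by omega) ?_
            · rw [← he k (by omega), hc k hk]
            · rwa [show j + 1 + s = j + s + 1 by omega]
      refine step (2 * m - (j + 1)) c h (by omega) ?_
      rw [flagMem2_eq_top c (by omega)]
      trivial
  exact key (2 * m) j₀ le_rfl (by omega) c d hcd

variable [Fintype F]

theorem panelMat_mulVec_add (i : ℕ) (f : MaxFlag2 F m → ℝ) (c : MaxFlag2 F m) :
    (panelMat F m i *ᵥ f) c + f c = ∑ d with SamePanel i c d, f d := by
  have h : (panelMat F m i *ᵥ f) c + f c = ((panelMat F m i + 1) *ᵥ f) c := by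
    rw [Matrix.add_mulVec, Matrix.one_mulVec, Pi.add_apply]
  rw [h, Matrix.mulVec, dotProduct, Finset.sum_filter]
  simp only [panelMat_add_one_apply, ite_mul, one_mul, zero_mul]

theorem panelMat_mulVec_of_const {i : ℕ} (hi : i + 2 ≤ 2 * m) {f : MaxFlag2 F m → ℝ}
    (hf : ∀ c d, SamePanel i c d → f c = f d) :
    panelMat F m i *ᵥ f = (Fintype.card F : ℝ) • f := by
  funext c
  have h := panelMat_mulVec_add i f c
  rw [Finset.sum_congr rfl (g := fun _ => f c), Finset.sum_const, nsmul_eq_mul,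
    card_panel c hi] at h
  · rw [Pi.smul_apply, smul_eq_mul]
    linarith
  · intro d hd
    exact (hf c d (by simpa using hd)).symm

theorem eq_of_panelMat_mulVec {i : ℕ} {f : MaxFlag2 F m → ℝ}
    (hf : panelMat F m i *ᵥ f = (Fintype.card F : ℝ) • f) {c d : MaxFlag2 F m}
    (h : SamePanel i c d) : f c = f d := by
  have hc := panelMat_mulVec_add i f c
  have hd := panelMat_mulVec_add i f d
  have h1 : ∀ e, SamePanel i c e ↔ SamePanel i d e :=
    fun e => ⟨fun h' => h.symm.trans h', fun h' => h.trans h'⟩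
  simp only [h1] at hc
  rw [← hd, hf, Pi.smul_apply, Pi.smul_apply, smul_eq_mul, smul_eq_mul] at hc
  have hq : (0 : ℝ) < (Fintype.card F : ℝ) + 1 := by positivity
  apply mul_left_cancel₀ hq.ne'
  linarith

theorem panelMat_ptFun_of_ne (x : Fin (2 * m) → F) {i k : ℕ} (hi : i + 2 ≤ 2 * m)
    (hk : k ≠ i + 1) : panelMat F m i *ᵥ ptFun x k = (Fintype.card F : ℝ) • ptFun x k :=
  panelMat_mulVec_of_const hi fun c d h => by simp only [ptFun, h k hk]

theorem panelMat_ptFun (x : Fin (2 * m) → F) {i : ℕ} (hi : i + 2 ≤ 2 * m) :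
    panelMat F m i *ᵥ ptFun x (i + 1) =
      ptFun x (i + 2) - ptFun x (i + 1) + (Fintype.card F : ℝ) • ptFun x i := by
  funext c
  have h := panelMat_mulVec_add i (ptFun x (i + 1)) c
  have hs : ∑ d with SamePanel i c d, ptFun x (i + 1) d =
      ptFun x (i + 2) c + (Fintype.card F : ℝ) • ptFun x i c := by
    by_cases h0 : x ∈ flagMem2 c i
    · have h2 := flagMem2_mono c (by omega : i ≤ i + 2) h0
      rw [Finset.sum_congr rfl (g := fun _ => 1), Finset.sum_const, nsmul_eq_mul,
        card_panel c hi]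
      · simp [ptFun, h0, h2]; ring
      · intro d hd
        have hd : SamePanel i c d := by simpa using hd
        rw [hd i (by omega)] at h0
        simp [ptFun, flagMem2_mono d (by omega : i ≤ i + 1) h0]
    · by_cases h2 : x ∈ flagMem2 c (i + 2)
      · obtain ⟨d, hd, hd'⟩ := existsUnique_samePanel c hi h2 h0
        rw [Finset.sum_eq_single d]
        · simp [ptFun, h0, h2, hd.2]
        · intro e he hne
          exact if_neg fun h' => hne (hd' e ⟨by simpa using he, h'⟩)
        · exact fun h' => absurd hd.1 (by simpa using h')
      · rw [Finset.sum_eq_zero]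
        · simp [ptFun, h0, h2]
        · intro d hd
          have hd : SamePanel i c d := by simpa using hd
          rw [hd (i + 2) (by omega)] at h2
          exact if_neg fun h' => h2 (flagMem2_mono d (by omega) h')
  simp only [Pi.add_apply, Pi.sub_apply, Pi.smul_apply]
  linarith

theorem panelMat_mulVec_mem_ptSpan {i : ℕ} (hi : i + 2 ≤ 2 * m) {f : MaxFlag2 F m → ℝ}
    (hf : f ∈ ptSpan F m) : panelMat F m i *ᵥ f ∈ ptSpan F m := by
  have h : ptSpan F m ≤ (ptSpan F m).comap (panelMat F m i).mulVecLin := by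
    refine Submodule.span_le.2 ?_
    rintro _ ⟨x, hx, k, hk, rfl⟩
    simp only [SetLike.mem_coe, Submodule.mem_comap, Matrix.mulVecLin_apply]
    by_cases hki : k = i + 1
    · subst hki
      rw [panelMat_ptFun x hi]
      exact Submodule.add_mem _ (Submodule.sub_mem _ (ptFun_mem_ptSpan hx hi)
        (ptFun_mem_ptSpan hx hk)) (Submodule.smul_mem _ _ (ptFun_mem_ptSpan hx (by omega)))
    · rw [panelMat_ptFun_of_ne x hi hki]
      exact Submodule.smul_mem _ _ (ptFun_mem_ptSpan hx hk)
  exact h hf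

theorem mem_ptSpan_of_fixed (hm : 1 ≤ m) {f : MaxFlag2 F m → ℝ}
    (hf : ∀ i, 1 ≤ i → i + 2 ≤ 2 * m → panelMat F m i *ᵥ f = (Fintype.card F : ℝ) • f) :
    f ∈ ptSpan F m := by
  have hq : (1 : ℝ) < Fintype.card F := by exact_mod_cast Fintype.one_lt_card
  let h : (Fin (2 * m) → F) → ℝ := fun x =>
    if hx : ∃ d : MaxFlag2 F m, x ∈ flagMem2 d 1 then f hx.choose else 0
  have hh : ∀ (x : Fin (2 * m) → F) (c : MaxFlag2 F m), x ≠ 0 → x ∈ flagMem2 c 1 → h x = f c := by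
    intro x c hx hxc
    have he : ∃ d : MaxFlag2 F m, x ∈ flagMem2 d 1 := ⟨c, hxc⟩
    rw [show h x = f he.choose from dif_pos he]
    refine eq_of_forall_panel (j₀ := 1)
      (fun i h1 h2 c d h => eq_of_panelMat_mulVec (hf i h1 h2) h) fun k hk => ?_
    rcases Nat.le_one_iff_eq_zero_or_eq_one.1 hk with rfl | rfl
    · rw [flagMem2_zero, flagMem2_zero]
    have h1 : ∀ e : MaxFlag2 F m, x ∈ flagMem2 e 1 → ⊥ ⊔ Submodule.span F {x} = flagMem2 e 1 :=
      fun e hxe => Submodule.sup_span_singleton_eq bot_le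
        (by rw [finrank_flagMem2 e (by omega), finrank_bot]) hxe (by simpa using hx)
    rw [← h1 _ he.choose_spec, ← h1 c hxc]
  have hfe : f = ((Fintype.card F : ℝ) - 1)⁻¹ • ∑ x with x ≠ 0, h x • ptFun x 1 := by
    funext c
    have h1 : ∑ x with x ≠ 0, h x • ptFun x 1 c =
        ∑ x with x ∈ flagMem2 c 1 ∧ x ∉ flagMem2 c 0, f c := by
      rw [Finset.sum_filter, Finset.sum_filter]
      refine Finset.sum_congr rfl fun x _ => ?_
      rw [flagMem2_zero, Submodule.mem_bot]
      by_cases hx : x = 0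
      · simp [hx]
      by_cases hxc : x ∈ flagMem2 c 1
      · simp [hx, hxc, ptFun, hh x c hx hxc]
      · simp [hxc, ptFun]
    rw [Pi.smul_apply, Finset.sum_apply]
    simp only [Pi.smul_apply]
    rw [h1, Finset.sum_const, nsmul_eq_mul, card_filter_mem_sdiff (flagMem2_mono c (by omega)),
      finrank_flagMem2 c (by omega), finrank_flagMem2 c (by omega), pow_zero, pow_one, smul_eq_mul,
      inv_mul_cancel_left₀ (by linarith)]
  rw [hfe]
  refine Submodule.smul_mem _ _ (Submodule.sum_mem _ fun x hx => Submodule.smul_mem _ _ ?_)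
  exact ptFun_mem_ptSpan (by simpa using hx) (by omega)

end PointFunctions

section Opposition

open Classical

variable {F : Type} [Field F] [Fintype F] {m : ℕ}

theorem descProd_mulVec_ptFun (x : Fin (2 * m) → F) {N j : ℕ} (hN : N + 1 = 2 * m) (k : ℕ)
    (hk : k ≤ N) :
    (k + j ≤ N ∨ N < j → descProd (fun i => panelMat F m (N - 1 - i)) k *ᵥ ptFun x j =
      (Fintype.card F : ℝ) ^ k • ptFun x j) ∧
    (N < k + j → j ≤ N → descProd (fun i => panelMat F m (N - 1 - i)) k *ᵥ ptFun x j =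
      (Fintype.card F : ℝ) ^ (k - 1) • (ptFun x (j + 1) - ptFun x (N - k + 1) +
        (Fintype.card F : ℝ) • ptFun x (N - k))) := by
  induction k with
  | zero => exact ⟨fun _ => by simp [descProd], fun h h' => absurd h (by omega)⟩
  | succ k ih =>
    obtain ⟨ih1, ih2⟩ := ih (by omega)
    rw [descProd, ← Matrix.mulVec_mulVec]
    refine ⟨fun h => ?_, fun h hj => ?_⟩
    · rw [ih1 (by omega), Matrix.mulVec_smul, panelMat_ptFun_of_ne x (by omega) (by omega),
        smul_smul, pow_succ]
    · rcases Nat.lt_or_ge N (k + j) with h' | h'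
      · rw [ih2 h' hj, Matrix.mulVec_smul, Matrix.mulVec_add, Matrix.mulVec_sub, Matrix.mulVec_smul,
          panelMat_ptFun_of_ne x (by omega) (by omega : j + 1 ≠ N - 1 - k + 1),
          panelMat_ptFun_of_ne x (by omega) (by omega : N - k + 1 ≠ N - 1 - k + 1),
          (by omega : N - k = N - 1 - k + 1), panelMat_ptFun x (by omega),
          (by omega : k + 1 - 1 = k - 1 + 1), (by omega : N - (k + 1) = N - 1 - k), pow_succ]
        module
      · obtain rfl : j = N - 1 - k + 1 := by omega
        rw [ih1 (Or.inl h'), Matrix.mulVec_smul, panelMat_ptFun x (by omega),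
          (by omega : N - (k + 1) = N - 1 - k), Nat.add_sub_cancel]

theorem longProd_mulVec_ptFun_of_le (x : Fin (2 * m) → F) {N j : ℕ} (hN : N + 1 = 2 * m) (k : ℕ)
    (hk : k ≤ N) (hj : j + k ≤ N ∨ N < j) :
    longProd (fun i => panelMat F m (N - 1 - i)) k *ᵥ ptFun x j =
      (Fintype.card F : ℝ) ^ (∑ l ∈ Finset.range (k + 1), l) • ptFun x j := by
  induction k with
  | zero => simp [longProd]
  | succ k ih =>
    rw [longProd, ← Matrix.mulVec_mulVec, (descProd_mulVec_ptFun x hN (k + 1) hk).1 (by omega),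
      Matrix.mulVec_smul, ih (by omega) (by omega), smul_smul, Finset.sum_range_succ _ (k + 1),
      pow_add _ _ (k + 1), mul_comm]

theorem longProd_mulVec_ptFun (x : Fin (2 * m) → F) {N : ℕ} (hN : N + 1 = 2 * m) (k : ℕ)
    (hk : k ≤ N) (i : ℕ) (hi : i ≤ k + 1) :
    (Fintype.card F : ℝ) ^ (k + 1) •
        (longProd (fun i => panelMat F m (N - 1 - i)) k *ᵥ ptFun x (N - k + i)) =
      (Fintype.card F : ℝ) ^ (∑ l ∈ Finset.range (k + 1), l) •
        ((Fintype.card F : ℝ) ^ (k + 1) • ptFun x (N - k) +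
          (Fintype.card F : ℝ) ^ i • (ptFun x (N + 1) - ptFun x (N + 1 - i))) := by
  induction k generalizing i with
  | zero =>
    obtain rfl | rfl : i = 0 ∨ i = 1 := by omega
    · simp [longProd]
    · simp [longProd, smul_sub]
  | succ k ih =>
    rcases Nat.eq_zero_or_pos i with rfl | hi0
    · rw [longProd_mulVec_ptFun_of_le x hN (k + 1) hk (Or.inl (by omega)), add_zero, smul_comm]
      simp
    rcases hi.eq_or_lt with rfl | hi
    · rw [longProd_mulVec_ptFun_of_le x hN (k + 1) hk (Or.inr (by omega)),
        (by omega : N - (k + 1) + (k + 1 + 1) = N + 1),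
        (by omega : N + 1 - (k + 1 + 1) = N - (k + 1))]
      module
    · have h := ih (by omega) i (by omega)
      rw [longProd, ← Matrix.mulVec_mulVec,
        (descProd_mulVec_ptFun x hN (k + 1) hk).2 (by omega) (by omega), Matrix.mulVec_smul,
        Matrix.mulVec_add, Matrix.mulVec_sub, Matrix.mulVec_smul,
        (by omega : N - (k + 1) + 1 = N - k), (by omega : N - (k + 1) + i + 1 = N - k + i),
        longProd_mulVec_ptFun_of_le x hN k (by omega) (Or.inl (by omega : N - k + k ≤ N)),
        longProd_mulVec_ptFun_of_le x hN k (by omega) (Or.inl (by omega : N - (k + 1) + k ≤ N)),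
        Finset.sum_range_succ _ (k + 1), Nat.add_sub_cancel]
      funext c
      have h := congrFun h c
      simp only [Pi.smul_apply, Pi.add_apply, Pi.sub_apply, smul_eq_mul] at h ⊢
      linear_combination (Fintype.card F : ℝ) ^ (k + 1) * h

theorem sum_range_two_mul {m : ℕ} (hm : 1 ≤ m) :
    ∑ l ∈ Finset.range (2 * m), l = 2 * m ^ 2 - 2 * m + m := by
  have h := Finset.sum_range_id_mul_two (2 * m)
  obtain ⟨m, rfl⟩ : ∃ k, m = k + 1 := ⟨m - 1, by omega⟩
  have h1 : 2 * (m + 1) ^ 2 - 2 * (m + 1) = 2 * m * (m + 1) := by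
    rw [Nat.sub_eq_iff_eq_add (by nlinarith)]; ring
  rw [h1]
  rw [(by omega : 2 * (m + 1) - 1 = 2 * m + 1)] at h
  nlinarith

theorem oppMat_mulVec_ptFun {x : Fin (2 * m) → F} (hx : x ≠ 0) (hm : 1 ≤ m) {k : ℕ}
    (hk : k ≤ 2 * m) :
    (Fintype.card F : ℝ) ^ m • (oppMat F m *ᵥ ptFun x k) =
      (Fintype.card F : ℝ) ^ (2 * m ^ 2 - 2 * m) •
        ((Fintype.card F : ℝ) ^ k • (1 - ptFun x (2 * m - k))) := by
  have hq : (Fintype.card F : ℝ) ^ m ≠ 0 := by positivity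
  obtain ⟨N, hN⟩ : ∃ N, N + 1 = 2 * m := ⟨2 * m - 1, by omega⟩
  have h := longProd_mulVec_ptFun x hN N le_rfl k (by omega)
  rw [longProd_panelMat hN, Nat.sub_self, zero_add, ptFun_zero hx, smul_zero, zero_add, hN,
    ptFun_top x le_rfl, sum_range_two_mul hm] at h
  generalize 2 * m ^ 2 - 2 * m = e at h ⊢
  funext c
  have h := congrFun h c
  simp only [Pi.smul_apply, Pi.sub_apply, smul_eq_mul] at h ⊢
  apply mul_left_cancel₀ hq
  linear_combination h

end Opposition

section RealEigenspace

open Classical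

theorem map_descProd {R S : Type*} [Monoid R] [Monoid S] (φ : R →* S) (T : ℕ → R) (k : ℕ) :
    φ (descProd T k) = descProd (fun i => φ (T i)) k := by
  induction k with
  | zero => exact map_one φ
  | succ k ih => rw [descProd, map_mul, ih, descProd]

theorem map_longProd {R S : Type*} [Monoid R] [Monoid S] (φ : R →* S) (T : ℕ → R) (k : ℕ) :
    φ (longProd T k) = longProd (fun i => φ (T i)) k := by
  induction k with
  | zero => exact map_one φ
  | succ k ih => rw [longProd, map_mul, ih, longProd, map_descProd]

variable {F : Type} [Field F] [Fintype F] {m : ℕ}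

theorem isSymmetric_toLpLin {ι : Type*} [Fintype ι] [DecidableEq ι] {A : Matrix ι ι ℝ}
    (hA : Aᵀ = A) : (Matrix.toLpLin 2 2 A).IsSymmetric :=
  Matrix.isSymmetric_toEuclideanLin_iff.2 (by
    rw [Matrix.IsHermitian, Matrix.conjTranspose_eq_transpose_of_trivial, hA])

theorem isHeckeFamily_panelMat {N : ℕ} (hN : N + 1 = 2 * m) :
    IsHeckeFamily (Fintype.card F : ℝ) N
      (fun i => Matrix.toLpLinAlgEquiv (R := ℝ) 2 (panelMat F m (N - 1 - i))) where
  symm i hi := isSymmetric_toLpLin (panelMat_transpose _)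
  quad i hi := by
    rw [← map_mul, panelMat_quad (by omega), map_add, map_smul, map_smul, map_one]
  comm i j hij hj := by
    rw [← map_mul, ← map_mul, ← panelMat_comm (by omega) (by omega)]
  braid i hi := by
    rw [← map_mul, ← map_mul, ← map_mul, ← map_mul,
      (by omega : N - 1 - i = N - 1 - (i + 1) + 1), panelMat_braid (by omega)]

theorem mem_ptSpan_of_oppMat_mulVec (hm : 1 ≤ m) {f : MaxFlag2 F m → ℝ}
    (hf : oppMat F m *ᵥ f = (-(Fintype.card F : ℝ) ^ (2 * m ^ 2 - 2 * m)) • f) :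
    f ∈ ptSpan F m := by
  have hq : (1 : ℝ) < Fintype.card F := by exact_mod_cast Fintype.one_lt_card
  obtain ⟨N, hN⟩ : ∃ N, N + 1 = 2 * m := ⟨2 * m - 1, by omega⟩
  have hlong : longProd (fun i => Matrix.toLpLinAlgEquiv (R := ℝ) 2 (panelMat F m (N - 1 - i))) N =
      Matrix.toLpLin 2 2 (oppMat F m) := by
    rw [← longProd_panelMat hN]
    exact (map_longProd (MonoidHomClass.toMonoidHom
      (Matrix.toLpLinAlgEquiv (n := MaxFlag2 F m) (R := ℝ) 2)) _ N).symm
  refine (isHeckeFamily_panelMat (F := F) hN).mem_of_longProd_eigenvector hq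
    (by omega : N - 1 + 1 = N) (hlong ▸ isSymmetric_toLpLin oppMat_transpose)
    (W := (ptSpan F m).comap (WithLp.linearEquiv 2 ℝ (MaxFlag2 F m → ℝ)).toLinearMap)
    (fun i hi v hv => panelMat_mulVec_mem_ptSpan (by omega) hv) (fun v hv => ?_)
    (a := -(Fintype.card F : ℝ) ^ (2 * m ^ 2 - 2 * m)) ?_ (v := WithLp.toLp 2 f) ?_
  · refine mem_ptSpan_of_fixed hm fun i h1 h2 => ?_
    have := congrArg WithLp.ofLp (hv (N - 1 - i) (by omega))
    simp only [(by omega : N - 1 - (N - 1 - i) = i)] at this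
    exact this
  · rw [neg_sq, ← pow_mul, ← pow_succ]
    congr 1
    obtain ⟨m, rfl⟩ : ∃ k, m = k + 1 := ⟨m - 1, by omega⟩
    have h1 : 2 * (m + 1) ^ 2 - 2 * (m + 1) = 2 * m * (m + 1) := by
      rw [Nat.sub_eq_iff_eq_add (by nlinarith)]; ring
    rw [h1, (by omega : N = 2 * m + 1)]
    ring
  · rw [hlong]
    apply (WithLp.equiv 2 _).injective
    exact hf

/-- The real function `χ_j` of the point spanned by `x`. -/
noncomputable def chiFun (x : Fin (2 * m) → F) (j : ℕ) : MaxFlag2 F m → ℝ :=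
  ((Fintype.card F : ℝ) ^ j + 1) • ptFun x m - (Fintype.card F : ℝ) ^ j • ptFun x (m - j) -
    ptFun x (m + j)

theorem chi2_eq_chiFun {P : Submodule F (Fin (2 * m) → F)} {x : Fin (2 * m) → F}
    (hP : ∀ S, P ≤ S ↔ x ∈ S) (j : ℕ) (c : MaxFlag2 F m) :
    chi2 F m j P c = (chiFun x j c : ℂ) := by
  have h1 : x ∈ flagMem2 c (m - j) → x ∈ flagMem2 c m := @flagMem2_mono F _ m c _ _ (by omega) x
  have h2 : x ∈ flagMem2 c m → x ∈ flagMem2 c (m + j) := @flagMem2_mono F _ m c _ _ (by omega) x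
  simp only [chi2, hP, chiFun, ptFun, Pi.sub_apply, Pi.smul_apply, smul_eq_mul]
  by_cases ha : x ∈ flagMem2 c (m - j)
  · simp [ha, h1 ha, h2 (h1 ha)]
  by_cases hb : x ∈ flagMem2 c m
  · simp [ha, hb, h2 hb]
  by_cases hc : x ∈ flagMem2 c (m + j)
  · simp [ha, hb, hc]
  · simp [ha, hb, hc]

theorem oppMat_mulVec_chiFun {x : Fin (2 * m) → F} (hx : x ≠ 0) (hm : 1 ≤ m) {j : ℕ}
    (hj : j ≤ m) : oppMat F m *ᵥ chiFun x j =
      (-(Fintype.card F : ℝ) ^ (2 * m ^ 2 - 2 * m)) • chiFun x j := by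
  have hq : (Fintype.card F : ℝ) ^ m ≠ 0 := by positivity
  have h1 := oppMat_mulVec_ptFun hx hm (by omega : m ≤ 2 * m)
  have h2 := oppMat_mulVec_ptFun hx hm (by omega : m - j ≤ 2 * m)
  have h3 := oppMat_mulVec_ptFun hx hm (by omega : m + j ≤ 2 * m)
  rw [(by omega : 2 * m - m = m)] at h1
  rw [(by omega : 2 * m - (m - j) = m + j)] at h2
  rw [(by omega : 2 * m - (m + j) = m - j)] at h3
  have hpow : (Fintype.card F : ℝ) ^ m =
      (Fintype.card F : ℝ) ^ j * (Fintype.card F : ℝ) ^ (m - j) := by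
    rw [← pow_add]; congr 1; omega
  rw [chiFun, Matrix.mulVec_sub, Matrix.mulVec_sub, Matrix.mulVec_smul, Matrix.mulVec_smul]
  funext c
  have h1 := congrFun h1 c
  have h2 := congrFun h2 c
  have h3 := congrFun h3 c
  simp only [Pi.smul_apply, Pi.sub_apply, Pi.one_apply, smul_eq_mul] at h1 h2 h3 ⊢
  apply mul_left_cancel₀ hq
  generalize 2 * m ^ 2 - 2 * m = e at *
  rw [pow_add] at h3
  linear_combination ((Fintype.card F : ℝ) ^ j + 1) * h1 - (Fintype.card F : ℝ) ^ j * h2 - h3 +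
    (Fintype.card F : ℝ) ^ e * (1 - ptFun x (m + j) c) * hpow

variable (F m) in
/-- The span of the functions `chiFun x j` for `1 ≤ j ≤ m` and nonzero `x`. -/
noncomputable def chiSpan : Submodule ℝ (MaxFlag2 F m → ℝ) :=
  Submodule.span ℝ {f | ∃ x : Fin (2 * m) → F, x ≠ 0 ∧ ∃ j, 1 ≤ j ∧ j ≤ m ∧ f = chiFun x j}

theorem chiFun_mem_chiSpan {x : Fin (2 * m) → F} (hx : x ≠ 0) {j : ℕ} (hj : j ≤ m) :
    chiFun x j ∈ chiSpan F m := by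
  rcases Nat.eq_zero_or_pos j with rfl | hj'
  · rw [show chiFun x 0 = 0 by simp [chiFun, add_smul, one_smul]]
    exact Submodule.zero_mem _
  · exact Submodule.subset_span ⟨x, hx, j, hj', hj, rfl⟩

theorem chiSpan_le (hm : 1 ≤ m) {f : MaxFlag2 F m → ℝ} (hf : f ∈ chiSpan F m) :
    oppMat F m *ᵥ f = (-(Fintype.card F : ℝ) ^ (2 * m ^ 2 - 2 * m)) • f := by
  have h : chiSpan F m ≤ Module.End.eigenspace (oppMat F m).mulVecLin
      (-(Fintype.card F : ℝ) ^ (2 * m ^ 2 - 2 * m)) := by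
    refine Submodule.span_le.2 ?_
    rintro _ ⟨x, hx, j, -, hj, rfl⟩
    rw [SetLike.mem_coe, Module.End.mem_eigenspace_iff, Matrix.mulVecLin_apply]
    exact oppMat_mulVec_chiFun hx hm hj
  exact Module.End.mem_eigenspace_iff.1 (h hf)

theorem ptFun_reflect_mem {x : Fin (2 * m) → F} (hx : x ≠ 0) (hm : 1 ≤ m) {k : ℕ}
    (hk : k ≤ 2 * m) : (Fintype.card F : ℝ) ^ m • ptFun x k +
      (Fintype.card F : ℝ) ^ k • ptFun x (2 * m - k) ∈ chiSpan F m ⊔ Submodule.span ℝ {1} := by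
  have hmid : ((Fintype.card F : ℝ) ^ m + 1) • ptFun x m ∈ chiSpan F m ⊔ Submodule.span ℝ {1} := by
    have h : ((Fintype.card F : ℝ) ^ m + 1) • ptFun x m = chiFun x m + 1 := by
      rw [chiFun, Nat.sub_self, ptFun_zero hx, ← two_mul, ptFun_top x le_rfl]
      simp
    rw [h]
    exact Submodule.add_mem_sup (chiFun_mem_chiSpan hx le_rfl)
      (Submodule.mem_span_singleton_self 1)
  have hmid : ptFun x m ∈ chiSpan F m ⊔ Submodule.span ℝ {1} := by
    have hq : (Fintype.card F : ℝ) ^ m + 1 ≠ 0 := by positivity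
    simpa [smul_smul, inv_mul_cancel₀ hq] using
      Submodule.smul_mem _ (((Fintype.card F : ℝ) ^ m + 1)⁻¹) hmid
  have key : ∀ j ≤ m, (Fintype.card F : ℝ) ^ j • ptFun x (m - j) + ptFun x (m + j) ∈
      chiSpan F m ⊔ Submodule.span ℝ {1} := by
    intro j hj
    have h : (Fintype.card F : ℝ) ^ j • ptFun x (m - j) + ptFun x (m + j) =
        ((Fintype.card F : ℝ) ^ j + 1) • ptFun x m - chiFun x j := by
      rw [chiFun]; abel
    rw [h]
    exact Submodule.sub_mem _ (Submodule.smul_mem _ _ hmid)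
      (Submodule.mem_sup_left (chiFun_mem_chiSpan hx hj))
  rcases le_total k m with h | h
  · obtain ⟨j, rfl⟩ := Nat.exists_eq_add_of_le h
    have h1 := Submodule.smul_mem _ ((Fintype.card F : ℝ) ^ k) (key j (by omega))
    rw [smul_add, smul_smul, ← pow_add, Nat.add_sub_cancel] at h1
    rwa [(by omega : 2 * (k + j) - k = k + j + j)]
  · obtain ⟨j, rfl⟩ := Nat.exists_eq_add_of_le h
    have h1 := Submodule.smul_mem _ ((Fintype.card F : ℝ) ^ m) (key j (by omega))
    rw [smul_add, smul_smul, ← pow_add, add_comm] at h1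
    rwa [(by omega : 2 * m - (m + j) = m - j)]

theorem mem_chiSpan_of_oppMat_mulVec (hm : 1 ≤ m) {f : MaxFlag2 F m → ℝ}
    (hf : oppMat F m *ᵥ f = (-(Fintype.card F : ℝ) ^ (2 * m ^ 2 - 2 * m)) • f) :
    f ∈ chiSpan F m := by
  have hq0 : (0 : ℝ) < Fintype.card F := by exact_mod_cast Fintype.card_pos
  have hq : (Fintype.card F : ℝ) ^ m ≠ 0 := by positivity
  have hfW := mem_ptSpan_of_oppMat_mulVec hm hf
  have hle : ptSpan F m ≤ (chiSpan F m ⊔ Submodule.span ℝ {1}).comap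
      ((Fintype.card F : ℝ) ^ (2 * m ^ 2 - 2 * m) • LinearMap.id - (oppMat F m).mulVecLin) := by
    refine Submodule.span_le.2 ?_
    rintro _ ⟨x, hx, k, hk, rfl⟩
    have h1 := oppMat_mulVec_ptFun hx hm hk
    have h2 := Submodule.smul_mem _ ((Fintype.card F : ℝ) ^ (2 * m ^ 2 - 2 * m))
      (Submodule.sub_mem _ (ptFun_reflect_mem hx hm hk)
      (Submodule.smul_mem _ ((Fintype.card F : ℝ) ^ k)
        (Submodule.mem_sup_right (Submodule.mem_span_singleton_self 1))))
    have h3 := Submodule.smul_mem _ (((Fintype.card F : ℝ) ^ m)⁻¹) h2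
    rw [SetLike.mem_coe, Submodule.mem_comap]
    convert h3 using 1
    rw [eq_inv_smul_iff₀ hq, LinearMap.sub_apply, smul_sub, Matrix.mulVecLin_apply, h1]
    simp only [LinearMap.smul_apply, LinearMap.id_apply]
    module
  have h1 := hle hfW
  rw [Submodule.mem_comap, LinearMap.sub_apply, Matrix.mulVecLin_apply, hf] at h1
  have h2 : f ∈ chiSpan F m ⊔ Submodule.span ℝ {1} := by
    have h3 := Submodule.smul_mem _ ((2 * (Fintype.card F : ℝ) ^ (2 * m ^ 2 - 2 * m))⁻¹) h1
    convert h3 using 1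
    rw [eq_inv_smul_iff₀ (by positivity)]
    simp only [LinearMap.smul_apply, LinearMap.id_apply]
    module
  obtain ⟨y, hy, z, hz, rfl⟩ := Submodule.mem_sup.1 h2
  obtain ⟨r, rfl⟩ := Submodule.mem_span_singleton.1 hz
  obtain ⟨x, hx⟩ : ∃ x : Fin (2 * m) → F, x ≠ 0 := by
    have : Nonempty (Fin (2 * m)) := ⟨⟨0, by omega⟩⟩
    exact exists_ne 0
  have hA := oppMat_mulVec_ptFun hx hm (le_refl (2 * m))
  rw [Nat.sub_self, ptFun_zero hx, ptFun_top x le_rfl, sub_zero] at hA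
  rw [Matrix.mulVec_add, chiSpan_le hm hy, smul_add, add_right_inj, Matrix.mulVec_smul] at hf
  have h4 : r • (1 : MaxFlag2 F m → ℝ) = 0 := by
    funext c
    have hA := congrFun hA c
    have hf := congrFun hf c
    simp only [Pi.smul_apply, Pi.one_apply, smul_eq_mul, Pi.zero_apply, mul_one] at hA hf ⊢
    generalize 2 * m ^ 2 - 2 * m = e at *
    have h5 : ((Fintype.card F : ℝ) ^ e * (Fintype.card F : ℝ) ^ (2 * m) +
        (Fintype.card F : ℝ) ^ m * (Fintype.card F : ℝ) ^ e) * r = 0 := by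
      linear_combination (Fintype.card F : ℝ) ^ m * hf - r * hA
    exact (mul_eq_zero.1 h5).resolve_left (by positivity)
  rw [h4, add_zero]
  exact hy

end RealEigenspace

section Points

open Classical

instance (F : Type) [Field F] [Fintype F] (m : ℕ) : Finite (Point2 F m) :=
  Subtype.finite

noncomputable instance (F : Type) [Field F] [Fintype F] (m : ℕ) : Fintype (Point2 F m) :=
  Fintype.ofFinite _

variable {F : Type} [Field F] {m : ℕ}

theorem Point2.exists_gen (P : Point2 F m) : ∃ x : Fin (2 * m) → F, x ≠ 0 ∧ P.1 = F ∙ x := by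
  obtain ⟨x, hx, h⟩ := finrank_eq_one_iff'.1 P.2
  refine ⟨x, by simpa using hx, le_antisymm (fun y hy => ?_) (by simp)⟩
  obtain ⟨r, hr⟩ := h ⟨y, hy⟩
  exact Submodule.mem_span_singleton.2 ⟨r, congrArg Subtype.val hr⟩

/-- A vector spanning a point. -/
noncomputable def Point2.gen (P : Point2 F m) : Fin (2 * m) → F := P.exists_gen.choose

theorem Point2.gen_ne_zero (P : Point2 F m) : P.gen ≠ 0 := P.exists_gen.choose_spec.1

theorem Point2.le_iff (P : Point2 F m) (S : Submodule F (Fin (2 * m) → F)) :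
    P.1 ≤ S ↔ P.gen ∈ S := by
  conv_lhs => rw [P.exists_gen.choose_spec.2]
  simp [Point2.gen]

/-- The point spanned by a nonzero vector. -/
noncomputable def Point2.mk {x : Fin (2 * m) → F} (hx : x ≠ 0) : Point2 F m :=
  ⟨F ∙ x, finrank_span_singleton hx⟩

theorem Point2.gen_mk_mem {x : Fin (2 * m) → F} (hx : x ≠ 0)
    (S : Submodule F (Fin (2 * m) → F)) : (Point2.mk hx).gen ∈ S ↔ x ∈ S := by
  rw [← Point2.le_iff]
  simp [Point2.mk]

theorem Point2.eq_of_le {P Q : Point2 F m} (h : P.1 ≤ Q.1) : P = Q :=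
  Subtype.ext (Submodule.eq_of_le_of_finrank_eq h (P.2.trans Q.2.symm))

theorem exists_flag (F : Type) [Field F] (m : ℕ) : Nonempty (MaxFlag2 F m) := by
  let v (k : Fin (2 * m + 1)) : Fin (k : ℕ) → Fin (2 * m) → F :=
    fun i => Pi.basisFun F (Fin (2 * m)) (Fin.castLE (by omega) i)
  refine ⟨⟨fun k => Submodule.span F (Set.range (v k)), fun a b hab => ?_, fun k => ?_⟩⟩
  · refine Submodule.span_mono ?_
    rintro _ ⟨i, rfl⟩
    exact ⟨Fin.castLE hab i, rfl⟩
  · have h : LinearIndependent F (v k) :=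
      (Pi.basisFun F (Fin (2 * m))).linearIndependent.comp _ (Fin.castLE_injective _)
    simpa using finrank_span_eq_card h

theorem exists_flag_mem {x : Fin (2 * m) → F} : ∃ c : MaxFlag2 F m, x ∈ flagMem2 c 1 := by
  obtain ⟨c₀⟩ := exists_flag F m
  have key : ∀ s : ℕ, ∀ c : MaxFlag2 F m, x ∈ flagMem2 c (s + 1) →
      ∃ d : MaxFlag2 F m, x ∈ flagMem2 d 1 := by
    intro s
    induction s with
    | zero => exact fun c hc => ⟨c, hc⟩
    | succ s ih =>
      intro c hc
      by_cases hs : s + 2 ≤ 2 * m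
      · by_cases hx : x ∈ flagMem2 c s
        · exact ih c (flagMem2_mono c (Nat.le_succ s) hx)
        · obtain ⟨d, ⟨-, hd⟩, -⟩ := existsUnique_samePanel c hs hc hx
          exact ih d hd
      · refine ih c ?_
        rw [flagMem2_eq_top c (by omega)]
        trivial
  refine key (2 * m) c₀ ?_
  rw [flagMem2_eq_top c₀ (by omega)]
  trivial

variable [Fintype F]

theorem card_points (S : Submodule F (Fin (2 * m) → F)) :
    ((Finset.univ.filter fun P : Point2 F m => P.gen ∈ S).card : ℝ) * (Fintype.card F - 1) =
      (Fintype.card F : ℝ) ^ Module.finrank F S - 1 := by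
  have h := Finset.sum_card_bipartiteAbove_eq_sum_card_bipartiteBelow
    (s := Finset.univ.filter fun P : Point2 F m => P.gen ∈ S)
    (t := Finset.univ.filter fun x => x ∈ S ∧ x ∉ (⊥ : Submodule F (Fin (2 * m) → F)))
    (fun P x => x ∈ P.1)
  have h1 : ∀ P ∈ Finset.univ.filter fun P : Point2 F m => P.gen ∈ S,
      ((Finset.bipartiteAbove (fun (P : Point2 F m) x => x ∈ P.1)
        (Finset.univ.filter fun x => x ∈ S ∧ x ∉ (⊥ : Submodule F (Fin (2 * m) → F))) P).card : ℝ) =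
        Fintype.card F - 1 := by
    intro P hP
    have hP : P.1 ≤ S := (P.le_iff S).2 (by simpa using hP)
    have h2 : Finset.bipartiteAbove (fun (P : Point2 F m) x => x ∈ P.1)
        (Finset.univ.filter fun x => x ∈ S ∧ x ∉ (⊥ : Submodule F (Fin (2 * m) → F))) P =
        Finset.univ.filter fun x => x ∈ P.1 ∧ x ∉ (⊥ : Submodule F (Fin (2 * m) → F)) := by
      ext x
      simp only [Finset.mem_bipartiteAbove, Finset.mem_filter, Finset.mem_univ, true_and]
      have := @hP x
      tauto
    rw [h2, card_filter_mem_sdiff bot_le, P.2, finrank_bot, pow_one, pow_zero]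
  have h2 : ∀ x ∈ Finset.univ.filter fun x => x ∈ S ∧ x ∉ (⊥ : Submodule F (Fin (2 * m) → F)),
      (Finset.bipartiteBelow (fun (P : Point2 F m) x => x ∈ P.1)
        (Finset.univ.filter fun P : Point2 F m => P.gen ∈ S) x).card = 1 := by
    intro x hx
    simp only [Finset.mem_filter, Finset.mem_univ, true_and, Submodule.mem_bot] at hx
    rw [Finset.card_eq_one]
    refine ⟨Point2.mk hx.2, ?_⟩
    ext P
    simp only [Finset.mem_bipartiteBelow, Finset.mem_filter, Finset.mem_univ, true_and,
      Finset.mem_singleton]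
    constructor
    · rintro ⟨-, h'⟩
      exact (Point2.eq_of_le (by simpa [Point2.mk] using h')).symm
    · rintro rfl
      exact ⟨(Point2.gen_mk_mem hx.2 S).2 hx.1, Submodule.mem_span_singleton_self x⟩
  rw [Finset.sum_congr rfl h2] at h
  have h := congrArg (Nat.cast : ℕ → ℝ) h
  push_cast at h
  rw [Finset.sum_congr rfl h1, Finset.sum_const, Finset.sum_const, nsmul_eq_mul, nsmul_eq_mul,
    card_filter_mem_sdiff bot_le, finrank_bot, pow_zero, mul_one] at h
  exact h

theorem card_point2 (F : Type) [Field F] [Fintype F] (m : ℕ) :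
    (Fintype.card (Point2 F m) : ℝ) * (Fintype.card F - 1) =
      (Fintype.card F : ℝ) ^ (2 * m) - 1 := by
  have h := card_points (⊤ : Submodule F (Fin (2 * m) → F))
  simpa using h

theorem sum_ptFun {k : ℕ} (hk : k ≤ 2 * m) (c : MaxFlag2 F m) :
    (∑ P : Point2 F m, ptFun P.gen k c) * (Fintype.card F - 1) =
      (Fintype.card F : ℝ) ^ k - 1 := by
  have h := card_points (flagMem2 c k)
  rw [finrank_flagMem2 c hk] at h
  simp only [ptFun, Finset.sum_boole]
  exact h

theorem sum_chiFun {j : ℕ} (hj : j ≤ m) : ∑ P : Point2 F m, chiFun P.gen j = 0 := by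
  have hq : (1 : ℝ) < Fintype.card F := by exact_mod_cast Fintype.one_lt_card
  funext c
  have h1 := sum_ptFun (by omega : m ≤ 2 * m) c
  have h2 := sum_ptFun (by omega : m - j ≤ 2 * m) c
  have h3 := sum_ptFun (by omega : m + j ≤ 2 * m) c
  have hpow : (Fintype.card F : ℝ) ^ m =
      (Fintype.card F : ℝ) ^ j * (Fintype.card F : ℝ) ^ (m - j) := by
    rw [← pow_add]; congr 1; omega
  simp only [chiFun, Finset.sum_apply, Pi.sub_apply, Pi.smul_apply, smul_eq_mul,
    Finset.sum_sub_distrib, ← Finset.mul_sum, Pi.zero_apply]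
  apply mul_right_cancel₀ (sub_pos.2 hq).ne'
  rw [pow_add] at h3
  linear_combination ((Fintype.card F : ℝ) ^ j + 1) * h1 - (Fintype.card F : ℝ) ^ j * h2 - h3 + hpow

/-- A linear combination of the functions `ptFun P.gen k` over all points `P`. -/
noncomputable def ptSum (b : Point2 F m → ℝ) (k : ℕ) : MaxFlag2 F m → ℝ :=
  ∑ P, b P • ptFun P.gen k

theorem ptSum_eq_of_ne (b : Point2 F m → ℝ) {i k : ℕ} (hk : k ≠ i + 1) {c d : MaxFlag2 F m}
    (h : SamePanel i c d) : ptSum b k c = ptSum b k d := by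
  simp only [ptSum, Finset.sum_apply, Pi.smul_apply, ptFun, h k hk]

theorem panelMat_ptSum (b : Point2 F m → ℝ) {i : ℕ} (hi : i + 2 ≤ 2 * m) :
    panelMat F m i *ᵥ ptSum b (i + 1) =
      ptSum b (i + 2) - ptSum b (i + 1) + (Fintype.card F : ℝ) • ptSum b i := by
  simp only [ptSum, Matrix.mulVec_sum, Matrix.mulVec_smul, panelMat_ptFun _ hi, Finset.smul_sum,
    ← Finset.sum_sub_distrib, ← Finset.sum_add_distrib, smul_add, smul_sub]
  exact Finset.sum_congr rfl fun P _ => by rw [smul_comm]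

theorem ptSum_one_apply (b : Point2 F m → ℝ) (hm : 1 ≤ m) {P : Point2 F m} {c : MaxFlag2 F m}
    (hc : P.gen ∈ flagMem2 c 1) : ptSum b 1 c = b P := by
  have hP : P.1 = flagMem2 c 1 := Submodule.eq_of_le_of_finrank_eq ((P.le_iff _).2 hc)
    (by rw [P.2, finrank_flagMem2 c (by omega)])
  simp only [ptSum, Finset.sum_apply, Pi.smul_apply, smul_eq_mul, ptFun, mul_boole]
  rw [Finset.sum_eq_single P, if_pos hc]
  · intro Q _ hQ
    rw [if_neg]
    intro h
    rw [← hP, ← Point2.le_iff] at h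
    exact hQ (Point2.eq_of_le h)
  · simp

theorem eq_zero_of_ptSum_const {b : Point2 F m → ℝ} {P0 : Point2 F m} (hb : b P0 = 0)
    {i : ℕ} (hi : i + 2 ≤ 2 * m)
    (h : ∀ c d, SamePanel i c d → ptSum b (i + 1) c = ptSum b (i + 1) d) (P : Point2 F m) :
    b P = 0 := by
  induction i with
  | zero =>
    obtain ⟨c, hc⟩ := exists_flag_mem (x := P.gen)
    obtain ⟨d, hd⟩ := exists_flag_mem (x := P0.gen)
    rw [← hb, ← ptSum_one_apply b (by omega) hc, ← ptSum_one_apply b (by omega) hd]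
    refine eq_of_forall_panel (j₀ := 0) (fun i _ _ c d hcd => ?_) fun k hk => ?_
    · rcases Nat.eq_zero_or_pos i with rfl | hi0
      · exact h c d hcd
      · exact ptSum_eq_of_ne b (by omega) hcd
    · rw [Nat.le_zero.1 hk, flagMem2_zero, flagMem2_zero]
  | succ i ih =>
    refine ih (by omega) fun c d hcd => ?_
    have hT := panelMat_ptSum b hi
    rw [panelMat_mulVec_of_const hi h] at hT
    have hc := congrFun hT c
    have hd := congrFun hT d
    have h2 := ptSum_eq_of_ne b (by omega : i + 1 + 2 ≠ i + 1) hcd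
    have h1 := ptSum_eq_of_ne b (by omega : i + 1 + 1 ≠ i + 1) hcd
    simp only [Pi.smul_apply, Pi.sub_apply, Pi.add_apply, smul_eq_mul] at hc hd
    have hq : (Fintype.card F : ℝ) ≠ 0 := by
      exact_mod_cast Fintype.card_ne_zero
    apply mul_left_cancel₀ hq
    linear_combination hd - hc + ((Fintype.card F : ℝ) + 1) * h1 - h2

theorem sum_smul_chiFun (b : Point2 F m → ℝ) (j : ℕ) :
    ∑ P, b P • chiFun P.gen j = ((Fintype.card F : ℝ) ^ j + 1) • ptSum b m -
      (Fintype.card F : ℝ) ^ j • ptSum b (m - j) - ptSum b (m + j) := by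
  simp only [ptSum, chiFun, Finset.smul_sum, ← Finset.sum_sub_distrib, smul_sub]
  refine Finset.sum_congr rfl fun P _ => ?_
  rw [smul_comm (b P), smul_comm (b P)]

theorem eq_zero_of_sum_chiFun {a : ℕ → Point2 F m → ℝ} {P0 : Point2 F m} (ha : ∀ j, a j P0 = 0)
    (h : ∑ j ∈ Finset.Icc 1 m, ∑ P, a j P • chiFun P.gen j = 0) {j : ℕ} (hj1 : 1 ≤ j)
    (hjm : j ≤ m) (P : Point2 F m) : a j P = 0 := by
  have hlt : ∀ j, 1 ≤ j → j < m → ∀ P, a j P = 0 := by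
    intro j hj1 hjm
    refine eq_zero_of_ptSum_const (ha j) (i := m + j - 1) (by omega) fun c d hcd => ?_
    have hcong : ∀ l k, k ≠ m + j → ptSum (a l) k c = ptSum (a l) k d :=
      fun l k hk => ptSum_eq_of_ne (a l) (by omega) hcd
    have hsum := (congrFun h c).trans (congrFun h d).symm
    rw [← Finset.add_sum_erase _ _ (Finset.mem_Icc.2 ⟨hj1, hjm.le⟩)] at hsum
    simp only [Finset.sum_apply _ (Finset.erase _ _), sum_smul_chiFun, Pi.add_apply, Pi.sub_apply,
      Pi.smul_apply, hcong j m (by omega), hcong j (m - j) (by omega)] at hsum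
    rw [Finset.sum_congr rfl fun l hl => ?_, add_left_inj, sub_right_inj] at hsum
    · rwa [Nat.sub_add_cancel (by omega)]
    · have hl := Finset.ne_of_mem_erase hl
      rw [hcong l m (by omega), hcong l (m - l) (by omega), hcong l (m + l) (by omega)]
  rcases hjm.lt_or_eq with hjm | rfl
  · exact hlt j hj1 hjm P
  · rw [Finset.sum_eq_single_of_mem j (Finset.mem_Icc.2 ⟨hj1, le_rfl⟩) fun l hl hlj =>
      Finset.sum_eq_zero fun P _ => by
        have := Finset.mem_Icc.1 hl
        rw [hlt l this.1 (by omega) P, zero_smul]] at h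
    refine eq_zero_of_ptSum_const (ha j) (i := j - 1) (by omega) (fun c d hcd => ?_) P
    have hcong : ∀ k, k ≠ j → ptSum (a j) k c = ptSum (a j) k d :=
      fun k hk => ptSum_eq_of_ne (a j) (by omega) hcd
    have hsum := (congrFun h c).trans (congrFun h d).symm
    simp only [sum_smul_chiFun, Pi.sub_apply, Pi.smul_apply, hcong (j - j) (by omega),
      hcong (j + j) (by omega), sub_left_inj, smul_eq_mul] at hsum
    rw [Nat.sub_add_cancel hj1]
    exact mul_left_cancel₀ (by positivity) hsum

end Points

section ComplexEigenspace

open Classical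

variable {F : Type} [Field F] {m : ℕ}

variable (F m) in
/-- Pairs of an index `1 ≤ j ≤ m` and a point different from `P0`. -/
abbrev ChiIndex (P0 : Point2 F m) : Type :=
  {p : ℕ × Point2 F m // 1 ≤ p.1 ∧ p.1 ≤ m ∧ p.2 ≠ P0}

/-- The extension of a real function on flags by scalars to a complex function. -/
noncomputable def ofRealFun : (MaxFlag2 F m → ℝ) →ₗ[ℝ] (MaxFlag2 F m → ℂ) :=
  Complex.ofRealCLM.toLinearMap.compLeft _

theorem ofRealFun_apply (f : MaxFlag2 F m → ℝ) (c : MaxFlag2 F m) :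
    ofRealFun f c = (f c : ℂ) := rfl

theorem linearIndependent_ofRealFun {ι : Type*} [Fintype ι] {v : ι → MaxFlag2 F m → ℝ}
    (hv : LinearIndependent ℝ v) : LinearIndependent ℂ fun i => ofRealFun (v i) := by
  rw [Fintype.linearIndependent_iff] at hv ⊢
  intro g hg i
  refine Complex.ext (hv (fun i => (g i).re) ?_ i) (hv (fun i => (g i).im) ?_ i)
  · funext c
    simpa [ofRealFun_apply] using congrArg Complex.re (congrFun hg c)
  · funext c
    simpa [ofRealFun_apply] using congrArg Complex.im (congrFun hg c)

variable [Fintype F]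

theorem chi2_eq_ofRealFun (j : ℕ) (P : Point2 F m) :
    chi2 F m j P.1 = ofRealFun (chiFun P.gen j) :=
  funext (chi2_eq_chiFun P.le_iff j)

theorem chiFun_congr {x y : Fin (2 * m) → F}
    (h : ∀ S : Submodule F (Fin (2 * m) → F), x ∈ S ↔ y ∈ S) (j : ℕ) :
    chiFun x j = chiFun y j := by
  have (k : ℕ) : ptFun x k = ptFun y k := funext fun c => by simp only [ptFun, h]
  simp only [chiFun, this]

theorem adj2_mulVec_apply (f : MaxFlag2 F m → ℂ) (c : MaxFlag2 F m) :
    (adj2 F m *ᵥ f) c = ∑ d, (oppMat F m c d : ℂ) * f d := by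
  simp only [Matrix.mulVec, dotProduct, adj2, oppMat, Matrix.of_apply]
  refine Finset.sum_congr rfl fun d _ => ?_
  split_ifs <;> simp

theorem adj2_mulVec_ofRealFun (f : MaxFlag2 F m → ℝ) :
    adj2 F m *ᵥ ofRealFun f = ofRealFun (oppMat F m *ᵥ f) := by
  funext c
  rw [adj2_mulVec_apply, ofRealFun_apply, Matrix.mulVec, dotProduct]
  push_cast
  rfl

theorem mem_chiIndex_iff (P0 : Point2 F m) (p : ℕ × Point2 F m) :
    p ∈ Finset.Icc 1 m ×ˢ Finset.univ.erase P0 ↔ 1 ≤ p.1 ∧ p.1 ≤ m ∧ p.2 ≠ P0 := by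
  simp [and_assoc]

noncomputable instance (P0 : Point2 F m) : Fintype (ChiIndex F m P0) :=
  Fintype.subtype _ (mem_chiIndex_iff P0)

theorem card_chiIndex (P0 : Point2 F m) :
    Fintype.card (ChiIndex F m P0) = m * (Fintype.card (Point2 F m) - 1) := by
  rw [Fintype.card_of_subtype _ (mem_chiIndex_iff P0), Finset.card_product, Nat.card_Icc,
    Finset.card_erase_of_mem (Finset.mem_univ _), Finset.card_univ, Nat.add_sub_cancel]

theorem linearIndependent_chiFun (P0 : Point2 F m) :
    LinearIndependent ℝ (fun p : ChiIndex F m P0 => chiFun p.1.2.gen p.1.1) := by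
  rw [Fintype.linearIndependent_iff]
  intro r hr p
  let a : ℕ → Point2 F m → ℝ := fun j P =>
    if h : 1 ≤ j ∧ j ≤ m ∧ P ≠ P0 then r ⟨(j, P), h⟩ else 0
  have ha (i : ChiIndex F m P0) : a i.1.1 i.1.2 = r i := dif_pos i.2
  have ha0 (j : ℕ) : a j P0 = 0 := dif_neg (by simp)
  rw [← ha]
  refine eq_zero_of_sum_chiFun ha0 ?_ p.2.1 p.2.2.1 _
  rw [← hr]
  simp only [← ha]
  rw [← Finset.sum_subtype _ (mem_chiIndex_iff P0)
    (fun p : ℕ × Point2 F m => a p.1 p.2 • chiFun p.2.gen p.1), Finset.sum_product]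
  refine Finset.sum_congr rfl fun j _ => ?_
  rw [← Finset.add_sum_erase _ _ (Finset.mem_univ P0), ha0, zero_smul, zero_add]

theorem linearIndependent_chi2 (P0 : Point2 F m) :
    LinearIndependent ℂ (fun p : ChiIndex F m P0 => chi2 F m p.1.1 p.1.2.1) := by
  simp only [chi2_eq_ofRealFun]
  exact linearIndependent_ofRealFun (linearIndependent_chiFun P0)

theorem ofRealFun_mem_span (P0 : Point2 F m) {f : MaxFlag2 F m → ℝ} (hf : f ∈ chiSpan F m) :
    ofRealFun f ∈ Submodule.span ℂ
      (Set.range fun p : ChiIndex F m P0 => chi2 F m p.1.1 p.1.2.1) := by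
  have hle : chiSpan F m ≤ ((Submodule.span ℂ
      (Set.range fun p : ChiIndex F m P0 => chi2 F m p.1.1 p.1.2.1)).restrictScalars ℝ).comap
      ofRealFun := by
    rw [chiSpan, Submodule.span_le]
    rintro _ ⟨x, hx, j, hj1, hjm, rfl⟩
    rw [SetLike.mem_coe, Submodule.mem_comap, Submodule.restrictScalars_mem,
      chiFun_congr (fun S => (Point2.gen_mk_mem hx S).symm)]
    have hne (P : Point2 F m) (hP : P ≠ P0) : ofRealFun (chiFun P.gen j) ∈ Submodule.span ℂ
        (Set.range fun p : ChiIndex F m P0 => chi2 F m p.1.1 p.1.2.1) := by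
      rw [← chi2_eq_ofRealFun]
      exact Submodule.subset_span ⟨⟨(j, P), hj1, hjm, hP⟩, rfl⟩
    by_cases hP : Point2.mk hx = P0
    · have h := sum_chiFun (F := F) hjm
      rw [← Finset.add_sum_erase _ _ (Finset.mem_univ P0)] at h
      rw [hP, eq_neg_of_add_eq_zero_left h, map_neg, map_sum]
      exact Submodule.neg_mem _ (Submodule.sum_mem _ fun P h' => hne P (Finset.ne_of_mem_erase h'))
    · exact hne _ hP
  exact hle hf

theorem span_chi2 (hm : 1 ≤ m) (P0 : Point2 F m) :
    Submodule.span ℂ (Set.range fun p : ChiIndex F m P0 => chi2 F m p.1.1 p.1.2.1) =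
      Module.End.eigenspace (adj2 F m).mulVecLin
        (-((Fintype.card F : ℂ) ^ (2 * m ^ 2 - 2 * m))) := by
  refine le_antisymm (Submodule.span_le.2 ?_) fun f hf => ?_
  · rintro _ ⟨p, rfl⟩
    beta_reduce
    rw [SetLike.mem_coe, Module.End.mem_eigenspace_iff, Matrix.mulVecLin_apply,
      chi2_eq_ofRealFun, adj2_mulVec_ofRealFun, oppMat_mulVec_chiFun p.1.2.gen_ne_zero hm p.2.2.1]
    funext c
    simp [ofRealFun_apply]
  · rw [Module.End.mem_eigenspace_iff, Matrix.mulVecLin_apply] at hf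
    have hcast : -((Fintype.card F : ℂ) ^ (2 * m ^ 2 - 2 * m)) =
        ((-(Fintype.card F : ℝ) ^ (2 * m ^ 2 - 2 * m) : ℝ) : ℂ) := by push_cast; rfl
    rw [hcast] at hf
    have hre : oppMat F m *ᵥ (fun c => (f c).re) =
        (-(Fintype.card F : ℝ) ^ (2 * m ^ 2 - 2 * m)) • fun c => (f c).re := by
      funext c
      have h := congrArg Complex.re (congrFun hf c)
      rw [adj2_mulVec_apply, Pi.smul_apply, smul_eq_mul, Complex.re_ofReal_mul, Complex.re_sum] at h
      simpa only [Complex.re_ofReal_mul] using! h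
    have him : oppMat F m *ᵥ (fun c => (f c).im) =
        (-(Fintype.card F : ℝ) ^ (2 * m ^ 2 - 2 * m)) • fun c => (f c).im := by
      funext c
      have h := congrArg Complex.im (congrFun hf c)
      rw [adj2_mulVec_apply, Pi.smul_apply, smul_eq_mul, Complex.im_ofReal_mul, Complex.im_sum] at h
      simpa only [Complex.im_ofReal_mul] using! h
    have hsum : f = ofRealFun (fun c => (f c).re) + Complex.I • ofRealFun (fun c => (f c).im) := by
      funext c
      simp only [Pi.add_apply, Pi.smul_apply, ofRealFun_apply, smul_eq_mul, mul_comm Complex.I,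
        Complex.re_add_im]
    rw [hsum]
    exact Submodule.add_mem _ (ofRealFun_mem_span P0 (mem_chiSpan_of_oppMat_mulVec hm hre))
      (Submodule.smul_mem _ _ (ofRealFun_mem_span P0 (mem_chiSpan_of_oppMat_mulVec hm him)))

theorem cast_card_chiIndex (P0 : Point2 F m) :
    (Fintype.card (ChiIndex F m P0) : ℚ) =
      (m : ℚ) * (((Fintype.card F : ℚ) ^ (2 * m) - Fintype.card F) / ((Fintype.card F : ℚ) - 1)) := by
  have hq : (1 : ℚ) < Fintype.card F := by exact_mod_cast Fintype.one_lt_card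
  have hpos : 1 ≤ Fintype.card (Point2 F m) := Fintype.card_pos_iff.2 ⟨P0⟩
  have h : (Fintype.card (Point2 F m) : ℚ) * (Fintype.card F - 1) =
      (Fintype.card F : ℚ) ^ (2 * m) - 1 := by exact_mod_cast card_point2 F m
  rw [card_chiIndex, Nat.cast_mul, Nat.cast_sub hpos, Nat.cast_one]
  congr 1
  rw [eq_div_iff (sub_pos.2 hq).ne']
  linear_combination h

end ComplexEigenspace

/-- Fixing a point `P₀`, the family `{χ_j^P : 1 ≤ j ≤ m, P ≠ P₀}` is a basis of the
eigenspace of `-q^(2m²-2m)`; in particular the eigenspace has dimension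
`m·(q^(2m)-q)/(q-1)`. -/
theorem chi_basis_eigenspace (F : Type) [Field F] [Fintype F] (q : ℕ)
    (hq : Fintype.card F = q) (m : ℕ) (hm : 1 ≤ m) (P0 : Point2 F m) :
    LinearIndependent ℂ
      (fun p : {p : ℕ × Point2 F m // 1 ≤ p.1 ∧ p.1 ≤ m ∧ p.2 ≠ P0} =>
        chi2 F m p.1.1 p.1.2.1) ∧
    Submodule.span ℂ
        (Set.range (fun p : {p : ℕ × Point2 F m // 1 ≤ p.1 ∧ p.1 ≤ m ∧ p.2 ≠ P0} =>
          chi2 F m p.1.1 p.1.2.1)) =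
      Module.End.eigenspace (adj2 F m).mulVecLin (-((q : ℂ) ^ (2 * m ^ 2 - 2 * m))) ∧
    ((Module.finrank ℂ
        (Module.End.eigenspace (adj2 F m).mulVecLin
          (-((q : ℂ) ^ (2 * m ^ 2 - 2 * m)))) : ℚ) =
      (m : ℚ) * (((q : ℚ) ^ (2 * m) - q) / ((q : ℚ) - 1))) := by
  subst hq
  refine ⟨linearIndependent_chi2 P0, span_chi2 hm P0, ?_⟩
  rw [← span_chi2 hm P0, finrank_span_eq_card (linearIndependent_chi2 P0), cast_card_chiIndex]
end

section
/- For every prime power q and every n ≥ 2, the adjacency matrix of the opposition graph on the maximal isotropic flags of a nondegenerate alternating bilinear form on F_q^{2n} has smallest eigenvalue −q^{n(n−1)}. -/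
open Matrix

/-- A maximal isotropic flag for the bilinear form `B` on `F^(2n)`: a chain
`U 0 ⊆ U 1 ⊆ ⋯ ⊆ U n` with `dim (U k) = k` (so `U 0 = ⊥`) whose top member (and hence
every member) is totally isotropic. -/
def SympFlag (F : Type) [Field F] (n : ℕ) (B : LinearMap.BilinForm F (Fin (2 * n) → F)) :
    Type :=
  {U : Fin (n + 1) → Submodule F (Fin (2 * n) → F) //
    Monotone U ∧ (∀ k : Fin (n + 1), Module.finrank F (U k) = (k : ℕ)) ∧
    ∀ x ∈ U (Fin.last n), ∀ y ∈ U (Fin.last n), B x y = 0}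

instance (F : Type) [Field F] [Fintype F] (n : ℕ)
    (B : LinearMap.BilinForm F (Fin (2 * n) → F)) : Finite (SympFlag F n B) :=
  Subtype.finite

noncomputable instance (F : Type) [Field F] [Fintype F] (n : ℕ)
    (B : LinearMap.BilinForm F (Fin (2 * n) → F)) : Fintype (SympFlag F n B) :=
  Fintype.ofFinite _

/-- Two maximal isotropic flags are opposite when `U_i ∩ V_i^⊥ = 0` for all `i`
(trivial for `i = 0`). -/
def OppS {F : Type} [Field F] {n : ℕ} {B : LinearMap.BilinForm F (Fin (2 * n) → F)}
    (c d : SympFlag F n B) : Prop :=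
  ∀ i : Fin (n + 1), c.1 i ⊓ B.orthogonal (d.1 i) = ⊥

open Classical in
/-- The adjacency matrix of the opposition graph on maximal isotropic flags. -/
noncomputable def adjS (F : Type) [Field F] [Fintype F] (n : ℕ)
    (B : LinearMap.BilinForm F (Fin (2 * n) → F)) :
    Matrix (SympFlag F n B) (SympFlag F n B) ℝ :=
  fun c d => if OppS c d then 1 else 0

section LinearAlgebra

open Module

variable {E : Type*} [AddCommGroup E] [Module ℝ E] [FiniteDimensional ℝ E]

theorem abs_det_of_quadratic (T : E →ₗ[ℝ] E) {q : ℝ} (hq : 0 ≤ q)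
    (hT : ∀ v, T (T v) = (q - 1) • T v + q • v) :
    |LinearMap.det T| = q ^ finrank ℝ (LinearMap.ker (T - q • LinearMap.id)) := by
  set W := LinearMap.ker (T - q • LinearMap.id) with hW
  have hmem : ∀ v, v ∈ W ↔ T v = q • v := fun v => by
    simp [hW, LinearMap.mem_ker, sub_eq_zero]
  have he : W ≤ W.comap T := fun v hv => by
    rw [Submodule.mem_comap, (hmem v).1 hv]
    exact W.smul_mem _ hv
  rw [LinearMap.det_eq_det_mul_det W T he]
  have h1 : T.restrict (p := W) (q := W) he = q • LinearMap.id := by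
    ext ⟨v, hv⟩
    simpa using (hmem v).1 hv
  have h2 : W.mapQ W T he = (-1 : ℝ) • LinearMap.id := by
    apply Submodule.linearMap_qext
    ext v
    simp only [LinearMap.comp_apply, Submodule.mkQ_apply, Submodule.mapQ_apply,
      LinearMap.smul_apply, LinearMap.id_apply]
    rw [← Submodule.Quotient.mk_smul, Submodule.Quotient.eq, hmem, map_sub, map_smul, hT]
    module
  rw [h1, h2, LinearMap.det_smul, LinearMap.det_smul]
  simp [abs_mul, abs_pow, abs_of_nonneg hq]

theorem finrank_le_sum_of_iInf_eq_bot {ι : Type*} [Fintype ι] (W : ι → Submodule ℝ E)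
    (hW : ⨅ i, W i = ⊥) : finrank ℝ E ≤ ∑ i, (finrank ℝ E - finrank ℝ (W i)) := by
  have hinj : Function.Injective (LinearMap.pi fun i => (W i).mkQ) := by
    rw [← LinearMap.ker_eq_bot, LinearMap.ker_pi]
    simpa using hW
  refine (LinearMap.finrank_le_finrank_of_injective hinj).trans (le_of_eq ?_)
  rw [finrank_pi_fintype]
  exact Finset.sum_congr rfl fun i _ => by
    have := (W i).finrank_quotient_add_finrank
    omega

/-- If the `n`-th power of a product of `n` operators with eigenvalues `q` and `-1`, without a
common `q`-eigenvector, is the scalar `μ`, then `|μ|` is at most `q ^ (n * (n - 1))`. -/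
theorem abs_le_of_prod_pow_eq_smul [Nontrivial E] {q : ℝ} (hq : 1 ≤ q) (n : ℕ)
    (T : ℕ → Module.End ℝ E) (hT : ∀ i < n, ∀ v, T i (T i v) = (q - 1) • T i v + q • v)
    (hcommon : ∀ v, (∀ i < n, T i v = q • v) → v = 0) (μ : ℝ)
    (hμ : (((List.range n).map T).prod) ^ n = μ • 1) : |μ| ≤ q ^ (n * (n - 1)) := by
  have hq0 : 0 ≤ q := zero_le_one.trans hq
  let W : Fin n → Submodule ℝ E := fun i => LinearMap.ker (T i - q • LinearMap.id)
  have hWbot : ⨅ i, W i = ⊥ := by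
    rw [eq_bot_iff]
    intro v hv
    rw [Submodule.mem_iInf] at hv
    refine hcommon v fun i hi => ?_
    simpa [W, LinearMap.mem_ker, sub_eq_zero] using hv ⟨i, hi⟩
  have hdim := finrank_le_sum_of_iInf_eq_bot W hWbot
  have hsum : ∑ i, finrank ℝ (W i) ≤ (n - 1) * finrank ℝ E := by
    have h1 : ∑ i, (finrank ℝ E - finrank ℝ (W i)) + ∑ i, finrank ℝ (W i)
        = n * finrank ℝ E := by
      rw [← Finset.sum_add_distrib]
      rw [Finset.sum_congr rfl fun i _ => Nat.sub_add_cancel (W i).finrank_le]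
      simp
    rw [Nat.sub_mul, one_mul]
    omega
  have hdet : ∀ m ≤ n, |LinearMap.det ((List.range m).map T).prod|
      = ∏ i ∈ Finset.range m,
        q ^ finrank ℝ (LinearMap.ker (T i - q • LinearMap.id)) := by
    intro m
    induction m with
    | zero => intro _; simp
    | succ m ih =>
      intro hm
      rw [List.prod_range_succ, map_mul, abs_mul, ih (by omega), Finset.prod_range_succ,
        abs_det_of_quadratic (T m) hq0 (hT m (by omega))]
  have h2 : |μ| ^ finrank ℝ E = (q ^ ∑ i, finrank ℝ (W i)) ^ n := by
    have h3 := congrArg (fun X => |LinearMap.det X|) hμ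
    simp only [map_pow, abs_pow, hdet n le_rfl, LinearMap.det_smul, map_one, mul_one] at h3
    rw [← h3, Finset.prod_pow_eq_pow_sum, Finset.sum_range]
  have h4 : |μ| ^ finrank ℝ E ≤ (q ^ (n * (n - 1))) ^ finrank ℝ E := by
    rw [h2, ← pow_mul, ← pow_mul]
    refine pow_le_pow_right₀ hq ?_
    calc (∑ i, finrank ℝ (W i)) * n ≤ ((n - 1) * finrank ℝ E) * n :=
          Nat.mul_le_mul_right _ hsum
      _ = n * (n - 1) * finrank ℝ E := by ring
  exact le_of_pow_le_pow_left₀ (finrank_pos (R := ℝ) (M := E)).ne' (by positivity) h4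

/-- The orbit of `f 1` under a Coxeter-type product acting on a reflection-type module. -/
theorem prod_pow_apply_reflection {M : Type*} [AddCommGroup M] [Module ℝ M] (q : ℝ) (n : ℕ)
    (T : ℕ → Module.End ℝ M) (f : ℕ → M) (hf0 : f 0 = 0)
    (hne : ∀ i < n, ∀ j ≤ n, j ≠ i + 1 → T i (f j) = q • f j)
    (hlt : ∀ i, i + 1 < n → T i (f (i + 1)) = f (i + 2) + q • f i - f (i + 1))
    (hlast : ∀ i, i + 1 = n → T i (f n) = (2 * q) • f i - f n) (hn : 0 < n) :
    (∀ j, 1 ≤ j → j < n →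
      ((List.range n).map T).prod (f j) = q ^ (n - 1) • (f (j + 1) - f 1)) ∧
    ((List.range n).map T).prod (f n) = q ^ (n - 1) • (f n - (2 : ℝ) • f 1) := by
  have hfix : ∀ m ≤ n, ∀ j ≤ n, m < j →
      ((List.range m).map T).prod (f j) = q ^ m • f j := by
    intro m
    induction m with
    | zero => intros; simp
    | succ m ih =>
      intro hm j hj hmj
      rw [List.prod_range_succ, Module.End.mul_apply, hne m (by omega) j hj (by omega), map_smul,
        ih (by omega) j hj (by omega), smul_smul, pow_succ']
  have hup : ∀ i < n, ((List.range i).map T).prod (f i) = 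
      if i = 0 then 0 else q ^ (i - 1) • (f (i + 1) - f 1) := by
    intro i
    induction i with
    | zero => intro _; simp [hf0]
    | succ i ih =>
      intro hi
      rw [List.prod_range_succ, Module.End.mul_apply, hlt i hi, map_sub, map_add, map_smul,
        hfix i (by omega) (i + 1) (by omega) (by omega),
        hfix i (by omega) (i + 2) (by omega) (by omega), ih (by omega)]
      rcases i with _ | i
      · simp
      · simp only [Nat.add_sub_cancel, Nat.add_eq_zero_iff, one_ne_zero, and_false, if_false,
          smul_smul, ← pow_succ']
        module
  have hdown : ∀ j, 1 ≤ j → ∀ m, j + m ≤ n → j < n →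
      ((List.range (j + m)).map T).prod (f j) = q ^ (j + m - 1) • (f (j + 1) - f 1) := by
    intro j hj m
    induction m with
    | zero =>
      intro _ hjn
      rw [add_zero, hup j hjn, if_neg (by omega)]
    | succ m ih =>
      intro hm hjn
      rw [← add_assoc, List.prod_range_succ, Module.End.mul_apply,
        hne (j + m) (by omega) j (by omega) (by omega), map_smul, ih (by omega) hjn, smul_smul,
        ← pow_succ', show j + m + 1 - 1 = j + m - 1 + 1 by omega]
  refine ⟨fun j hj hjn => ?_, ?_⟩
  · have := hdown j hj (n - j) (by omega) hjn
    rwa [Nat.add_sub_cancel' hjn.le] at this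
  · obtain ⟨i, rfl⟩ : ∃ i, n = i + 1 := ⟨n - 1, by omega⟩
    rw [List.prod_range_succ, Module.End.mul_apply, hlast i rfl, map_sub, map_smul,
      hup i (by omega), hfix i (by omega) (i + 1) le_rfl (by omega)]
    rcases i with _ | i
    · simp; module
    · simp only [Nat.add_sub_cancel, Nat.add_eq_zero_iff, one_ne_zero, and_false, if_false,
        smul_smul, mul_assoc, ← pow_succ']
      module

theorem pow_prod_apply_reflection {M : Type*} [AddCommGroup M] [Module ℝ M] {c : ℝ} {n : ℕ}
    (hn : 0 < n) (C : Module.End ℝ M) (f : ℕ → M)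
    (hC : ∀ j, 1 ≤ j → j < n → C (f j) = c • (f (j + 1) - f 1))
    (hCn : C (f n) = c • (f n - (2 : ℝ) • f 1)) : (C ^ n) (f 1) = -(c ^ n) • f 1 := by
  have hpow : ∀ m < n, (C ^ m) (f 1) = c ^ m • (f (m + 1) - if m = 0 then 0 else f m) := by
    intro m
    induction m with
    | zero => intro _; simp
    | succ m ih =>
      intro hm
      rw [pow_succ', Module.End.mul_apply, ih (by omega), map_smul, map_sub]
      rcases m with _ | m
      · simp [hC 1 le_rfl (by omega)]
      · simp only [Nat.add_eq_zero_iff, one_ne_zero, and_false, if_false]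
        rw [hC (m + 1) (by omega) (by omega), hC (m + 1 + 1) (by omega) (by omega),
          pow_succ c (m + 1)]
        module
  obtain ⟨m, rfl⟩ : ∃ m, n = m + 1 := ⟨n - 1, by omega⟩
  rw [pow_succ', Module.End.mul_apply, hpow m (by omega), map_smul, map_sub, hCn]
  rcases m with _ | m
  · simp; module
  · simp only [Nat.add_eq_zero_iff, one_ne_zero, and_false, if_false]
    rw [hC (m + 1) (by omega) (by omega), pow_succ c (m + 1)]
    module

end LinearAlgebra

section Jump

open Module Submodule

variable {F V : Type*} [Field F] [AddCommGroup V] [Module F V]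

/-- The first index at which the chain `E` meets `D` outside of `A`. -/
noncomputable def jump (E : ℕ → Submodule F V) (A D : Submodule F V) : ℕ :=
  sInf {i | ¬ E i ⊓ D ≤ A}

theorem jump_eq_iff {E : ℕ → Submodule F V} {A D : Submodule F V} (h : ∃ i, ¬ E i ⊓ D ≤ A)
    {i : ℕ} : jump E A D = i ↔ ¬ E i ⊓ D ≤ A ∧ ∀ m < i, E m ⊓ D ≤ A := by
  constructor
  · rintro rfl
    exact ⟨Nat.sInf_mem (s := {i | ¬ E i ⊓ D ≤ A}) h,
      fun m hm => by simpa using Nat.notMem_of_lt_sInf hm⟩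
  · rintro ⟨h1, h2⟩
    refine le_antisymm (Nat.sInf_le h1) (le_of_not_gt fun hlt => ?_)
    exact Nat.sInf_mem (s := {i | ¬ E i ⊓ D ≤ A}) h (h2 _ hlt)

variable [FiniteDimensional F V]

theorem eq_sup_span_singleton {A X : Submodule F V} (hAX : A ≤ X)
    (hX : finrank F X = finrank F A + 1) {v : V} (hvX : v ∈ X) (hvA : v ∉ A) :
    X = A ⊔ F ∙ v := by
  refine (eq_of_le_of_finrank_eq (sup_le hAX ?_) ?_).symm
  · rwa [span_singleton_le_iff_mem]
  · rw [finrank_sup_span_singleton hvA, hX]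

theorem exists_not_inf_le {E : ℕ → Submodule F V} {N : ℕ} (hN : E N = ⊤) {A D : Submodule F V}
    (h : finrank F A < finrank F D) : ∃ i, ¬ E i ⊓ D ≤ A := by
  refine ⟨N, fun hle => ?_⟩
  rw [hN, top_inf_eq] at hle
  exact absurd (finrank_mono hle) (by omega)

theorem exists_jump_pair {E : ℕ → Submodule F V} {N : ℕ} (hE : Monotone E) (hN : E N = ⊤)
    (h0 : E 0 = ⊥) (hdim : ∀ i, finrank F (E (i + 1)) ≤ finrank F (E i) + 1)
    {A D : Submodule F V} (hAD : A ≤ D) (hD : finrank F D = finrank F A + 2) :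
    ∃ (X₀ : Submodule F V) (a b : ℕ), a < b ∧ A ≤ X₀ ∧ X₀ ≤ D ∧
      finrank F X₀ = finrank F A + 1 ∧ jump E A X₀ = a ∧ jump E X₀ D = b ∧
      ∀ X, A ≤ X → X ≤ D → finrank F X = finrank F A + 1 → X ≠ X₀ →
        jump E A X = b ∧ jump E X D = a := by
  obtain ⟨ha, ha'⟩ := (jump_eq_iff (exists_not_inf_le hN (by omega : finrank F A < finrank F D))
    (i := jump E A D)).1 rfl
  set a := jump E A D
  obtain ⟨v, ⟨hva, hvD⟩, hvA⟩ := SetLike.not_le_iff_exists.1 ha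
  set X₀ := A ⊔ F ∙ v with hX₀
  have hAX₀ : A ≤ X₀ := le_sup_left
  have hvX₀ : v ∈ X₀ := (le_sup_right : F ∙ v ≤ X₀) (mem_span_singleton_self v)
  have hX₀D : X₀ ≤ D := sup_le hAD (by rwa [span_singleton_le_iff_mem])
  have hrank : finrank F X₀ = finrank F A + 1 := finrank_sup_span_singleton hvA
  have hEaX₀ : E a ⊓ D ≤ X₀ := by
    rcases hcase : a with _ | a'
    · simp [h0]
    · have h1 : E a' ⊓ D ≤ A := ha' a' (by omega)
      have hvE : v ∉ E a' := fun hv => hvA (h1 ⟨hv, hvD⟩)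
      rw [hcase] at hva
      have hle : E a' ⊔ F ∙ v ≤ E (a' + 1) :=
        sup_le (hE a'.le_succ) (by rwa [span_singleton_le_iff_mem])
      have heq : E a' ⊔ F ∙ v = E (a' + 1) := eq_of_le_of_finrank_le hle (by
        rw [finrank_sup_span_singleton hvE]; exact hdim a')
      rintro w ⟨hw, hwD⟩
      rw [← heq] at hw
      obtain ⟨e, he, y, hy, rfl⟩ := mem_sup.1 hw
      obtain ⟨c, rfl⟩ := mem_span_singleton.1 hy
      refine X₀.add_mem (hAX₀ (h1 ⟨he, ?_⟩)) (X₀.smul_mem c hvX₀)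
      simpa using D.sub_mem hwD (D.smul_mem c hvD)
  obtain ⟨hb, hb'⟩ := (jump_eq_iff (exists_not_inf_le hN (by omega : finrank F X₀ < finrank F D))
    (i := jump E X₀ D)).1 rfl
  set b := jump E X₀ D
  have hab : a < b := by
    by_contra hba
    exact hb ((inf_le_inf_right D (hE (not_lt.1 hba))).trans hEaX₀)
  refine ⟨X₀, a, b, hab, hAX₀, hX₀D, hrank, ?_, rfl, ?_⟩
  · rw [jump_eq_iff (exists_not_inf_le hN (by omega))]
    exact ⟨fun h => hvA (h ⟨hva, hvX₀⟩),
      fun m hm => (inf_le_inf_left _ hX₀D).trans (ha' m hm)⟩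
  · intro X hAX hXD hX hne
    have hinf : X ⊓ X₀ ≤ A := by
      rintro x ⟨hx, hx₀⟩
      by_contra hxA
      exact hne ((eq_sup_span_singleton hAX hX hx hxA).trans
        (eq_sup_span_singleton hAX₀ hrank hx₀ hxA).symm)
    constructor
    · rw [jump_eq_iff (exists_not_inf_le hN (by omega))]
      refine ⟨fun hle => ?_, fun m hm => ?_⟩
      · obtain ⟨w, ⟨hwb, hwD⟩, hwX₀⟩ := SetLike.not_le_iff_exists.1 hb
        have hDeq : D = X₀ ⊔ F ∙ w := eq_sup_span_singleton hX₀D (by omega) hwD hwX₀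
        have hXA : ¬ X ≤ A := fun h => absurd (finrank_mono h) (by omega)
        obtain ⟨x, hxX, hxA⟩ := SetLike.not_le_iff_exists.1 hXA
        have hxD := hXD hxX
        rw [hDeq, hX₀] at hxD
        obtain ⟨y, hy, z, hz, rfl⟩ := mem_sup.1 hxD
        obtain ⟨s, hs, t, ht, rfl⟩ := mem_sup.1 hy
        obtain ⟨c, rfl⟩ := mem_span_singleton.1 hz
        obtain ⟨d, rfl⟩ := mem_span_singleton.1 ht
        refine hxA ?_
        rw [add_assoc] at hxX ⊢
        refine A.add_mem hs (hle ⟨?_, ?_⟩)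
        · exact (E b).add_mem ((E b).smul_mem d (hE hab.le hva)) ((E b).smul_mem c hwb)
        · simpa using X.sub_mem hxX (hAX hs)
      · exact (le_inf inf_le_right ((inf_le_inf_left _ hXD).trans (by
          by_contra hcon; exact hcon (hb' m hm)))).trans hinf
    · rw [jump_eq_iff (exists_not_inf_le hN (by omega))]
      refine ⟨fun hle => hvA (hinf ⟨hle ⟨hva, hvD⟩, hvX₀⟩), fun m hm => (ha' m hm).trans hAX⟩

theorem jump_orthogonal {B : LinearMap.BilinForm F V} (hB : B.Nondegenerate) (hr : B.IsRefl)
    {E : ℕ → Submodule F V} {N : ℕ} (hE : Monotone E) (h0 : E 0 = ⊥)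
    (hperp : ∀ m ≤ N, B.orthogonal (E m) = E (N - m))
    {A D : Submodule F V} (hAD : A ≤ D) (hD : finrank F D = finrank F A + 1) :
    jump E (B.orthogonal D) (B.orthogonal A) = N + 1 - jump E A D := by
  have hN : E N = ⊤ := by simpa [h0] using (hperp 0 N.zero_le).symm
  have key : ∀ m ≤ N, (E m ⊓ B.orthogonal A ≤ B.orthogonal D ↔ ¬ E (N - m) ⊓ D ≤ A) := by
    intro m hm
    have h1 : E m ⊓ B.orthogonal A = B.orthogonal (E (N - m) ⊔ A) := by
      have : E m = B.orthogonal (E (N - m)) := by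
        rw [hperp _ (Nat.sub_le _ _)]
        congr 1
        omega
      rw [this]
      apply le_antisymm
      · rintro x ⟨hx1, hx2⟩ y hy
        obtain ⟨s, hs, t, ht, rfl⟩ := mem_sup.1 hy
        have e1 := hx1 s hs
        have e2 := hx2 t ht
        simpa using congrArg₂ (· + ·) e1 e2
      · exact le_inf (LinearMap.BilinForm.orthogonal_le le_sup_left)
          (LinearMap.BilinForm.orthogonal_le le_sup_right)
    rw [h1]
    constructor
    · intro h hle
      have h2 := LinearMap.BilinForm.orthogonal_le (B := B) h
      rw [LinearMap.BilinForm.orthogonal_orthogonal hB hr,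
        LinearMap.BilinForm.orthogonal_orthogonal hB hr] at h2
      have hDA : ¬ D ≤ A := fun h => absurd (finrank_mono h) (by omega)
      obtain ⟨x, hxD, hxA⟩ := SetLike.not_le_iff_exists.1 hDA
      obtain ⟨e, he, a, ha, rfl⟩ := mem_sup.1 (h2 hxD)
      refine hxA (A.add_mem (hle ⟨he, ?_⟩) ha)
      simpa using D.sub_mem hxD (hAD ha)
    · intro h
      obtain ⟨x, ⟨hxE, hxD⟩, hxA⟩ := SetLike.not_le_iff_exists.1 h
      apply LinearMap.BilinForm.orthogonal_le
      rw [eq_sup_span_singleton hAD hD hxD hxA, sup_comm]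
      exact sup_le_sup_right (by rwa [span_singleton_le_iff_mem]) _
  obtain ⟨ha, ha'⟩ := (jump_eq_iff (exists_not_inf_le hN (by omega : finrank F A < finrank F D))
    (i := jump E A D)).1 rfl
  have haN : jump E A D ≤ N := Nat.sInf_le (fun hle => absurd (finrank_mono hle) (by
    rw [hN, top_inf_eq]; omega))
  have hpos : 1 ≤ jump E A D := by
    by_contra h
    rw [show jump E A D = 0 by omega, h0] at ha
    simp at ha
  set a := jump E A D
  have hne : ¬ E (N + 1 - a) ⊓ B.orthogonal A ≤ B.orthogonal D := by
    rw [key _ (by omega), not_not]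
    exact ha' _ (by omega)
  rw [jump_eq_iff ⟨_, hne⟩]
  refine ⟨hne, fun m hm => ?_⟩
  rw [key m (by omega)]
  exact fun hle => ha ((inf_le_inf_right D (hE (by omega))).trans hle)

end Jump

namespace SympFlag

open Module Submodule

section Flags

variable {F : Type} [Field F] {n : ℕ} {B : LinearMap.BilinForm F (Fin (2 * n) → F)}

/-- The flag of length `2 * n` obtained by adding the orthogonal complements. -/
def ext (c : SympFlag F n B) (k : ℕ) : Submodule F (Fin (2 * n) → F) :=
  if h : k ≤ n then c.1 ⟨k, by omega⟩ else B.orthogonal (c.1 ⟨2 * n - k, by omega⟩)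

theorem ext_of_le (c : SympFlag F n B) {k : ℕ} (hk : k ≤ n) : c.ext k = c.1 ⟨k, by omega⟩ :=
  dif_pos hk

theorem ext_of_lt (c : SympFlag F n B) {k : ℕ} (hk : n < k) :
    c.ext k = B.orthogonal (c.ext (2 * n - k)) := by
  rw [ext, dif_neg (by omega), ext_of_le c (by omega)]

theorem finrank_ext_of_le (c : SympFlag F n B) {k : ℕ} (hk : k ≤ n) :
    finrank F (c.ext k) = k := by
  rw [ext_of_le c hk, c.2.2.1]

theorem ext_zero (c : SympFlag F n B) : c.ext 0 = ⊥ := by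
  rw [← finrank_eq_zero (R := F), finrank_ext_of_le c n.zero_le]

theorem finrank_ext (hB : B.Nondegenerate) (c : SympFlag F n B) {k : ℕ} (hk : k ≤ 2 * n) :
    finrank F (c.ext k) = k := by
  rcases le_or_gt k n with h | h
  · exact finrank_ext_of_le c h
  · rw [ext_of_lt c h, LinearMap.BilinForm.finrank_orthogonal hB,
      finrank_ext_of_le c (by omega), finrank_fin_fun]
    omega

theorem ext_le_orthogonal (c : SympFlag F n B) : c.ext n ≤ B.orthogonal (c.ext n) := by
  rw [ext_of_le c le_rfl]
  exact fun x hx y hy => c.2.2.2 y hy x hx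

theorem orthogonal_ext (hB : B.Nondegenerate) (hA : B.IsAlt) (c : SympFlag F n B) {k : ℕ}
    (hk : k ≤ 2 * n) : B.orthogonal (c.ext k) = c.ext (2 * n - k) := by
  rcases lt_trichotomy k n with h | rfl | h
  · rw [ext_of_lt c (k := 2 * n - k) (by omega)]
    congr 2
    omega
  · rw [show 2 * k - k = k by omega]
    refine (eq_of_le_of_finrank_eq (ext_le_orthogonal c) ?_).symm
    rw [LinearMap.BilinForm.finrank_orthogonal hB, finrank_ext_of_le c le_rfl, finrank_fin_fun]
    omega
  · rw [ext_of_lt c h, LinearMap.BilinForm.orthogonal_orthogonal hB hA.isRefl]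

theorem ext_mono (c : SympFlag F n B) : Monotone c.ext := by
  have hlow : ∀ {i j}, i ≤ j → j ≤ n → c.ext i ≤ c.ext j := fun {i j} hij hj => by
    rw [ext_of_le c hj, ext_of_le c (hij.trans hj)]
    exact c.2.1 (by simpa using hij)
  intro i j hij
  rcases le_or_gt j n with hj | hj
  · exact hlow hij hj
  rw [ext_of_lt c hj]
  rcases le_or_gt i n with hi | hi
  · exact (hlow hi le_rfl).trans ((ext_le_orthogonal c).trans
      (LinearMap.BilinForm.orthogonal_le (hlow (by omega) le_rfl)))
  · rw [ext_of_lt c hi]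
    exact LinearMap.BilinForm.orthogonal_le (hlow (by omega) (by omega))

theorem ext_two_mul (hB : B.Nondegenerate) (c : SympFlag F n B) : c.ext (2 * n) = ⊤ :=
  eq_top_of_finrank_eq (by rw [finrank_ext hB c le_rfl, finrank_fin_fun])

theorem finrank_ext_succ_le (hB : B.Nondegenerate) (c : SympFlag F n B) (i : ℕ) :
    finrank F (c.ext (i + 1)) ≤ finrank F (c.ext i) + 1 := by
  rcases lt_or_ge i (2 * n) with h | h
  · rw [finrank_ext hB c (by omega), finrank_ext hB c (by omega)]
  · have htop : c.ext i = ⊤ := top_le_iff.1 (ext_two_mul hB c ▸ ext_mono c h)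
    rw [htop]
    exact (finrank_mono le_top).trans (Nat.le_succ _)

theorem eq_of_ext_eq {c d : SympFlag F n B} (h : ∀ j ≤ n, c.ext j = d.ext j) : c = d := by
  refine Subtype.ext (funext fun j => ?_)
  have := h j (by omega)
  rwa [ext_of_le c (by omega), ext_of_le d (by omega)] at this

/-- Two flags agreeing except possibly in dimension `k + 1`. -/
def PanelRel (k : ℕ) (c d : SympFlag F n B) : Prop :=
  ∀ j ≤ n, j ≠ k + 1 → c.ext j = d.ext j

theorem PanelRel.refl (k : ℕ) (c : SympFlag F n B) : PanelRel k c c := fun _ _ _ => rfl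

theorem PanelRel.symm {k : ℕ} {c d : SympFlag F n B} (h : PanelRel k c d) : PanelRel k d c :=
  fun j hj hjk => (h j hj hjk).symm

theorem PanelRel.trans {k : ℕ} {c d e : SympFlag F n B} (h : PanelRel k c d)
    (h' : PanelRel k d e) : PanelRel k c e :=
  fun j hj hjk => (h j hj hjk).trans (h' j hj hjk)

theorem PanelRel.ext_eq {k : ℕ} {c d : SympFlag F n B} (h : PanelRel k c d) {j : ℕ}
    (hj : j ≠ k + 1) (hj' : 2 * n - j ≠ k + 1) : c.ext j = d.ext j := by
  rcases le_or_gt j n with hjn | hjn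
  · exact h j hjn hj
  · rw [ext_of_lt c hjn, ext_of_lt d hjn, h _ (by omega) hj']

theorem PanelRel.ext_add_two {k : ℕ} {c d : SympFlag F n B} (h : PanelRel k c d) :
    c.ext (k + 2) = d.ext (k + 2) :=
  h.ext_eq (by omega) (by omega)

theorem PanelRel.eq_of_ext {k : ℕ} {c d : SympFlag F n B} (h : PanelRel k c d)
    (hk : c.ext (k + 1) = d.ext (k + 1)) : c = d :=
  eq_of_ext_eq fun j hj => by
    by_cases hjk : j = k + 1
    · rw [hjk, hk]
    · exact h j hj hjk

theorem exists_panelRel (hB : B.Nondegenerate) (hA : B.IsAlt) (c : SympFlag F n B) {k : ℕ}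
    (hk : k < n) {X : Submodule F (Fin (2 * n) → F)} (h1 : c.ext k ≤ X)
    (h2 : X ≤ c.ext (k + 2)) (hX : finrank F X = k + 1) :
    ∃ d, PanelRel k c d ∧ d.ext (k + 1) = X := by
  have hrank : finrank F X = finrank F (c.ext k) + 1 := by
    rw [hX, finrank_ext hB c (by omega)]
  let U : Fin (n + 1) → Submodule F (Fin (2 * n) → F) :=
    fun j => if (j : ℕ) = k + 1 then X else c.ext j
  have hmono : Monotone U := by
    intro i j hij
    have hij' : (i : ℕ) ≤ j := hij
    simp only [U]
    split_ifs with hi hj hj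
    · exact le_rfl
    · exact h2.trans (ext_mono c (by omega))
    · exact (ext_mono c (by omega)).trans h1
    · exact ext_mono c hij'
  have hiso : ∀ x ∈ U (Fin.last n), ∀ y ∈ U (Fin.last n), B x y = 0 := by
    simp only [U, Fin.val_last]
    split_ifs with hn
    · have hperp : c.ext (k + 2) = B.orthogonal (c.ext k) := by
        rw [orthogonal_ext hB hA c (by omega)]
        congr 1
        omega
      have hnot : ¬ X ≤ c.ext k := fun h => absurd (finrank_mono h) (by omega)
      obtain ⟨v, hvX, hv⟩ := SetLike.not_le_iff_exists.1 hnot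
      have hlo : ∀ x ∈ c.ext k, ∀ y ∈ X, B x y = 0 := fun x hx y hy => by
        have := h2 hy
        rw [hperp] at this
        exact this x hx
      intro x hx y hy
      have hx' := hx
      rw [eq_sup_span_singleton h1 hrank hvX hv] at hx hy
      obtain ⟨s, hs, z, hz, rfl⟩ := mem_sup.1 hx
      obtain ⟨a, rfl⟩ := mem_span_singleton.1 hz
      obtain ⟨t, ht, w, hw, rfl⟩ := mem_sup.1 hy
      obtain ⟨b, rfl⟩ := mem_span_singleton.1 hw
      have e1 := hA.isRefl _ _ (hlo t ht _ hx')
      have e2 := hlo s hs v hvX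
      rw [map_add, e1, map_smul, map_add, LinearMap.add_apply, e2, map_smul,
        LinearMap.smul_apply, hA v]
      simp
    · intro x hx y hy
      exact ext_le_orthogonal c hy x hx
  let d : SympFlag F n B := ⟨U, hmono, fun j => by
    by_cases hj : (j : ℕ) = k + 1
    · rw [show U j = X from if_pos hj, hX, hj]
    · rw [show U j = c.ext j from if_neg hj]
      exact finrank_ext_of_le c (Nat.lt_succ_iff.1 j.2), hiso⟩
  refine ⟨d, fun j hj hjk => ?_, ?_⟩
  · rw [ext_of_le d hj]
    simp [d, U, hjk]
  · rw [ext_of_le d (by omega)]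
    simp [d, U]

theorem existsUnique_panelRel_mem (hB : B.Nondegenerate) (hA : B.IsAlt) (c : SympFlag F n B)
    {k : ℕ} (hk : k < n) {x : Fin (2 * n) → F} (hx : x ∈ c.ext (k + 2)) (hx' : x ∉ c.ext k) :
    ∃! d, PanelRel k c d ∧ x ∈ d.ext (k + 1) := by
  have hfin := finrank_ext hB c (k := k) (by omega)
  obtain ⟨d, hd, hdX⟩ := exists_panelRel hB hA c hk (X := c.ext k ⊔ F ∙ x) le_sup_left
    (sup_le (ext_mono c (by omega)) (by rwa [span_singleton_le_iff_mem]))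
    (by rw [finrank_sup_span_singleton hx', hfin])
  have hxd : x ∈ d.ext (k + 1) := by
    rw [hdX]
    exact (le_sup_right : F ∙ x ≤ _) (mem_span_singleton_self x)
  refine ⟨d, ⟨hd, hxd⟩, fun e ⟨he, hxe⟩ => (he.symm.trans hd).eq_of_ext ?_⟩
  rw [hdX]
  refine eq_sup_span_singleton ?_ ?_ hxe hx'
  · rw [he k (by omega) (by omega)]
    exact ext_mono e (by omega)
  · rw [hfin, finrank_ext hB e (by omega)]

end Flags

section Counting

variable {F : Type} [Field F] [Fintype F] {n : ℕ}
  {B : LinearMap.BilinForm F (Fin (2 * n) → F)}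

open Classical in
/-- The sum of `g` over the vectors of a subspace. -/
noncomputable def subSum (g : (Fin (2 * n) → F) → ℝ) (W : Submodule F (Fin (2 * n) → F)) : ℝ :=
  ∑ x, if x ∈ W then g x else 0

theorem subSum_one (W : Submodule F (Fin (2 * n) → F)) :
    subSum (fun _ => 1) W = (Fintype.card F : ℝ) ^ finrank F W := by
  classical
  rw [subSum, Finset.sum_boole, ← Nat.cast_pow, ← Nat.card_eq_fintype_card,
    ← Module.natCard_eq_pow_finrank, Nat.card_eq_fintype_card, Fintype.card_subtype]

open Classical in
theorem sum_panelRel_subSum (hB : B.Nondegenerate) (hA : B.IsAlt) (c : SympFlag F n B) {k : ℕ}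
    (hk : k < n) (g : (Fin (2 * n) → F) → ℝ) :
    ∑ d with PanelRel k c d, subSum g (d.ext (k + 1)) = subSum g (c.ext (k + 2))
      + ((Finset.card {d | PanelRel k c d} : ℝ) - 1) * subSum g (c.ext k) := by
  unfold subSum
  rw [Finset.sum_comm, Finset.mul_sum, ← Finset.sum_add_distrib]
  refine Finset.sum_congr rfl fun x _ => ?_
  by_cases hlo : x ∈ c.ext k
  · have hall : ∀ d ∈ Finset.univ.filter (PanelRel k c),
        (if x ∈ d.ext (k + 1) then g x else 0) = g x := fun d hd => by
      rw [if_pos]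
      rw [(Finset.mem_filter.1 hd).2 k (by omega) (by omega)] at hlo
      exact ext_mono d (by omega) hlo
    rw [Finset.sum_congr rfl hall, if_pos hlo, if_pos (ext_mono c (by omega) hlo)]
    simp
    ring
  · rw [if_neg hlo, mul_zero, add_zero]
    by_cases hhi : x ∈ c.ext (k + 2)
    · obtain ⟨d, ⟨hd, hxd⟩, huniq⟩ := existsUnique_panelRel_mem hB hA c hk hhi hlo
      rw [if_pos hhi, Finset.sum_eq_single d, if_pos hxd]
      · intro e he hne
        exact if_neg fun hxe => hne (huniq e ⟨(Finset.mem_filter.1 he).2, hxe⟩)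
      · intro h
        exact absurd (Finset.mem_filter.2 ⟨Finset.mem_univ d, hd⟩) h
    · rw [if_neg hhi]
      refine Finset.sum_eq_zero fun d hd => if_neg fun hxd => hhi ?_
      rw [PanelRel.ext_add_two (Finset.mem_filter.1 hd).2]
      exact ext_mono d (by omega) hxd

open Classical in
theorem card_panelRel (hB : B.Nondegenerate) (hA : B.IsAlt) (c : SympFlag F n B) {k : ℕ}
    (hk : k < n) : (Finset.card {d | PanelRel k c d} : ℝ) = Fintype.card F + 1 := by
  have h := sum_panelRel_subSum hB hA c hk (fun _ => 1)
  have hfin : ∀ d : SympFlag F n B, finrank F (d.ext (k + 1)) = k + 1 :=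
    fun d => finrank_ext hB d (by omega)
  simp only [subSum_one, hfin, finrank_ext hB c (k := k) (by omega),
    finrank_ext hB c (k := k + 2) (by omega), Finset.sum_const, nsmul_eq_mul] at h
  have hq : (1 : ℝ) < Fintype.card F := by exact_mod_cast Fintype.one_lt_card
  have hne : ((Fintype.card F : ℝ) ^ k) * (Fintype.card F - 1) ≠ 0 :=
    mul_ne_zero (by positivity) (by linarith)
  apply mul_right_cancel₀ hne
  rw [pow_succ, pow_add] at h
  linear_combination h

end Counting

section Opposition

variable {F : Type} [Field F] {n : ℕ} {B : LinearMap.BilinForm F (Fin (2 * n) → F)}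

theorem oppS_iff (hB : B.Nondegenerate) (hA : B.IsAlt) {c d : SympFlag F n B} :
    OppS c d ↔ ∀ i ≤ n, c.ext i ⊓ d.ext (2 * n - i) = ⊥ := by
  have key : ∀ i (hi : i ≤ n), c.1 ⟨i, by omega⟩ ⊓ B.orthogonal (d.1 ⟨i, by omega⟩)
      = c.ext i ⊓ d.ext (2 * n - i) := fun i hi => by
    rw [← orthogonal_ext hB hA d (by omega), ext_of_le c hi, ext_of_le d hi]
  constructor
  · intro h i hi
    rw [← key i hi]
    exact h _
  · intro h i
    exact (key i (by omega)).trans (h i (by omega))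

theorem ext_inf_ext_eq_bot_symm (hB : B.Nondegenerate) (hA : B.IsAlt) {c d : SympFlag F n B}
    {i : ℕ} (hi : i ≤ 2 * n) (h : c.ext i ⊓ d.ext (2 * n - i) = ⊥) :
    d.ext i ⊓ c.ext (2 * n - i) = ⊥ := by
  have hsup : c.ext i ⊔ d.ext (2 * n - i) = ⊤ := by
    apply eq_top_of_finrank_eq
    have := finrank_sup_add_finrank_inf_eq (c.ext i) (d.ext (2 * n - i))
    rw [h, finrank_bot, finrank_ext hB c hi, finrank_ext hB d (by omega)] at this
    rw [finrank_fin_fun]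
    omega
  have hd : d.ext i = B.orthogonal (d.ext (2 * n - i)) := by
    rw [orthogonal_ext hB hA d (by omega)]
    congr 1
    omega
  rw [hd, ← orthogonal_ext hB hA c hi, eq_bot_iff,
    ← LinearMap.BilinForm.orthogonal_top_eq_bot hB, ← hsup]
  rintro x ⟨hx1, hx2⟩ y hy
  obtain ⟨s, hs, t, ht, rfl⟩ := mem_sup.1 hy
  simpa using congrArg₂ (· + ·) (hx2 s hs) (hx1 t ht)

theorem oppS_comm (hB : B.Nondegenerate) (hA : B.IsAlt) {c d : SympFlag F n B} :
    OppS c d ↔ OppS d c := by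
  rw [oppS_iff hB hA, oppS_iff hB hA]
  exact ⟨fun h i hi => ext_inf_ext_eq_bot_symm hB hA (by omega) (h i hi),
    fun h i hi => ext_inf_ext_eq_bot_symm hB hA (by omega) (h i hi)⟩

/-- Opposition in every dimension except possibly `k + 1`. -/
def OppExcept (k : ℕ) (c d : SympFlag F n B) : Prop :=
  ∀ i ≤ n, i ≠ k + 1 → c.ext i ⊓ d.ext (2 * n - i) = ⊥

theorem oppExcept_comm (hB : B.Nondegenerate) (hA : B.IsAlt) {k : ℕ} {c d : SympFlag F n B} :
    OppExcept k c d ↔ OppExcept k d c :=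
  ⟨fun h i hi hk => ext_inf_ext_eq_bot_symm hB hA (by omega) (h i hi hk),
    fun h i hi hk => ext_inf_ext_eq_bot_symm hB hA (by omega) (h i hi hk)⟩

theorem oppS_iff_of_panelRel (hB : B.Nondegenerate) (hA : B.IsAlt) {k : ℕ} (hk : k < n)
    {c d e : SympFlag F n B} (h : PanelRel k c e) :
    OppS e d ↔ OppExcept k c d ∧ e.ext (k + 1) ⊓ d.ext (2 * n - (k + 1)) = ⊥ := by
  rw [oppS_iff hB hA]
  constructor
  · intro ho
    exact ⟨fun i hi hik => by rw [h i hi hik]; exact ho i hi, ho _ hk⟩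
  · rintro ⟨h1, h2⟩ i hi
    by_cases hik : i = k + 1
    · rw [hik, h2]
    · rw [← h i hi hik]
      exact h1 i hi hik

theorem OppExcept.exists_vector (hB : B.Nondegenerate) (hA : B.IsAlt) {k : ℕ} (hk : k < n)
    {c d : SympFlag F n B} (h : OppExcept k c d) :
    ∃ v ∈ c.ext (k + 2), v ∉ c.ext k ∧ ∀ e, PanelRel k c e →
      (e.ext (k + 1) ⊓ d.ext (2 * n - (k + 1)) = ⊥ ↔ v ∉ e.ext (k + 1)) := by
  have hne : c.ext (k + 2) ⊓ d.ext (2 * n - (k + 1)) ≠ ⊥ := by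
    intro hbot
    have h1 := finrank_sup_add_finrank_inf_eq (c.ext (k + 2)) (d.ext (2 * n - (k + 1)))
    have h2 := finrank_le (c.ext (k + 2) ⊔ d.ext (2 * n - (k + 1)))
    rw [hbot, finrank_bot, finrank_ext hB c (by omega), finrank_ext hB d (by omega)] at h1
    rw [finrank_fin_fun] at h2
    omega
  obtain ⟨v, ⟨hvc, hvd⟩, hv0⟩ := (Submodule.ne_bot_iff _).1 hne
  have hlo : c.ext k ⊓ d.ext (2 * n - k) = ⊥ := h k (by omega) (by omega)
  have hhi : c.ext (k + 2) ⊓ d.ext (2 * n - (k + 2)) = ⊥ := by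
    rcases Nat.lt_or_ge (k + 1) n with hlt | hge
    · exact h (k + 2) (by omega) (by omega)
    · have := ext_inf_ext_eq_bot_symm hB hA (by omega) hlo
      rwa [inf_comm, show 2 * n - k = k + 2 by omega,
        show d.ext k = d.ext (2 * n - (k + 2)) by congr 1; omega] at this
  refine ⟨v, hvc, fun hvk => hv0 ?_, fun e he => ⟨fun hbot hve => hv0 ?_, fun hve => ?_⟩⟩
  · exact (Submodule.eq_bot_iff _).1 hlo v ⟨hvk, ext_mono d (by omega) hvd⟩
  · exact (Submodule.eq_bot_iff _).1 hbot v ⟨hve, hvd⟩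
  · rw [Submodule.eq_bot_iff]
    rintro w ⟨hwe, hwd⟩
    by_contra hw0
    have hvd' : v ∉ d.ext (2 * n - (k + 2)) := fun hv =>
      hv0 ((Submodule.eq_bot_iff _).1 hhi v ⟨hvc, hv⟩)
    rw [eq_sup_span_singleton (ext_mono d (by omega : 2 * n - (k + 2) ≤ 2 * n - (k + 1)))
      (by rw [finrank_ext hB d (by omega), finrank_ext hB d (by omega)]; omega) hvd hvd'] at hwd
    obtain ⟨y, hy, z, hz, rfl⟩ := mem_sup.1 hwd
    obtain ⟨a, rfl⟩ := mem_span_singleton.1 hz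
    have hwc : y + a • v ∈ c.ext (k + 2) := by
      rw [he.ext_add_two]
      exact ext_mono e (by omega) hwe
    have hyc : y ∈ c.ext (k + 2) := by
      simpa using sub_mem hwc ((c.ext (k + 2)).smul_mem a hvc)
    have hy0 : y = 0 := (Submodule.eq_bot_iff _).1 hhi y ⟨hyc, hy⟩
    subst hy0
    rw [zero_add] at hwe hw0
    have ha : a ≠ 0 := fun ha => hw0 (by simp [ha])
    exact hve (by simpa [smul_smul, ha] using (e.ext (k + 1)).smul_mem a⁻¹ hwe)

end Opposition

section PanelMatrix

variable {F : Type} [Field F] {n : ℕ} {B : LinearMap.BilinForm F (Fin (2 * n) → F)}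

variable (F n B) in
open Classical in
/-- The adjacency matrix of the graph of distinct flags agreeing outside dimension `k + 1`. -/
noncomputable def panelMat (k : ℕ) : Matrix (SympFlag F n B) (SympFlag F n B) ℝ :=
  fun c d => if PanelRel k c d ∧ c ≠ d then 1 else 0

theorem panelMat_apply_comm (k : ℕ) (c d : SympFlag F n B) :
    panelMat F n B k c d = panelMat F n B k d c := by
  classical
  exact if_congr ⟨fun h => ⟨h.1.symm, h.2.symm⟩, fun h => ⟨h.1.symm, h.2.symm⟩⟩ rfl rfl

variable [Fintype F]

open Classical in
theorem card_panelRel_oppS (hB : B.Nondegenerate) (hA : B.IsAlt) {k : ℕ} (hk : k < n)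
    (c d : SympFlag F n B) : (Finset.card {e | PanelRel k c e ∧ OppS e d} : ℝ)
      = if OppExcept k c d then (Fintype.card F : ℝ) else 0 := by
  split_ifs with h
  · obtain ⟨v, hv, hv', hiff⟩ := h.exists_vector hB hA hk
    obtain ⟨e₀, ⟨he₀, hve₀⟩, huniq⟩ := existsUnique_panelRel_mem hB hA c hk hv hv'
    have heq : ({e | PanelRel k c e ∧ OppS e d} : Finset (SympFlag F n B))
        = ({e | PanelRel k c e} : Finset (SympFlag F n B)).erase e₀ := by
      ext e
      simp only [Finset.mem_filter, Finset.mem_univ, true_and, Finset.mem_erase]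
      constructor
      · rintro ⟨he, ho⟩
        refine ⟨?_, he⟩
        rintro rfl
        exact (hiff e he).1 ((oppS_iff_of_panelRel hB hA hk he).1 ho).2 hve₀
      · rintro ⟨hne, he⟩
        exact ⟨he, (oppS_iff_of_panelRel hB hA hk he).2
          ⟨h, (hiff e he).2 fun hve => hne (huniq e ⟨he, hve⟩)⟩⟩
    have hmem : e₀ ∈ ({e | PanelRel k c e} : Finset (SympFlag F n B)) := by simpa using he₀
    have hcard := Finset.card_erase_add_one hmem
    rw [heq]
    have := card_panelRel hB hA c hk
    rw [← hcard] at this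
    push_cast at this
    linarith
  · rw [Nat.cast_eq_zero, Finset.card_eq_zero, Finset.filter_eq_empty_iff]
    rintro e - ⟨he, ho⟩
    exact h ((oppS_iff_of_panelRel hB hA hk he).1 ho).1

open Classical in
theorem panelMat_mulVec (k : ℕ) (φ : SympFlag F n B → ℝ) (c : SympFlag F n B) :
    (panelMat F n B k *ᵥ φ) c = ∑ d with PanelRel k c d, φ d - φ c := by
  have hmem : c ∈ ({d | PanelRel k c d} : Finset (SympFlag F n B)) := by
    simpa using PanelRel.refl k c
  rw [← Finset.add_sum_erase _ _ hmem, add_sub_cancel_left]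
  simp only [mulVec, dotProduct, panelMat, ite_mul, one_mul, zero_mul]
  rw [← Finset.sum_filter]
  refine Finset.sum_congr (Finset.ext fun d => ?_) fun _ _ => rfl
  simp [and_comm, eq_comm]

theorem panelMat_quadratic (hB : B.Nondegenerate) (hA : B.IsAlt) {k : ℕ} (hk : k < n)
    (φ : SympFlag F n B → ℝ) :
    panelMat F n B k *ᵥ (panelMat F n B k *ᵥ φ)
      = ((Fintype.card F : ℝ) - 1) • (panelMat F n B k *ᵥ φ) + (Fintype.card F : ℝ) • φ := by
  classical
  ext c
  rw [panelMat_mulVec]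
  simp only [Pi.add_apply, Pi.smul_apply, smul_eq_mul, panelMat_mulVec]
  have hsame : ∀ d ∈ ({d | PanelRel k c d} : Finset (SympFlag F n B)),
      ∑ e with PanelRel k d e, φ e - φ d = ∑ e with PanelRel k c e, φ e - φ d := by
    intro d hd
    have hd := (Finset.mem_filter.1 hd).2
    congr 2
    ext e
    simp only [Finset.mem_filter, Finset.mem_univ, true_and]
    exact ⟨fun h => hd.trans h, fun h => hd.symm.trans h⟩
  rw [Finset.sum_congr rfl hsame, Finset.sum_sub_distrib, Finset.sum_const, nsmul_eq_mul,
    card_panelRel hB hA c hk]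
  ring

theorem adjS_apply_comm (hB : B.Nondegenerate) (hA : B.IsAlt) (c d : SympFlag F n B) :
    adjS F n B c d = adjS F n B d c := by
  classical
  exact if_congr (oppS_comm hB hA) rfl rfl

open Classical in
theorem panelMat_mul_adjS_apply (hB : B.Nondegenerate) (hA : B.IsAlt) {k : ℕ} (hk : k < n)
    (c d : SympFlag F n B) : (panelMat F n B k * adjS F n B) c d
      = (if OppExcept k c d then (Fintype.card F : ℝ) else 0) - adjS F n B c d := by
  rw [← card_panelRel_oppS hB hA hk]
  have h := panelMat_mulVec k (fun e => adjS F n B e d) c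
  rw [show (panelMat F n B k * adjS F n B) c d
    = (panelMat F n B k *ᵥ fun e => adjS F n B e d) c from rfl, h]
  simp only [adjS]
  rw [Finset.sum_boole, Finset.filter_filter]

theorem panelMat_mul_adjS (hB : B.Nondegenerate) (hA : B.IsAlt) {k : ℕ} (hk : k < n) :
    panelMat F n B k * adjS F n B = adjS F n B * panelMat F n B k := by
  classical
  ext c d
  have h : (adjS F n B * panelMat F n B k) c d = (panelMat F n B k * adjS F n B) d c := by
    rw [mul_apply, mul_apply]
    refine Finset.sum_congr rfl fun e _ => ?_
    rw [mul_comm, panelMat_apply_comm, adjS_apply_comm hB hA]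
  rw [h, panelMat_mul_adjS_apply hB hA hk, panelMat_mul_adjS_apply hB hA hk,
    adjS_apply_comm hB hA, oppExcept_comm hB hA]

end PanelMatrix

section RelativePosition

variable {F : Type} [Field F] {n : ℕ} {B : LinearMap.BilinForm F (Fin (2 * n) → F)}

/-- The relative position of `d` with respect to `c`, in step `j`. -/
noncomputable def relPos (c d : SympFlag F n B) (j : ℕ) : ℕ :=
  jump c.ext (d.ext j) (d.ext (j + 1))

theorem relPos_eq_iff (hB : B.Nondegenerate) {c d : SympFlag F n B} {j i : ℕ} (hj : j < 2 * n) :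
    relPos c d j = i ↔ ¬ c.ext i ⊓ d.ext (j + 1) ≤ d.ext j ∧
      ∀ m < i, c.ext m ⊓ d.ext (j + 1) ≤ d.ext j :=
  jump_eq_iff (exists_not_inf_le (ext_two_mul hB c)
    (by rw [finrank_ext hB d (by omega), finrank_ext hB d (by omega)]; omega))

theorem relPos_congr {k j : ℕ} {c d e : SympFlag F n B} (h : PanelRel k d e) (hj : j < n)
    (hjk : j ≠ k) (hjk' : j ≠ k + 1) : relPos c d j = relPos c e j := by
  rw [relPos, relPos, h j hj.le hjk', h (j + 1) hj (by omega)]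

theorem exists_panelRel_relPos (hB : B.Nondegenerate) (hA : B.IsAlt) {k : ℕ} (hk : k < n)
    (c d : SympFlag F n B) : ∃ (e₀ : SympFlag F n B) (a b : ℕ), a < b ∧ PanelRel k d e₀ ∧
      relPos c e₀ k = a ∧ relPos c e₀ (k + 1) = b ∧
      ∀ e, PanelRel k d e → e ≠ e₀ → relPos c e k = b ∧ relPos c e (k + 1) = a := by
  have hfk := finrank_ext hB d (k := k) (by omega)
  obtain ⟨X₀, a, b, hab, h1, h2, hX₀, ha, hb, hother⟩ :=
    exists_jump_pair (ext_mono c) (ext_two_mul hB c) (ext_zero c) (finrank_ext_succ_le hB c)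
      (ext_mono d (by omega : k ≤ k + 2)) (by rw [hfk, finrank_ext hB d (by omega)])
  obtain ⟨e₀, he₀, hX⟩ := exists_panelRel hB hA d hk h1 h2 (by omega)
  refine ⟨e₀, a, b, hab, he₀, ?_, ?_, fun e he hne => ?_⟩
  · rw [relPos, hX, ← he₀ k (by omega) (by omega), ha]
  · rw [relPos, hX, ← he₀.ext_add_two, hb]
  · have hek := he k (by omega) (by omega)
    have := hother (e.ext (k + 1)) (by rw [hek]; exact ext_mono e (by omega))
      (by rw [he.ext_add_two]; exact ext_mono e (by omega))
      (by rw [hfk, finrank_ext hB e (by omega)])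
      (fun h => hne ((he.symm.trans he₀).eq_of_ext (h.trans hX.symm)))
    rwa [hek, he.ext_add_two] at this

theorem relPos_middle (hB : B.Nondegenerate) (hA : B.IsAlt) {k : ℕ} (hk : k + 1 = n)
    (c d : SympFlag F n B) : relPos c d (k + 1) = 2 * n + 1 - relPos c d k := by
  rw [relPos, relPos, ← jump_orthogonal hB hA.isRefl (ext_mono c) (ext_zero c)
    (fun m hm => orthogonal_ext hB hA c hm) (ext_mono d k.le_succ)
    (by rw [finrank_ext hB d (by omega), finrank_ext hB d (by omega)]),
    orthogonal_ext hB hA d (by omega), orthogonal_ext hB hA d (by omega)]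
  congr 2 <;> omega

/-- `d` has relative position `w` with respect to `c`. -/
def HasPos (w : ℕ → ℕ) (c d : SympFlag F n B) : Prop := ∀ j < n, relPos c d j = w j

theorem hasPos_succ_iff (hB : B.Nondegenerate) {c d : SympFlag F n B} :
    HasPos (fun j => j + 1) c d ↔ c = d := by
  constructor
  · intro h
    refine eq_of_ext_eq fun j => ?_
    induction j with
    | zero => intro _; rw [ext_zero, ext_zero]
    | succ j ih =>
      intro hj
      have ih := ih (by omega)
      obtain ⟨h1, -⟩ := (relPos_eq_iff hB (by omega)).1 (h j (by omega))
      obtain ⟨x, ⟨hxc, hxd⟩, hx⟩ := SetLike.not_le_iff_exists.1 h1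
      rw [eq_sup_span_singleton (ext_mono d j.le_succ)
        (by rw [finrank_ext hB d (by omega), finrank_ext hB d (by omega)]) hxd hx]
      rw [← ih] at hx ⊢
      exact eq_sup_span_singleton (ext_mono c j.le_succ)
        (by rw [finrank_ext hB c (by omega), finrank_ext hB c (by omega)]) hxc hx
  · rintro rfl j hj
    beta_reduce
    rw [relPos_eq_iff hB (by omega), inf_idem]
    refine ⟨fun hle => ?_, fun m hm => inf_le_left.trans (ext_mono c (by omega))⟩
    have := finrank_mono hle
    rw [finrank_ext hB c (by omega), finrank_ext hB c (by omega)] at this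
    omega

theorem hasPos_longest_iff (hB : B.Nondegenerate) (hA : B.IsAlt) {c d : SympFlag F n B} :
    HasPos (fun j => 2 * n - j) c d ↔ OppS d c := by
  rw [oppS_iff hB hA]
  constructor
  · intro h i
    induction i with
    | zero => intro _; rw [ext_zero, bot_inf_eq]
    | succ i ih =>
      intro hi
      obtain ⟨-, h2⟩ := (relPos_eq_iff hB (i := 2 * n - i) (by omega)).1 (h i (by omega))
      rw [eq_bot_iff, ← ih (by omega)]
      exact le_inf (by rw [inf_comm]; exact h2 _ (by omega))
        (inf_le_right.trans (ext_mono c (by omega)))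
  · intro h j hj
    beta_reduce
    rw [relPos_eq_iff hB (by omega)]
    refine ⟨fun hle => ?_, fun m hm => ?_⟩
    · have hbot : c.ext (2 * n - j) ⊓ d.ext (j + 1) = ⊥ := by
        rw [eq_bot_iff, ← h j hj.le]
        exact le_inf hle inf_le_left
      have h1 := finrank_sup_add_finrank_inf_eq (c.ext (2 * n - j)) (d.ext (j + 1))
      have h2 := finrank_le (c.ext (2 * n - j) ⊔ d.ext (j + 1))
      rw [hbot, finrank_bot, finrank_ext hB c (by omega), finrank_ext hB d (by omega)] at h1
      rw [finrank_fin_fun] at h2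
      omega
    · refine le_trans ?_ bot_le
      rw [← h (j + 1) hj, inf_comm]
      exact inf_le_inf_left _ (ext_mono c (by omega))

end RelativePosition

section PositionMatrix

variable (F : Type) [Field F] (n : ℕ) (B : LinearMap.BilinForm F (Fin (2 * n) → F))

open Classical in
/-- The indicator matrix of the relative position `w`. -/
noncomputable def posMat (w : ℕ → ℕ) : Matrix (SympFlag F n B) (SympFlag F n B) ℝ :=
  fun c d => if HasPos w c d then 1 else 0

variable {F n B}

theorem posMat_congr {w w' : ℕ → ℕ} (h : ∀ j < n, w j = w' j) :
    posMat F n B w = posMat F n B w' := by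
  classical
  ext c d
  exact if_congr (forall₂_congr fun j hj => by rw [h j hj]) rfl rfl

variable [Fintype F]

theorem posMat_mul_panelMat {w w' : ℕ → ℕ} {k : ℕ}
    (huniq : ∀ c d e e' : SympFlag F n B, PanelRel k d e → PanelRel k d e' →
      HasPos w c e → HasPos w c e' → e = e')
    (hiff : ∀ c d : SympFlag F n B,
      HasPos w' c d ↔ ∃ e, PanelRel k d e ∧ e ≠ d ∧ HasPos w c e) :
    posMat F n B w * panelMat F n B k = posMat F n B w' := by
  classical
  ext c d
  rw [mul_apply]
  simp only [posMat, panelMat, mul_ite, mul_one, mul_zero, ← ite_and]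
  by_cases h : HasPos w' c d
  · rw [if_pos h]
    obtain ⟨e, he, hne, hpos⟩ := (hiff c d).1 h
    rw [Finset.sum_eq_single e, if_pos ⟨⟨he.symm, hne⟩, hpos⟩]
    · intro e' _ hne'
      exact if_neg fun h' => hne' (huniq c d e' e h'.1.1.symm he h'.2 hpos)
    · simp
  · rw [if_neg h]
    exact Finset.sum_eq_zero fun e _ => if_neg fun h' =>
      h ((hiff c d).2 ⟨e, h'.1.1.symm, h'.1.2, h'.2⟩)

theorem posMat_mul_panelMat_of_lt (hB : B.Nondegenerate) (hA : B.IsAlt) {w w' : ℕ → ℕ} {k : ℕ}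
    (hk : k + 1 < n) (hw : w k < w (k + 1)) (h1 : w' k = w (k + 1)) (h2 : w' (k + 1) = w k)
    (h3 : ∀ j < n, j ≠ k → j ≠ k + 1 → w' j = w j) :
    posMat F n B w * panelMat F n B k = posMat F n B w' := by
  apply posMat_mul_panelMat
  · intro c d e e' he he' hpe hpe'
    obtain ⟨e₀, a, b, hab, he₀, ha, hb, hother⟩ :=
      exists_panelRel_relPos hB hA (by omega : k < n) c d
    have key : ∀ e, PanelRel k d e → HasPos w c e → e = e₀ := fun e he hpe => by
      by_contra hne
      have := hother e he hne
      rw [hpe k (by omega), hpe (k + 1) hk] at this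
      omega
    rw [key e he hpe, key e' he' hpe']
  · intro c d
    obtain ⟨e₀, a, b, hab, he₀, ha, hb, hother⟩ :=
      exists_panelRel_relPos hB hA (by omega : k < n) c d
    constructor
    · intro hd
      have hd1 := hd k (by omega)
      have hd2 := hd (k + 1) hk
      have hne : d ≠ e₀ := by rintro rfl; omega
      have hd3 := hother d (PanelRel.refl k d) hne
      refine ⟨e₀, he₀, hne.symm, fun j hj => ?_⟩
      by_cases hjk : j = k
      · subst hjk; omega
      by_cases hjk' : j = k + 1
      · subst hjk'; omega
      rw [← relPos_congr he₀ hj hjk hjk', hd j hj, h3 j hj hjk hjk']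
    · rintro ⟨e, he, hne, hpe⟩
      have hp1 := hpe k (by omega)
      have hp2 := hpe (k + 1) hk
      have hee₀ : e = e₀ := by
        by_contra h
        have := hother e he h
        omega
      subst hee₀
      have hd3 := hother d (PanelRel.refl k d) hne.symm
      intro j hj
      by_cases hjk : j = k
      · subst hjk; omega
      by_cases hjk' : j = k + 1
      · subst hjk'; omega
      rw [relPos_congr he hj hjk hjk', hpe j hj, h3 j hj hjk hjk']

theorem posMat_mul_panelMat_last (hB : B.Nondegenerate) (hA : B.IsAlt) {w w' : ℕ → ℕ} {k : ℕ}
    (hk : k + 1 = n) (hw : w k ≤ n) (h1 : w' k = 2 * n + 1 - w k)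
    (h3 : ∀ j < n, j ≠ k → w' j = w j) :
    posMat F n B w * panelMat F n B k = posMat F n B w' := by
  have hmid := fun c d : SympFlag F n B => relPos_middle hB hA hk c d
  apply posMat_mul_panelMat
  · intro c d e e' he he' hpe hpe'
    obtain ⟨e₀, a, b, hab, he₀, ha, hb, hother⟩ :=
      exists_panelRel_relPos hB hA (by omega : k < n) c d
    have key : ∀ e, PanelRel k d e → HasPos w c e → e = e₀ := fun e he hpe => by
      by_contra hne
      have := hother e he hne
      rw [hmid, hpe k (by omega)] at this
      omega
    rw [key e he hpe, key e' he' hpe']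
  · intro c d
    obtain ⟨e₀, a, b, hab, he₀, ha, hb, hother⟩ :=
      exists_panelRel_relPos hB hA (by omega : k < n) c d
    have hmid₀ := hmid c e₀
    have hmidd := hmid c d
    constructor
    · intro hd
      have hd1 := hd k (by omega)
      have hne : d ≠ e₀ := by rintro rfl; omega
      have hd3 := hother d (PanelRel.refl k d) hne
      refine ⟨e₀, he₀, hne.symm, fun j hj => ?_⟩
      by_cases hjk : j = k
      · subst hjk; omega
      rw [← relPos_congr he₀ hj hjk (by omega), hd j hj, h3 j hj hjk]
    · rintro ⟨e, he, hne, hpe⟩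
      have hp1 := hpe k (by omega)
      have hmide := hmid c e
      have hee₀ : e = e₀ := by
        by_contra h
        have := hother e he h
        omega
      subst hee₀
      have hd3 := hother d (PanelRel.refl k d) hne.symm
      intro j hj
      by_cases hjk : j = k
      · subst hjk; omega
      rw [relPos_congr he hj hjk (by omega), hpe j hj, h3 j hj hjk]

/-- The relative position reached by `t` Coxeter words in the panel generators. -/
def coxeterPos (n t j : ℕ) : ℕ := if j < n - t then t + j + 1 else 3 * n - t - j

open Classical in
theorem posMat_coxeterPos_mul_prod (hB : B.Nondegenerate) (hA : B.IsAlt) {t : ℕ} (ht : t < n) :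
    posMat F n B (coxeterPos n t) * ((List.range n).map (panelMat F n B)).prod
      = posMat F n B (coxeterPos n (t + 1)) := by
  have hpart : ∀ m < n, posMat F n B (coxeterPos n t) * ((List.range m).map (panelMat F n B)).prod
      = posMat F n B (fun j => if j < m then coxeterPos n t (j + 1)
          else if j = m then t + 1 else coxeterPos n t j) := by
    intro m
    induction m with
    | zero =>
      intro _
      rw [List.range_zero, List.map_nil, List.prod_nil, mul_one]
      refine posMat_congr fun j hj => ?_
      rcases Nat.eq_zero_or_pos j with rfl | hj0
      · simp [coxeterPos, ht]
      · rw [if_neg (by omega), if_neg (by omega)]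
    | succ m ih =>
      intro hm
      rw [List.prod_range_succ, ← mul_assoc, ih (by omega)]
      apply posMat_mul_panelMat_of_lt hB hA hm
      · simp only [coxeterPos]
        split_ifs <;> omega
      · simp only [coxeterPos]
        split_ifs <;> omega
      · simp
      · intro j hj hjm hjm'
        simp only [show j < m + 1 ↔ j < m by omega, hjm, hjm', if_false]
  obtain ⟨m, rfl⟩ : ∃ m, n = m + 1 := ⟨n - 1, by omega⟩
  rw [List.prod_range_succ, ← mul_assoc, hpart m (by omega)]
  apply posMat_mul_panelMat_last hB hA rfl
  · simp
    omega
  · simp only [coxeterPos]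
    split_ifs <;> omega
  · intro j hj hjm
    simp only [coxeterPos]
    split_ifs <;> omega

open Classical in
/-- The opposition matrix is the image of the longest element of the Weyl group. -/
theorem prod_panelMat_pow (hB : B.Nondegenerate) (hA : B.IsAlt) :
    ((List.range n).map (panelMat F n B)).prod ^ n = adjS F n B := by
  have hpow : ∀ t ≤ n, ((List.range n).map (panelMat F n B)).prod ^ t
      = posMat F n B (coxeterPos n t) := by
    intro t
    induction t with
    | zero =>
      intro _
      rw [pow_zero, posMat_congr (w' := fun j => j + 1)]
      · ext c d
        simp only [one_apply, posMat, hasPos_succ_iff hB]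
      · intro j hj
        simp [coxeterPos, hj]
    | succ t ih =>
      intro ht
      rw [pow_succ, ih (by omega), posMat_coxeterPos_mul_prod hB hA ht]
  rw [hpow n le_rfl, posMat_congr (w' := fun j => 2 * n - j)]
  · ext c d
    exact if_congr ((hasPos_longest_iff hB hA).trans (oppS_comm hB hA)) rfl rfl
  · intro j hj
    simp only [coxeterPos]
    split_ifs <;> omega

end PositionMatrix

end SympFlag

section HeckeEigenspace

open Module

variable {M : Type*} [AddCommGroup M] [Module ℝ M]

theorem pow_apply_of_apply_eq_smul {T : Module.End ℝ M} {q : ℝ} {v : M} (h : T v = q • v)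
    (m : ℕ) : (T ^ m) v = q ^ m • v := by
  induction m with
  | zero => simp
  | succ m ih => rw [pow_succ, Module.End.mul_apply, h, map_smul, ih, smul_smul, pow_succ']

theorem prod_apply_of_common_eigenvector {q : ℝ} {n : ℕ} {T : ℕ → Module.End ℝ M} {v : M}
    (h : ∀ i < n, T i v = q • v) : ((List.range n).map T).prod v = q ^ n • v := by
  induction n with
  | zero => simp
  | succ n ih =>
    rw [List.prod_range_succ, Module.End.mul_apply, h n n.lt_succ_self, map_smul,
      ih fun i hi => h i (by omega), smul_smul, pow_succ']

theorem neg_le_of_prod_pow_eigenvector [FiniteDimensional ℝ M] {q : ℝ} (hq : 1 ≤ q) (n : ℕ)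
    (T : ℕ → Module.End ℝ M) (hT : ∀ i < n, ∀ v, T i (T i v) = (q - 1) • T i v + q • v)
    (A : Module.End ℝ M) (hA : ((List.range n).map T).prod ^ n = A)
    (hcomm : ∀ i < n, ∀ v, A (T i v) = T i (A v)) {μ : ℝ} {v : M} (hv : v ≠ 0)
    (hμ : A v = μ • v) : -q ^ (n * (n - 1)) ≤ μ := by
  have hq0 : 0 ≤ q := zero_le_one.trans hq
  by_cases hcommon : ∃ u ≠ 0, A u = μ • u ∧ ∀ i < n, T i u = q • u
  · obtain ⟨u, hu, hAu, hTu⟩ := hcommon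
    rw [← hA, pow_apply_of_apply_eq_smul (prod_apply_of_common_eigenvector hTu)] at hAu
    rw [← smul_left_injective ℝ hu hAu]
    exact (neg_nonpos.2 (by positivity)).trans (by positivity)
  · let E := End.eigenspace A μ
    have hinv : ∀ i < n, ∀ u ∈ E, T i u ∈ E := fun i hi u hu => by
      rw [End.mem_eigenspace_iff] at hu ⊢
      rw [hcomm i hi, hu, map_smul]
    let S : ℕ → Module.End ℝ E := fun i => if h : i < n then (T i).restrict (hinv i h) else 0
    have hS : ∀ i < n, ∀ u : E, (S i u : M) = T i u := fun i hi u => by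
      simp only [S, dif_pos hi, LinearMap.coe_restrict_apply]
    have hprod : ∀ m ≤ n, ∀ u : E,
        (((List.range m).map S).prod u : M) = ((List.range m).map T).prod u := by
      intro m
      induction m with
      | zero => intros; simp
      | succ m ih =>
        intro hm u
        rw [List.prod_range_succ, List.prod_range_succ, Module.End.mul_apply,
          Module.End.mul_apply, ih (by omega), hS m hm]
    have hpow : ∀ m, ∀ u : E,
        ((((List.range n).map S).prod ^ m) u : M) = (((List.range n).map T).prod ^ m) u := by
      intro m
      induction m with
      | zero => intros; simp
      | succ m ih =>
        intro u
        rw [pow_succ, pow_succ, Module.End.mul_apply, Module.End.mul_apply, ih, hprod n le_rfl]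
    have : Nontrivial E :=
      ⟨⟨v, End.mem_eigenspace_iff.2 hμ⟩, 0, fun h => hv (congrArg Subtype.val h)⟩
    refine (abs_le.1 (abs_le_of_prod_pow_eq_smul hq n S ?_ ?_ μ ?_)).1
    · intro i hi u
      ext
      simp [hS i hi, hT i hi]
    · intro u hu
      by_contra hne
      refine hcommon ⟨u, fun h => hne (Subtype.ext h), End.mem_eigenspace_iff.1 u.2,
        fun i hi => ?_⟩
      rw [← hS i hi, hu i hi]
      rfl
    · ext u
      rw [hpow, hA, End.mem_eigenspace_iff.1 u.2]
      rfl

end HeckeEigenspace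

namespace SympFlag

open Module Submodule

section Existence

variable {F : Type} [Field F] {n : ℕ} (B : LinearMap.BilinForm F (Fin (2 * n) → F))

theorem exists_isotropic_chain (hB : B.Nondegenerate) (hA : B.IsAlt) :
    ∀ k ≤ n, ∃ U : ℕ → Submodule F (Fin (2 * n) → F), Monotone U ∧
      (∀ j ≤ k, finrank F (U j) = j) ∧ ∀ x ∈ U k, ∀ y ∈ U k, B x y = 0 := by
  intro k
  induction k with
  | zero =>
    refine fun _ => ⟨fun _ => ⊥, fun _ _ _ => le_rfl, fun j hj => ?_, fun x hx y hy => ?_⟩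
    · rw [finrank_bot]
      omega
    · rw [(mem_bot F).1 hx, map_zero, LinearMap.zero_apply]
  | succ k ih =>
    intro hk
    obtain ⟨U, hmono, hrank, hiso⟩ := ih (by omega)
    have hnle : ¬ B.orthogonal (U k) ≤ U k := fun hle => by
      have := finrank_mono hle
      rw [LinearMap.BilinForm.finrank_orthogonal hB, hrank k le_rfl, finrank_fin_fun] at this
      omega
    obtain ⟨v, hv, hvU⟩ := SetLike.not_le_iff_exists.1 hnle
    have hvU' : ∀ x ∈ U k, B x v = 0 := LinearMap.BilinForm.mem_orthogonal_iff.1 hv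
    refine ⟨fun j => if j ≤ k then U j else U k ⊔ F ∙ v, fun i j hij => ?_, fun j hj => ?_, ?_⟩
    · beta_reduce
      split_ifs with hi hj hj
      · exact hmono hij
      · exact (hmono hi).trans le_sup_left
      · omega
      · exact le_rfl
    · beta_reduce
      by_cases hjk : j ≤ k
      · rw [if_pos hjk, hrank j hjk]
      · rw [if_neg hjk, finrank_sup_span_singleton hvU, hrank k le_rfl]
        omega
    · simp only [show ¬ k + 1 ≤ k by omega, if_false]
      intro x hx y hy
      obtain ⟨x₀, hx₀, x₁, hx₁, rfl⟩ := mem_sup.1 hx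
      obtain ⟨y₀, hy₀, y₁, hy₁, rfl⟩ := mem_sup.1 hy
      obtain ⟨a, rfl⟩ := mem_span_singleton.1 hx₁
      obtain ⟨b, rfl⟩ := mem_span_singleton.1 hy₁
      have hvy : B v y₀ = 0 := hA.isRefl _ _ (hvU' y₀ hy₀)
      simp [hiso x₀ hx₀ y₀ hy₀, hvU' x₀ hx₀, hvy, hA.self_eq_zero v]

theorem nonempty (hB : B.Nondegenerate) (hA : B.IsAlt) : Nonempty (SympFlag F n B) := by
  obtain ⟨U, hmono, hrank, hiso⟩ := exists_isotropic_chain B hB hA n le_rfl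
  exact ⟨⟨fun j => U j, fun i j hij => hmono hij, fun j => hrank j (by omega), hiso⟩⟩

end Existence

section ReflectionRepresentation

variable {F : Type} [Field F] {n : ℕ} {B : LinearMap.BilinForm F (Fin (2 * n) → F)}

theorem finrank_ext_inf_ext_two_mul_sub (hB : B.Nondegenerate) (hA : B.IsAlt)
    (c d : SympFlag F n B) {j : ℕ} (hj : j ≤ n) :
    finrank F ↥(c.ext n ⊓ d.ext (2 * n - j)) = n - j + finrank F ↥(c.ext n ⊓ d.ext j) := by
  have hc : B.orthogonal (c.ext n) = c.ext n := by
    rw [orthogonal_ext hB hA c (by omega)]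
    congr 1
    omega
  have horth : c.ext n ⊓ d.ext (2 * n - j) = B.orthogonal (c.ext n ⊔ d.ext j) := by
    rw [← orthogonal_ext hB hA d (by omega)]
    refine le_antisymm (fun x hx y hy => ?_) (le_inf ?_ ?_)
    · obtain ⟨u, hu, w, hw, rfl⟩ := mem_sup.1 hy
      have h1 : B u x = 0 := ext_le_orthogonal c hx.1 u hu
      have h2 : B w x = 0 := hx.2 w hw
      change B (u + w) x = 0
      rw [map_add, LinearMap.add_apply, h1, h2, add_zero]
    · exact (LinearMap.BilinForm.orthogonal_le le_sup_left).trans hc.le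
    · exact LinearMap.BilinForm.orthogonal_le le_sup_right
  have h := finrank_sup_add_finrank_inf_eq (c.ext n) (d.ext j)
  have hle := finrank_le (c.ext n ⊔ d.ext j)
  rw [finrank_ext_of_le c le_rfl, finrank_ext_of_le d hj] at h
  rw [horth, LinearMap.BilinForm.finrank_orthogonal hB]
  rw [finrank_fin_fun] at hle ⊢
  omega

variable [Fintype F]

open Classical in
/-- The difference of the indicator functions of the Lagrangians of `c` and `d`. -/
noncomputable def lagDiff (c d : SympFlag F n B) (x : Fin (2 * n) → F) : ℝ :=
  (if x ∈ c.ext n then 1 else 0) - if x ∈ d.ext n then 1 else 0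

theorem subSum_lagDiff (c d : SympFlag F n B) (W : Submodule F (Fin (2 * n) → F)) :
    subSum (lagDiff c d) W = (Fintype.card F : ℝ) ^ finrank F ↥(c.ext n ⊓ W)
      - (Fintype.card F : ℝ) ^ finrank F ↥(d.ext n ⊓ W) := by
  classical
  rw [← subSum_one, ← subSum_one]
  simp only [subSum, lagDiff]
  rw [← Finset.sum_sub_distrib]
  refine Finset.sum_congr rfl fun x _ => ?_
  by_cases hx : x ∈ W <;> simp [hx]

theorem subSum_lagDiff_ext_succ (hB : B.Nondegenerate) (hA : B.IsAlt) (c d e : SympFlag F n B)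
    {j : ℕ} (hj : j + 1 = n) : subSum (lagDiff c d) (e.ext (j + 2))
      = Fintype.card F * subSum (lagDiff c d) (e.ext j) := by
  have h := fun c : SympFlag F n B =>
    finrank_ext_inf_ext_two_mul_sub hB hA c e (j := j) (by omega)
  rw [show 2 * n - j = j + 2 by omega, show n - j = 1 by omega] at h
  rw [subSum_lagDiff, subSum_lagDiff, h, h, pow_add, pow_add, pow_one, mul_sub]

theorem panelMat_mulVec_subSum (hB : B.Nondegenerate) (hA : B.IsAlt)
    (g : (Fin (2 * n) → F) → ℝ) {k : ℕ} (hk : k < n) (e : SympFlag F n B) :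
    (panelMat F n B k *ᵥ fun e => subSum g (e.ext (k + 1))) e = subSum g (e.ext (k + 2))
      + Fintype.card F * subSum g (e.ext k) - subSum g (e.ext (k + 1)) := by
  rw [panelMat_mulVec, sum_panelRel_subSum hB hA e hk, card_panelRel hB hA e hk,
    add_sub_cancel_right]

theorem panelMat_mulVec_subSum_of_ne (hB : B.Nondegenerate) (hA : B.IsAlt)
    (g : (Fin (2 * n) → F) → ℝ) {k j : ℕ} (hk : k < n) (hj : j ≤ n) (hjk : j ≠ k + 1) :
    (panelMat F n B k *ᵥ fun e : SympFlag F n B => subSum g (e.ext j))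
      = (Fintype.card F : ℝ) • fun e : SympFlag F n B => subSum g (e.ext j) := by
  classical
  ext e
  have hconst : ∀ d ∈ ({d | PanelRel k e d} : Finset (SympFlag F n B)),
      subSum g (d.ext j) = subSum g (e.ext j) := fun d hd => by
    rw [(Finset.mem_filter.1 hd).2 j hj hjk]
  rw [panelMat_mulVec, Finset.sum_congr rfl hconst, Finset.sum_const, nsmul_eq_mul,
    card_panelRel hB hA e hk, Pi.smul_apply, smul_eq_mul]
  ring

theorem exists_ext_ne (hB : B.Nondegenerate) (hA : B.IsAlt) (hn : 0 < n) (c : SympFlag F n B) :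
    ∃ d : SympFlag F n B, d.ext n ≠ c.ext n := by
  classical
  obtain ⟨k, rfl⟩ : ∃ k, n = k + 1 := ⟨n - 1, by omega⟩
  have hcard := card_panelRel hB hA c k.lt_succ_self
  have hF : 1 < Fintype.card F := Fintype.one_lt_card
  have h1 : 1 < Finset.card {d | PanelRel k c d} := by
    have : (Finset.card {d | PanelRel k c d}) = Fintype.card F + 1 := by exact_mod_cast hcard
    omega
  obtain ⟨d, hd, hne⟩ := Finset.exists_mem_ne h1 c
  refine ⟨d, fun h => hne ?_⟩
  exact ((Finset.mem_filter.1 hd).2.eq_of_ext h.symm).symm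

theorem exists_adjS_eigenvector (hB : B.Nondegenerate) (hA : B.IsAlt) (hn : 0 < n) :
    ∃ v : SympFlag F n B → ℝ, v ≠ 0 ∧
      adjS F n B *ᵥ v = (-((Fintype.card F : ℝ) ^ (n * (n - 1)))) • v := by
  classical
  obtain ⟨c⟩ := nonempty B hB hA
  obtain ⟨d, hd⟩ := exists_ext_ne hB hA hn c
  set g := lagDiff c d with hg
  let f : ℕ → SympFlag F n B → ℝ := fun j e => subSum g (e.ext j)
  let T : ℕ → Module.End ℝ (SympFlag F n B → ℝ) := fun k => toLinAlgEquiv' (panelMat F n B k)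
  have hf0 : f 0 = 0 := by
    ext e
    simp only [f, hg, subSum_lagDiff]
    rw [ext_zero, inf_bot_eq, inf_bot_eq, sub_self, Pi.zero_apply]
  have hprod : ((List.range n).map T).prod ^ n = toLinAlgEquiv' (adjS F n B) := by
    rw [← prod_panelMat_pow hB hA, map_pow, map_list_prod, List.map_map]
    rfl
  obtain ⟨hC, hCn⟩ := prod_pow_apply_reflection (Fintype.card F : ℝ) n T f hf0
    (fun i hi j hj hij => panelMat_mulVec_subSum_of_ne hB hA g hi hj hij)
    (fun i hi => funext fun e => panelMat_mulVec_subSum hB hA g (by omega) e)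
    (fun i hi => by
      subst hi
      ext e
      refine (panelMat_mulVec_subSum hB hA g i.lt_succ_self e).trans ?_
      rw [hg, subSum_lagDiff_ext_succ hB hA c d e rfl]
      simp only [f, Pi.sub_apply, Pi.smul_apply, smul_eq_mul, ← hg]
      ring) hn
  have hpow := pow_prod_apply_reflection hn _ f hC hCn
  refine ⟨f 1, fun hf1 => ?_, ?_⟩
  · have hzero : ∀ j, j + 1 ≤ n → f (j + 1) = 0 := by
      intro j
      induction j with
      | zero => exact fun _ => hf1
      | succ j ih =>
        intro hj
        have h := hC (j + 1) (by omega) (by omega)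
        rw [ih (by omega), hf1, map_zero, sub_zero, eq_comm, smul_eq_zero] at h
        exact h.resolve_left (by positivity)
    have hfn : f n c = 0 := by
      obtain ⟨k, rfl⟩ : ∃ k, n = k + 1 := ⟨n - 1, by omega⟩
      rw [hzero k le_rfl, Pi.zero_apply]
    simp only [f, hg, subSum_lagDiff] at hfn
    rw [inf_idem] at hfn
    have hF : (1 : ℝ) < Fintype.card F := by exact_mod_cast Fintype.one_lt_card
    have heq := pow_right_injective₀ (zero_lt_one.trans hF) hF.ne' (sub_eq_zero.1 hfn)
    have h1 : d.ext n ⊓ c.ext n = c.ext n := eq_of_le_of_finrank_eq inf_le_right heq.symm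
    exact hd (eq_of_le_of_finrank_eq (inf_eq_right.1 h1)
      (by rw [finrank_ext_of_le c le_rfl, finrank_ext_of_le d le_rfl])).symm
  · rw [hprod, ← pow_mul, mul_comm] at hpow
    exact hpow

end ReflectionRepresentation

theorem neg_le_of_adjS_eigenvector {F : Type} [Field F] [Fintype F] {n : ℕ}
    {B : LinearMap.BilinForm F (Fin (2 * n) → F)} (hB : B.Nondegenerate) (hA : B.IsAlt) {μ : ℝ}
    {v : SympFlag F n B → ℝ} (hv : v ≠ 0) (hμ : adjS F n B *ᵥ v = μ • v) :
    -((Fintype.card F : ℝ) ^ (n * (n - 1))) ≤ μ := by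
  classical
  refine neg_le_of_prod_pow_eigenvector
    (by exact_mod_cast Fintype.one_lt_card.le : (1 : ℝ) ≤ Fintype.card F) n
    (fun k => toLinAlgEquiv' (panelMat F n B k))
    (fun i hi u => panelMat_quadratic hB hA hi u) (toLinAlgEquiv' (adjS F n B)) ?_
    (fun i hi u => ?_) hv hμ
  · rw [← prod_panelMat_pow hB hA, map_pow, map_list_prod, List.map_map]
    rfl
  · change adjS F n B *ᵥ (panelMat F n B i *ᵥ u) = panelMat F n B i *ᵥ (adjS F n B *ᵥ u)
    rw [mulVec_mulVec, mulVec_mulVec, panelMat_mul_adjS hB hA hi]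

end SympFlag

/-- The smallest eigenvalue of the opposition graph on maximal isotropic flags of a
nondegenerate alternating bilinear form on `F_q^(2n)` is `-q^(n(n-1))`. -/
theorem symplectic_smallest_eigenvalue (F : Type) [Field F] [Fintype F] (q : ℕ)
    (hq : Fintype.card F = q) (n : ℕ) (hn : 2 ≤ n)
    (B : LinearMap.BilinForm F (Fin (2 * n) → F))
    (hB : B.Nondegenerate) (hBalt : ∀ v, B v v = 0) :
    (∃ v : SympFlag F n B → ℝ, v ≠ 0 ∧
        (adjS F n B).mulVec v = (-((q : ℝ) ^ (n * (n - 1)))) • v) ∧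
    (∀ μ : ℝ, (∃ v : SympFlag F n B → ℝ, v ≠ 0 ∧ (adjS F n B).mulVec v = μ • v) →
        -((q : ℝ) ^ (n * (n - 1))) ≤ μ) := by
  subst hq
  exact ⟨SympFlag.exists_adjS_eigenvector hB hBalt (by omega),
    fun μ ⟨_, hv, hμ⟩ => SympFlag.neg_le_of_adjS_eigenvector hB hBalt hv hμ⟩
end
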